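/- Let F be a number field and X a central simple F-algebra whose Brauer class is 2-torsion. Then X is isomorphic either to a matrix algebra M_n(F) or to a matrix algebra M_n(D) over a quaternion division algebra D over F. -/

import Mathlib

open scoped TensorProduct

namespace TwoTorsionCSA

open scoped WithZero NumberField
open IsDedekindDomain

set_option linter.unusedSectionVars false

section NearSq

variable {K : Type*} [Field K] [CharZero K] (V : Valuation K ℤᵐ⁰)

/-- `x` is close enough to a square to be a square in the completion at `V`. -/
def NearSq (x : K) : Prop := ∃ y e : K, y ≠ 0 ∧ V e < 1 ∧ x = y ^ 2 * (1 + 4 * e)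

variable {V}

lemma val_natCast_le (n : ℕ) : V (n : K) ≤ 1 := by
  induction n with
  | zero => simp
  | succ n ih =>
    rw [Nat.cast_succ]
    exact (V.map_add _ _).trans (by simp [ih])

lemma val_two_le : V (2 : K) ≤ 1 := by simpa using val_natCast_le (V := V) 2

lemma val_four_le : V (4 : K) ≤ 1 := by simpa using val_natCast_le (V := V) 4

lemma val_add_lt {x y : K} {g : ℤᵐ⁰} (hx : V x < g) (hy : V y < g) : V (x + y) < g :=
  V.map_add_lt hx hy

lemma val_mul_lt_one {x y : K} (hx : V x ≤ 1) (hy : V y < 1) : V (x * y) < 1 := by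
  rw [map_mul]
  exact mul_lt_one_of_nonneg_of_lt_one_right hx (zero_le) hy

lemma val_one_add {e : K} (he : V e < 1) : V (1 + e) = 1 :=
  V.map_one_add_of_lt he

lemma ne_zero_of_val_eq_one {x : K} (h : V x = 1) : x ≠ 0 := by
  rintro rfl; simp at h

lemma NearSq.ne_zero {x : K} (h : NearSq V x) : x ≠ 0 := by
  obtain ⟨y, e, hy, he, rfl⟩ := h
  have := ne_zero_of_val_eq_one (val_one_add (val_mul_lt_one val_four_le he))
  positivity

lemma nearSq_sq {y : K} (hy : y ≠ 0) : NearSq V (y ^ 2) := ⟨y, 0, hy, by simp, by ring⟩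

lemma NearSq.mul {x x' : K} (h : NearSq V x) (h' : NearSq V x') : NearSq V (x * x') := by
  obtain ⟨y, e, hy, he, rfl⟩ := h
  obtain ⟨y', e', hy', he', rfl⟩ := h'
  refine ⟨y * y', e + e' + 4 * e * e', mul_ne_zero hy hy', ?_, by ring⟩
  refine val_add_lt (val_add_lt he he') (val_mul_lt_one ?_ he')
  exact (val_mul_lt_one val_four_le he).le

lemma NearSq.inv {x : K} (h : NearSq V x) : NearSq V x⁻¹ := by
  have hx := h.ne_zero
  have := h.mul (nearSq_sq (V := V) (inv_ne_zero hx))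
  rwa [show x * x⁻¹ ^ 2 = x⁻¹ by field_simp] at this

lemma NearSq.of_mul_sq {x y : K} (h : NearSq V (x * y ^ 2)) : NearSq V x := by
  have h0 := h.ne_zero
  have hy : y ≠ 0 := by rintro rfl; simp at h0
  have := h.mul (nearSq_sq (V := V) (inv_ne_zero hy))
  rwa [show x * y ^ 2 * y⁻¹ ^ 2 = x by field_simp] at this

lemma nearSq_of_sub_one {x : K} (h : V (x - 1) < V 4) : NearSq V x := by
  refine ⟨1, (x - 1) / 4, one_ne_zero, ?_, by field_simp; ring⟩
  rw [map_div₀]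
  exact (div_lt_one₀ (by simp [zero_lt_iff])).2 h

lemma nearSq_of_sub_sq {x y : K} (h : V (x - y ^ 2) < V (4 * y ^ 2)) : NearSq V x := by
  have hy : y ≠ 0 := by rintro rfl; simp at h
  have : NearSq V (x / y ^ 2) := by
    refine nearSq_of_sub_one ?_
    rw [show x / y ^ 2 - 1 = (x - y ^ 2) / y ^ 2 by field_simp, map_div₀]
    rw [map_mul] at h
    exact (div_lt_iff₀ (by simp [zero_lt_iff, hy])).2 h
  have := this.mul (nearSq_sq (V := V) hy)
  rwa [div_mul_cancel₀ _ (by positivity)] at this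

lemma exists_pow_lt_val {g : ℤᵐ⁰} (hg : g < 1) {d : K} (hd : d ≠ 0) : ∃ n : ℕ, g ^ n < V d :=
  exists_pow_lt₀ hg (Units.mk0 (V d) (by simpa using hd))

lemma NearSq.refine {x : K} (h : NearSq V x) {d : K} (hd : d ≠ 0) :
    ∃ y e : K, y ≠ 0 ∧ V e < 1 ∧ V e < V d ∧ x = y ^ 2 * (1 + 4 * e) := by
  obtain ⟨y, e, hy, he, hx⟩ := h
  have key : ∀ n : ℕ, ∃ y' e' : K, y' ≠ 0 ∧ V e' ≤ V e ^ (n + 1) ∧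
      x = y' ^ 2 * (1 + 4 * e') := by
    intro n
    induction n with
    | zero => exact ⟨y, e, hy, by simp, hx⟩
    | succ n ih =>
      obtain ⟨y', e', hy', he', hx'⟩ := ih
      have he1 : V e' < 1 := he'.trans_lt (pow_lt_one₀ (zero_le) he (by simp))
      have h1 : V (1 + 2 * e') = 1 := val_one_add (val_mul_lt_one val_two_le he1)
      have h0 := ne_zero_of_val_eq_one h1
      refine ⟨y' * (1 + 2 * e'), - e' ^ 2 / (1 + 2 * e') ^ 2, by positivity, ?_, ?_⟩
      · rw [map_div₀, Valuation.map_neg, map_pow, map_pow, h1, one_pow, div_one]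
        calc V e' ^ 2 ≤ (V e ^ (n + 1)) ^ 2 := by gcongr
          _ = V e ^ (n + 1 + 1) * V e ^ n := by
            rw [← pow_mul, ← pow_add]; congr 1; ring
          _ ≤ V e ^ (n + 1 + 1) * 1 := by gcongr; exact pow_le_one₀ (zero_le) he.le
          _ = _ := by simp
      · have h2 : ∀ u : K, u ≠ 0 → u ^ 2 * (1 + 4 * (-e' ^ 2 / u ^ 2)) = u ^ 2 - 4 * e' ^ 2 := by
          intro u hu; field_simp; ring
        rw [hx', mul_pow, mul_assoc, h2 _ h0]; ring
  obtain ⟨n, hn⟩ := exists_pow_lt_val he hd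
  obtain ⟨y', e', hy', he', hx'⟩ := key n
  have : V e ^ (n + 1) ≤ V e ^ n := pow_le_pow_of_le_one (zero_le) he.le (by simp)
  exact ⟨y', e', hy', he'.trans_lt (pow_lt_one₀ (zero_le) he (by simp)),
    (he'.trans this).trans_lt hn, hx'⟩

variable (V) in
/-- The subgroup of near squares. -/
def nsq : Subgroup Kˣ where
  carrier := {x | NearSq V (x : K)}
  one_mem' := by simpa using nearSq_sq (V := V) (one_ne_zero (α := K))
  mul_mem' := fun h h' => by simpa using NearSq.mul h h'
  inv_mem' := fun h => by simpa using NearSq.inv h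

lemma mem_nsq {x : Kˣ} : x ∈ nsq V ↔ NearSq V (x : K) := Iff.rfl

/-- if `(r-1)(r+1)` is small then `r` is close to `1` or `-1`. -/
lemma near_one_or_neg_one {r c : K} (h : V (r ^ 2 - 1) < V c * V c) :
    V (r - 1) < V c ∨ V (r + 1) < V c := by
  by_contra! hc
  rw [show r ^ 2 - 1 = (r - 1) * (r + 1) by ring, map_mul] at h
  exact absurd h (not_lt.2 (mul_le_mul' hc.1 hc.2))

end NearSq

/-- `b` is a norm from `K(√a)`. -/
def Sol (K : Type*) [Field K] (a b : K) : Prop := ∃ p q : K, p ^ 2 - a * q ^ 2 = b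

/-- `L = K(r)` with `r ^ 2 = a` and `σ` is the nontrivial automorphism. -/
structure IsQuad (K L : Type*) [Field K] [Field L] [Algebra K L] (a : K) (r : L)
    (σ : L ≃ₐ[K] L) : Prop where
  sq : r ^ 2 = algebraMap K L a
  conj : σ r = -r
  ne : r ≠ 0
  span : ∀ z : L, ∃ p q : K, z = algebraMap K L p + algebraMap K L q * r

lemma Sol.mul {K : Type*} [Field K] {a b c : K} (h : Sol K a b) (h' : Sol K a c) :
    Sol K a (b * c) := by
  obtain ⟨p, q, rfl⟩ := h
  obtain ⟨p', q', rfl⟩ := h'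
  exact ⟨p * p' + a * q * q', p * q' + q * p', by ring⟩

lemma Sol.sq {K : Type*} [Field K] (a c : K) : Sol K a (c ^ 2) := ⟨c, 0, by ring⟩

lemma Sol.of_isSquare {K : Type*} [Field K] (h2 : (2 : K) ≠ 0) {a b : K} (ha : IsSquare a)
    (ha0 : a ≠ 0) : Sol K a b := by
  obtain ⟨c, rfl⟩ := ha
  have hc : c ≠ 0 := by rintro rfl; simp at ha0
  refine ⟨(b + 1) / 2, (b - 1) / (2 * c), ?_⟩
  field_simp
  ring

namespace IsQuad

variable {K L : Type*} [Field K] [CharZero K] [Field L] [Algebra K L] {a : K} {r : L}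
  {σ : L ≃ₐ[K] L}

lemma ne_zero (h : IsQuad K L a r σ) : a ≠ 0 := by
  rintro rfl
  have := h.sq
  simp [h.ne] at this

lemma charZeroL (_ : IsQuad K L a r σ) : CharZero L :=
  charZero_of_injective_algebraMap (algebraMap K L).injective

lemma conj_conj (h : IsQuad K L a r σ) (z : L) : σ (σ z) = z := by
  obtain ⟨p, q, rfl⟩ := h.span z
  simp [h.conj]

lemma mem_of_fixed (h : IsQuad K L a r σ) {z : L} (hz : σ z = z) :
    ∃ p : K, algebraMap K L p = z := by
  have := h.charZeroL
  obtain ⟨p, q, rfl⟩ := h.span z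
  simp only [map_add, map_mul, AlgEquiv.commutes, h.conj] at hz
  have : algebraMap K L q * r = 0 := by linear_combination -(1 / 2) * hz
  exact ⟨p, by simp [this]⟩

lemma norm_mem (h : IsQuad K L a r σ) (z : L) : ∃ p : K, algebraMap K L p = z * σ z :=
  h.mem_of_fixed (by rw [map_mul, h.conj_conj, mul_comm])

lemma sol_iff (h : IsQuad K L a r σ) {b : K} : Sol K a b ↔ ∃ z : L, z * σ z = algebraMap K L b := by
  constructor
  · rintro ⟨p, q, rfl⟩
    refine ⟨algebraMap K L p + algebraMap K L q * r, ?_⟩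
    simp only [map_add, map_mul, AlgEquiv.commutes, h.conj, map_sub, map_pow, ← h.sq]
    ring
  · rintro ⟨z, hz⟩
    obtain ⟨p, q, rfl⟩ := h.span z
    refine ⟨p, q, (algebraMap K L).injective ?_⟩
    rw [← hz]
    simp only [map_add, map_mul, AlgEquiv.commutes, h.conj, map_sub, map_pow, ← h.sq]
    ring

end IsQuad

section LocalQuad

variable {K L : Type*} [Field K] [CharZero K] [Field L] [CharZero L] [Algebra K L] {a : K} {r : L}
  {σ : L ≃ₐ[K] L} {V : Valuation K ℤᵐ⁰} {W : Valuation L ℤᵐ⁰}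

lemma val_lt_iff (hVW : (W.comap (algebraMap K L)).IsEquiv V) {x y : K} :
    W (algebraMap K L x) < W (algebraMap K L y) ↔ V x < V y :=
  hVW.lt_iff_lt

lemma NearSq.map (hVW : (W.comap (algebraMap K L)).IsEquiv V) {x : K} (h : NearSq V x) :
    NearSq W (algebraMap K L x) := by
  obtain ⟨y, e, hy, he, rfl⟩ := h
  refine ⟨algebraMap K L y, algebraMap K L e, by simpa using hy, ?_, by simp [map_ofNat]⟩
  simpa using (val_lt_iff hVW (x := e) (y := 1)).2 (by simpa using he)

lemma nearSq_of_map_sub_sq (hVW : (W.comap (algebraMap K L)).IsEquiv V) {x y : K}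
    (h : W (algebraMap K L x - algebraMap K L y ^ 2) < W (4 * algebraMap K L y ^ 2)) :
    NearSq V x := by
  refine nearSq_of_sub_sq (y := y) ((val_lt_iff hVW).1 ?_)
  rwa [map_sub, map_mul, map_pow, map_ofNat]

lemma val_sub_sq_lt {x z e s : L} (hx : x = z ^ 2 * (1 + 4 * e)) (he : W e < 1)
    (hs : W (s / z - 1) < W 2) (hz : z ≠ 0) : W (x - s ^ 2) < W (4 * s ^ 2) := by
  set d := s / z - 1 with hd
  have hsz : s = z * (1 + d) := by rw [hd]; field_simp; ring
  have hd1 : W d < 1 := hs.trans_le val_two_le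
  have h20 : 0 < W (2 : L) := by simp [zero_lt_iff]
  have h4 : W (4 : L) = W 2 * W 2 := by rw [← map_mul]; norm_num
  have h40 : 0 < W (4 : L) := by simp [zero_lt_iff]
  have e1 : x - s ^ 2 = z ^ 2 * (4 * e - 2 * d - d * d) := by rw [hx, hsz]; ring
  have e2 : W (4 * s ^ 2) = W (z ^ 2) * W 4 := by
    rw [hsz, mul_pow, map_mul, map_mul, map_pow W (1 + d), val_one_add hd1]; simp [mul_comm]
  rw [e1, e2, map_mul]
  refine mul_lt_mul_of_pos_left ?_ (by simp [zero_lt_iff, hz])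
  refine W.map_sub_lt (W.map_sub_lt ?_ ?_) ?_
  · rw [map_mul]; exact mul_lt_of_lt_one_right h40 he
  · rw [map_mul, h4]; exact mul_lt_mul_of_pos_left hs h20
  · rw [map_mul, h4]; exact mul_lt_mul'' hs hs zero_le zero_le

lemma nearSq_descend_aux (h : IsQuad K L a r σ) (hW : ∀ z, W (σ z) = W z)
    (hVW : (W.comap (algebraMap K L)).IsEquiv V) {x : K} {z e : L} (hz : z ≠ 0) (he : W e < 1)
    (hxz : algebraMap K L x = z ^ 2 * (1 + 4 * e)) (h1 : W (z / σ z - 1) < W 4) :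
    NearSq V x := by
  obtain ⟨y, hy⟩ := h.mem_of_fixed (z := (z + σ z) / 2) (by
    simp [h.conj_conj, add_comm, map_ofNat])
  refine nearSq_of_map_sub_sq hVW (y := y) ?_
  have hσz : σ z ≠ 0 := by simpa using hz
  have hx' : algebraMap K L x = σ z ^ 2 * (1 + 4 * σ e) := by
    simpa [map_ofNat] using congrArg σ hxz
  refine val_sub_sq_lt hx' (by rwa [hW]) ?_ hσz
  rw [hy, show (z + σ z) / 2 / σ z - 1 = (z / σ z - 1) / 2 by field_simp; ring, map_div₀]
  refine (div_lt_iff₀ (by simp [zero_lt_iff])).2 ?_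
  rwa [← map_mul, show (2 : L) * 2 = 4 by norm_num]

/-- Elements of `K` near squares at `W` are near `1` or `a` modulo squares at `V`. -/
lemma NearSq.descend (h : IsQuad K L a r σ) (hW : ∀ z, W (σ z) = W z)
    (hVW : (W.comap (algebraMap K L)).IsEquiv V) {x : K} (hx : NearSq W (algebraMap K L x)) :
    NearSq V x ∨ NearSq V (a * x) := by
  obtain ⟨z, e, hz, he, he2, hxz⟩ := hx.refine (d := 16) (by norm_num)
  have hσz : σ z ≠ 0 := by simpa using hz
  have hσe : W (σ e) < W 16 := by rw [hW]; exact he2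
  have hx' : algebraMap K L x = σ z ^ 2 * (1 + 4 * σ e) := by
    simpa [map_ofNat] using congrArg σ hxz
  have h41 : W (1 + 4 * e) = 1 := val_one_add (val_mul_lt_one val_four_le he)
  have h40 := ne_zero_of_val_eq_one h41
  have hsq : (z / σ z) ^ 2 - 1 = 4 * (σ e - e) / (1 + 4 * e) := by
    rw [hxz] at hx'
    rw [div_pow, div_sub_one (by positivity), div_eq_div_iff (by positivity) h40]
    linear_combination hx'
  have hlt : W ((z / σ z) ^ 2 - 1) < W 4 * W 4 := by
    rw [hsq, map_div₀, h41, div_one, map_mul]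
    refine mul_lt_mul_of_pos_left ?_ (by simp [zero_lt_iff])
    have h16 : W 16 ≤ W 4 := by
      rw [show (16 : L) = 4 * 4 by norm_num, map_mul]
      exact mul_le_of_le_one_left' val_four_le
    exact (W.map_sub_lt hσe he2).trans_le h16
  rcases near_one_or_neg_one hlt with h1 | h1
  · exact Or.inl (nearSq_descend_aux h hW hVW hz he hxz h1)
  · right
    refine nearSq_descend_aux h hW hVW (z := z * r) (e := e) (mul_ne_zero hz h.ne) he ?_ ?_
    · rw [map_mul, hxz, ← h.sq]; ring
    · have hr := h.ne
      rw [map_mul, h.conj, show z * r / (σ z * -r) - 1 = -(z / σ z + 1) by field_simp; ring,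
        Valuation.map_neg]
      exact h1

lemma NearSq.norm (h : IsQuad K L a r σ) (hW : ∀ z, W (σ z) = W z)
    (hVW : (W.comap (algebraMap K L)).IsEquiv V) {x : L} (hx : NearSq W x) {b : K}
    (hb : algebraMap K L b = x * σ x) : NearSq V b := by
  obtain ⟨z, e, hz, he, hxz⟩ := hx
  obtain ⟨y, hy⟩ := h.norm_mem z
  have hσz : σ z ≠ 0 := by simpa using hz
  refine nearSq_of_map_sub_sq hVW (y := y) ?_
  have hb' : algebraMap K L b = (z * σ z) ^ 2 * (1 + 4 * (e + σ e + 4 * e * σ e)) := by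
    rw [hb, hxz]
    simp only [map_mul, map_add, map_pow, map_one, map_ofNat]
    ring
  have hσe : W (σ e) < 1 := by rwa [hW]
  refine val_sub_sq_lt hb' ?_ ?_ (mul_ne_zero hz hσz)
  · refine val_add_lt (val_add_lt he hσe) (val_mul_lt_one ?_ hσe)
    exact (val_mul_lt_one val_four_le he).le
  · rw [hy, div_self (mul_ne_zero hz hσz)]
    simp [zero_lt_iff]

/-- If the norm of `x` is near a square then `x` is in `K` up to near squares. -/
lemma NearSq.of_norm (h : IsQuad K L a r σ) (hW : ∀ z, W (σ z) = W z)
    (hVW : (W.comap (algebraMap K L)).IsEquiv V) {x : L} {b : K}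
    (hb : algebraMap K L b = x * σ x) (hbs : NearSq V b) :
    ∃ c : K, c ≠ 0 ∧ NearSq W (algebraMap K L c * x) := by
  obtain ⟨y, e, hy, he, he8, hby⟩ := hbs.refine (d := 8) (by norm_num)
  have hy' : algebraMap K L y ≠ 0 := by simpa using hy
  have hE : W (algebraMap K L (4 * e)) < W 4 * W 8 := by
    rw [map_mul, map_ofNat, map_mul]
    refine mul_lt_mul_of_pos_left ?_ (by simp [zero_lt_iff])
    simpa [map_ofNat] using (val_lt_iff hVW).2 he8
  set E := algebraMap K L (4 * e)
  have main : ∀ u : L, u * σ u = 1 + E → W 2 ≤ W (1 + σ u) →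
      ∃ c : K, c ≠ 0 ∧ NearSq W (algebraMap K L c * u) := by
    intro u hu hz
    obtain ⟨m, hm⟩ := h.norm_mem (1 + σ u)
    rw [map_add, map_one, h.conj_conj] at hm
    have hz0 : 1 + σ u ≠ 0 := by rintro h0; simp [h0] at hz
    have hz1 : 1 + u ≠ 0 := by
      intro h0; apply hz0
      have := congrArg σ h0
      simpa using this
    have hm0 : algebraMap K L m ≠ 0 := by rw [hm]; exact mul_ne_zero hz0 hz1
    have hm0' : m ≠ 0 := by simpa using hm0
    have hW1 : W (1 + u) = W (1 + σ u) := by rw [← hW (1 + u)]; simp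
    refine ⟨m⁻¹, by simpa using hm0', ?_⟩
    have : NearSq W (algebraMap K L m⁻¹ * u * (1 + σ u) ^ 2) := by
      refine nearSq_of_sub_one ?_
      have : algebraMap K L m⁻¹ * u * (1 + σ u) ^ 2 - 1 = E / (1 + u) := by
        rw [map_inv₀, hm]
        field_simp
        linear_combination hu
      rw [this, map_div₀, hW1]
      refine (div_lt_iff₀ (lt_of_lt_of_le (by simp [zero_lt_iff]) hz)).2 (hE.trans_le ?_)
      refine mul_le_mul' le_rfl (le_trans ?_ hz)
      rw [show (8 : L) = 4 * 2 by norm_num, map_mul]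
      exact mul_le_of_le_one_left' val_four_le
    exact this.of_mul_sq
  have hx0 : algebraMap K L y * algebraMap K L y⁻¹ = 1 := by
    rw [map_inv₀]; exact mul_inv_cancel₀ hy'
  have hu : (x * algebraMap K L y⁻¹) * σ (x * algebraMap K L y⁻¹) = 1 + E := by
    have h1 : algebraMap K L b = algebraMap K L y ^ 2 * (1 + E) := by
      rw [hby]; simp [E]
    rw [map_mul, AlgEquiv.commutes, map_inv₀]
    field_simp
    rw [← hb, h1]
  set u := x * algebraMap K L y⁻¹ with hudef
  have fin : ∀ s : K, s ≠ 0 →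
      (∃ c : K, c ≠ 0 ∧ NearSq W (algebraMap K L c * (algebraMap K L s * u))) →
      ∃ c : K, c ≠ 0 ∧ NearSq W (algebraMap K L c * x) := by
    rintro s hs ⟨c, hc, hcu⟩
    refine ⟨c * s * y⁻¹, by positivity, ?_⟩
    rw [hudef] at hcu
    convert hcu using 1
    simp only [map_mul]; ring
  by_cases hz : W 2 ≤ W (1 + σ u)
  · exact fin 1 one_ne_zero (by simpa using main u hu hz)
  · refine fin (-1) (by norm_num) ?_
    have := main (-u) (by simpa using hu) ?_
    · simpa using this
    · rw [map_neg, show 1 + -σ u = 2 - (1 + σ u) by ring]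
      rw [Valuation.map_sub_eq_of_lt_left _ (not_le.1 hz)]

/-- If the valuation is conjugation invariant, `a` is not near a square. -/
lemma not_nearSq_of_inv (h : IsQuad K L a r σ) (hW : ∀ z, W (σ z) = W z)
    (hVW : (W.comap (algebraMap K L)).IsEquiv V) : ¬ NearSq V a := by
  intro ha
  obtain ⟨y, e, hy, he, hay⟩ := ha
  have he' : W (algebraMap K L e) < 1 := by
    simpa using (val_lt_iff hVW (x := e) (y := 1)).2 (by simpa using he)
  have hy' : algebraMap K L y ≠ 0 := by simpa using hy
  set u := r / algebraMap K L y with hu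
  have hσu : σ u = -u := by rw [hu, map_div₀, h.conj, AlgEquiv.commutes, neg_div]
  have h1 : W (u ^ 2 - 1) < W 2 * W 2 := by
    rw [hu, div_pow, h.sq, hay]
    simp only [map_mul, map_add, map_pow, map_one, map_ofNat]
    rw [mul_div_cancel_left₀ _ (by positivity), ← map_mul,
      show (1 + 4 * algebraMap K L e - 1) = 2 * 2 * algebraMap K L e by ring, map_mul W (2 * 2)]
    exact mul_lt_of_lt_one_right (by simp [zero_lt_iff]) he'
  have h2 : W (u + 1) = W (u - 1) := by
    rw [← hW (u + 1), map_add, hσu, map_one, ← Valuation.map_neg, neg_add, neg_neg, sub_eq_add_neg]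
  have h3 : W (u - 1) < W 2 := by
    rcases near_one_or_neg_one h1 with h1 | h1
    · exact h1
    · rwa [← h2]
  have := W.map_sub_lt (h2.trans_lt h3) h3
  rw [show u + 1 - (u - 1) = 2 by ring] at this
  exact lt_irrefl _ this

end LocalQuad

/-- A finite prime of a number field. -/
abbrev Prm (K : Type*) [Field K] := HeightOneSpectrum (𝓞 K)

/-- The valuation of a finite prime. -/
noncomputable abbrev Prm.val {K : Type*} [Field K] [NumberField K] (v : Prm K) :
    Valuation K ℤᵐ⁰ := v.valuation K

section

variable {K : Type*} [Field K] [NumberField K]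

lemma Prm.val_le_one (v : Prm K) (x : 𝓞 K) : v.val (x : K) ≤ 1 :=
  HeightOneSpectrum.valuation_le_one v x

lemma Prm.val_lt_one_iff (v : Prm K) (x : 𝓞 K) : v.val (x : K) < 1 ↔ x ∈ v.asIdeal :=
  v.valuation_lt_one_iff_mem x

lemma Prm.val_eq_one_iff (v : Prm K) (x : 𝓞 K) : v.val (x : K) = 1 ↔ x ∉ v.asIdeal := by
  rw [← Prm.val_lt_one_iff, not_lt, (v.val_le_one x).ge_iff_eq', eq_comm]

lemma Prm.val_le_pow_iff (v : Prm K) (x : 𝓞 K) (n : ℕ) :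
    v.val (x : K) ≤ WithZero.exp (-(n : ℤ)) ↔ x ∈ v.asIdeal ^ n := by
  rw [← v.intValuation_le_pow_iff_mem x n]
  exact (by rw [← v.valuation_of_algebraMap (K := K)])

lemma exists_exp_lt {g : ℤᵐ⁰} (hg : g ≠ 0) : ∃ N : ℕ, ∀ n ≥ N, WithZero.exp (-(n : ℤ)) < g := by
  refine ⟨(-(WithZero.log g) + 1).toNat, fun n hn => ?_⟩
  rw [← WithZero.exp_log hg, WithZero.exp_lt_exp]
  omega

lemma Prm.exists_pow_small (v : Prm K) {d : K} (hd : d ≠ 0) :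
    ∃ N : ℕ, ∀ n ≥ N, ∀ x ∈ v.asIdeal ^ n, v.val ((x : 𝓞 K) : K) < v.val d := by
  obtain ⟨N, hN⟩ := exists_exp_lt (g := v.val d) (by simpa using hd)
  exact ⟨N, fun n hn x hx => ((v.val_le_pow_iff x n).2 hx).trans_lt (hN n hn)⟩

lemma Prm.eq_of_le {v w : Prm K} (h : v.asIdeal ≤ w.asIdeal) : v = w :=
  HeightOneSpectrum.ext (v.isMaximal.eq_of_le w.isPrime.ne_top h)

lemma Prm.isCoprime_pow {v w : Prm K} (h : v ≠ w) (m n : ℕ) :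
    IsCoprime (v.asIdeal ^ m) (w.asIdeal ^ n) := by
  refine IsCoprime.pow ?_
  rw [Ideal.isCoprime_iff_sup_eq]
  exact v.isMaximal.coprime_of_ne w.isMaximal fun e => h (HeightOneSpectrum.ext e)

/-- Finiteness of the support. -/
lemma finite_val_ne_one {x : K} (hx : x ≠ 0) : {v : Prm K | v.val x ≠ 1}.Finite := by
  have key : ∀ y : 𝓞 K, y ≠ 0 → {v : Prm K | v.val (y : K) ≠ 1}.Finite := by
    intro y hy
    refine (Ideal.finite_factors (I := Ideal.span {y}) (by simpa using hy)).subset ?_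
    intro v hv
    have : Prm.val v (y : K) < 1 := lt_of_le_of_ne (Prm.val_le_one v y) hv
    rw [Prm.val_lt_one_iff] at this
    simpa [Ideal.dvd_span_singleton] using this
  obtain ⟨y, z, hz, rfl⟩ := IsFractionRing.div_surjective (A := 𝓞 K) x
  have hz0 : z ≠ 0 := nonZeroDivisors.ne_zero hz
  have hy0 : y ≠ 0 := by rintro rfl; simp at hx
  refine ((key y hy0).union (key z hz0)).subset ?_
  intro v hv
  by_contra hc
  simp only [Set.mem_union, Set.mem_ofPred_eq, not_or, not_not] at hc
  apply hv
  rw [map_div₀]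
  erw [hc.1, hc.2]
  simp

end

section Quad

variable (K : Type*) {L : Type*} [Field K] [NumberField K] [Field L] [NumberField L] [Algebra K L]

/-- The prime below. -/
noncomputable def below (w : Prm L) : Prm K where
  asIdeal := w.asIdeal.under (𝓞 K)
  isPrime := inferInstance
  ne_bot := by
    have : Algebra.IsIntegral (𝓞 K) (𝓞 L) := inferInstance
    exact mt Ideal.eq_bot_of_comap_eq_bot w.ne_bot

variable {K}

lemma below_isEquiv (w : Prm L) :
    (w.val.comap (algebraMap K L)).IsEquiv (below K w).val := by
  have : w.asIdeal.LiesOver (below K w).asIdeal := ⟨rfl⟩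
  intro x y
  simp only [Valuation.comap_apply]
  rw [← HeightOneSpectrum.valuation_liesOver L (below K w) w,
    ← HeightOneSpectrum.valuation_liesOver L (below K w) w]
  exact pow_le_pow_iff_left₀ zero_le zero_le
    (Ideal.IsDedekindDomain.ramificationIdx'_ne_zero_of_liesOver w.asIdeal (below K w).ne_bot)

lemma exists_above (v : Prm K) : ∃ w : Prm L, below K w = v := by
  have := v.isMaximal
  obtain ⟨Q, hQ, hl⟩ := Ideal.exists_maximal_ideal_liesOver_of_isIntegral (S := 𝓞 L) v.asIdeal
  refine ⟨⟨Q, hQ.isPrime, ?_⟩, HeightOneSpectrum.ext hl.over.symm⟩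
  rintro rfl
  apply v.ne_bot
  rw [hl.over]
  ext x
  simp

/-- The image of a prime under an automorphism. -/
noncomputable def conjPrm (σ : L ≃ₐ[K] L) (w : Prm L) : Prm L where
  asIdeal := w.asIdeal.comap (NumberField.RingOfIntegers.mapRingEquiv (σ : L ≃+* L) : 𝓞 L →+* 𝓞 L)
  isPrime := inferInstance
  ne_bot := by
    intro h
    apply w.ne_bot
    rw [eq_bot_iff]
    intro x hx
    have : (NumberField.RingOfIntegers.mapRingEquiv (σ : L ≃+* L)).symm x ∈
      w.asIdeal.comap (NumberField.RingOfIntegers.mapRingEquiv (σ : L ≃+* L) : 𝓞 L →+* 𝓞 L) := by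
      rw [Ideal.mem_comap]
      change (NumberField.RingOfIntegers.mapRingEquiv (σ : L ≃+* L))
        ((NumberField.RingOfIntegers.mapRingEquiv (σ : L ≃+* L)).symm x) ∈ w.asIdeal
      rwa [RingEquiv.apply_symm_apply]
    rw [h] at this
    simpa using this

lemma conjPrm_val (σ : L ≃ₐ[K] L) (w : Prm L) (z : L) : (conjPrm σ w).val z = w.val (σ z) := by
  set e := NumberField.RingOfIntegers.mapRingEquiv (σ : L ≃+* L)
  have hpow : ∀ n (x : 𝓞 L), x ∈ (conjPrm σ w).asIdeal ^ n ↔ e x ∈ w.asIdeal ^ n := by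
    intro n x
    have h1 : ((conjPrm σ w).asIdeal).map (e : 𝓞 L →+* 𝓞 L) = w.asIdeal :=
      Ideal.map_comap_of_surjective (e : 𝓞 L →+* 𝓞 L) e.surjective w.asIdeal
    rw [← h1, ← Ideal.map_pow]
    refine ⟨fun h => Ideal.mem_map_of_mem (e : 𝓞 L →+* 𝓞 L) h, fun h => ?_⟩
    obtain ⟨y, hy, hxy⟩ := (Ideal.mem_map_iff_of_surjective (e : 𝓞 L →+* 𝓞 L) e.surjective).1 h
    rwa [← e.injective hxy]
  have h_int : ∀ x : 𝓞 L, (conjPrm σ w).val (x : L) = w.val ((e x : 𝓞 L) : L) := by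
    intro x
    by_cases hx : x = 0
    · simp [hx]
    have h1 : ∀ g : ℤᵐ⁰, ∀ g' : ℤᵐ⁰, g ≠ 0 → g' ≠ 0 → g ≤ 1 → g' ≤ 1 →
        (∀ n : ℕ, g ≤ WithZero.exp (-(n : ℤ)) ↔ g' ≤ WithZero.exp (-(n : ℤ))) → g = g' := by
      intro g g' hg hg' hg1 hg1' hn
      rw [← WithZero.exp_log hg, ← WithZero.exp_log hg'] at *
      rw [← WithZero.exp_zero] at hg1 hg1'
      simp only [WithZero.exp_le_exp] at hn hg1 hg1'
      have e1 := hn (-WithZero.log g).toNat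
      have e2 := hn (-WithZero.log g').toNat
      congr 1
      omega
    refine h1 _ _ (by simpa using hx) (by simpa using hx) (Prm.val_le_one _ _)
      (Prm.val_le_one _ _) fun n => ?_
    rw [Prm.val_le_pow_iff, Prm.val_le_pow_iff, hpow]
  obtain ⟨y, z, hz, rfl⟩ := IsFractionRing.div_surjective (A := 𝓞 L) z
  rw [map_div₀, map_div₀, map_div₀]
  congr 1
  · exact h_int y
  · exact h_int z

variable {a : K} {r : L} {σ : L ≃ₐ[K] L}

lemma below_conjPrm (w : Prm L) : below K (conjPrm σ w) = below K w := by
  apply HeightOneSpectrum.ext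
  ext x
  rw [← Prm.val_lt_one_iff, ← Prm.val_lt_one_iff]
  have h1 := val_lt_iff (below_isEquiv (K := K) (conjPrm σ w)) (x := (x : K)) (y := 1)
  have h2 := val_lt_iff (below_isEquiv (K := K) w) (x := (x : K)) (y := 1)
  rw [conjPrm_val, AlgEquiv.commutes, conjPrm_val, map_one, map_one] at h1
  rw [map_one, map_one, map_one] at h2
  rw [map_one, map_one] at h1
  rw [← h1, ← h2]

/-- If a prime is conjugation invariant it is the only one over the base prime. -/
lemma eq_of_below_eq (h : IsQuad K L a r σ) {w w' : Prm L} (hw : conjPrm σ w = w)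
    (hb : below K w' = below K w) : w' = w := by
  refine Prm.eq_of_le fun z hz => ?_
  rw [← Prm.val_lt_one_iff] at hz ⊢
  obtain ⟨m, hm⟩ := h.norm_mem (z : L)
  have hσ : ∀ z, w.val (σ z) = w.val z := fun z => by rw [← conjPrm_val, hw]
  have h1 := val_lt_iff (below_isEquiv (K := K) w') (x := m) (y := 1)
  have h2 := val_lt_iff (below_isEquiv (K := K) w) (x := m) (y := 1)
  rw [hb, ← h2, map_one, map_one, map_one, hm, map_mul, map_mul] at h1
  have h3 : w'.val (σ (z : L)) ≤ 1 := by
    rw [← conjPrm_val]; exact Prm.val_le_one _ _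
  have h4 := h1.1 (mul_lt_one_of_nonneg_of_lt_one_left zero_le hz h3)
  rw [hσ] at h4
  by_contra hc
  rw [not_lt] at hc
  exact absurd h4 (not_lt.2 (one_le_mul hc hc))

lemma nearSq_of_conj_ne (h : IsQuad K L a r σ) {w : Prm L} (hw : conjPrm σ w ≠ w) :
    NearSq (below K w).val a := by
  obtain ⟨N, hN⟩ := w.exists_pow_small (d := 4) (by norm_num)
  obtain ⟨N', hN'⟩ := (conjPrm σ w).exists_pow_small (d := 4) (by norm_num)
  obtain ⟨α, hα, β, hβ, hab⟩ :=
    Ideal.isCoprime_iff_exists.1 (Prm.isCoprime_pow (Ne.symm hw) N N')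
  have h4 : (conjPrm σ w).val 4 = w.val 4 := by rw [conjPrm_val, map_ofNat]
  have hα' := hN N le_rfl α hα
  have hβ' := hN' N' le_rfl β hβ
  rw [h4, conjPrm_val] at hβ'
  have hab' : (α : L) + (β : L) = 1 := by exact_mod_cast congrArg (algebraMap (𝓞 L) L) hab
  have hσ : σ (α : L) + σ (β : L) = 1 := by rw [← map_add, hab', map_one]
  obtain ⟨p, q, hpq⟩ := h.span ((β : L) - α)
  have h5 : algebraMap K L q * r - 1 = - (α : L) - σ (β : L) := by
    have := congrArg σ hpq
    simp only [map_add, map_mul, map_sub, AlgEquiv.commutes, h.conj] at this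
    linear_combination (1 / 2 : L) * this - (1 / 2 : L) * hpq + (1/2 : L) * hab' + (1/2 : L) * hσ
  have h6 : w.val (algebraMap K L q * r - 1) < w.val 4 := by
    rw [h5]; exact Valuation.map_sub_lt _ (by rwa [Valuation.map_neg]) hβ'
  have h7 : w.val (algebraMap K L q * r + 1) ≤ 1 := by
    rw [show algebraMap K L q * r + 1 = (algebraMap K L q * r - 1) + 2 by ring]
    exact Valuation.map_add_le _ (h6.le.trans val_four_le) val_two_le
  have h8 : (below K w).val (a * q ^ 2 - 1) < (below K w).val 4 := by
    rw [← val_lt_iff (below_isEquiv (K := K) w), map_ofNat]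
    rw [show algebraMap K L (a * q ^ 2 - 1) = (algebraMap K L q * r - 1) * (algebraMap K L q * r + 1)
      by simp only [map_sub, map_mul, map_pow, map_one, ← h.sq]; ring, map_mul]
    exact (mul_le_of_le_one_right' h7).trans_lt h6
  exact (nearSq_of_sub_one h8).of_mul_sq

lemma conj_ne_iff (h : IsQuad K L a r σ) {w : Prm L} :
    conjPrm σ w ≠ w ↔ NearSq (below K w).val a := by
  refine ⟨nearSq_of_conj_ne h, fun ha hw => ?_⟩
  exact not_nearSq_of_inv h (fun z => by rw [← conjPrm_val, hw]) (below_isEquiv w) ha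

end Quad

section LocalIndex

variable {K : Type*} [Field K] [NumberField K] (v : Prm K)

/-- The local ring at a prime. -/
noncomputable abbrev locRing : ValuationSubring K := v.val.valuationSubring

/-- The ideal of elements of size at most `g`. -/
def ballIdeal (g : ℤᵐ⁰) : Ideal (locRing v) where
  carrier := {x | v.val (x : K) ≤ g}
  zero_mem' := by simp
  add_mem' := fun {x y} hx hy => (v.val.map_add (x : K) y).trans (max_le hx hy)
  smul_mem' := fun c x hx => by
    change v.val ((c : K) * x) ≤ g
    rw [map_mul]
    exact (mul_le_of_le_one_left' c.2).trans hx

lemma mem_ballIdeal {g : ℤᵐ⁰} {x : locRing v} : x ∈ ballIdeal v g ↔ v.val (x : K) ≤ g := Iff.rfl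

/-- Inclusion of the integers in the local ring. -/
noncomputable def toLoc : 𝓞 K →+* locRing v :=
  (algebraMap (𝓞 K) K).codRestrict (locRing v).toSubring fun x => v.val_le_one x

@[simp] lemma toLoc_coe (x : 𝓞 K) : ((toLoc v x : locRing v) : K) = x := rfl

lemma toQuot_surjective {g : ℤᵐ⁰} (hg : g ≠ 0) :
    Function.Surjective ((Ideal.Quotient.mk (ballIdeal v g)).comp (toLoc v)) := by
  intro y
  obtain ⟨x, rfl⟩ := Ideal.Quotient.mk_surjective y
  obtain ⟨a, ha⟩ := v.exists_valuation_sub_lt_of_integer (x := (x : K)) x.2 (Units.mk0 g hg)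
  refine ⟨a, ?_⟩
  rw [RingHom.comp_apply, Ideal.Quotient.eq]
  exact le_of_lt ha

lemma ker_toQuot (n : ℕ) :
    RingHom.ker ((Ideal.Quotient.mk (ballIdeal v (WithZero.exp (-(n : ℤ))))).comp (toLoc v)) =
      v.asIdeal ^ n := by
  ext x
  rw [RingHom.mem_ker, RingHom.comp_apply, Ideal.Quotient.eq_zero_iff_mem, mem_ballIdeal,
    toLoc_coe, Prm.val_le_pow_iff]

lemma exists_exp_neg {g : ℤᵐ⁰} (hg : g ≠ 0) (hg1 : g ≤ 1) :
    ∃ n : ℕ, g = WithZero.exp (-(n : ℤ)) := by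
  refine ⟨(-WithZero.log g).toNat, ?_⟩
  rw [← WithZero.exp_log hg] at hg1 ⊢
  rw [← WithZero.exp_zero, WithZero.exp_le_exp] at hg1
  congr 1
  simp only [WithZero.log_exp]
  omega

/-- The quotient of the local ring by a ball. -/
noncomputable def quotEquiv (n : ℕ) :
    (𝓞 K ⧸ v.asIdeal ^ n) ≃+* (locRing v ⧸ ballIdeal v (WithZero.exp (-(n : ℤ)))) :=
  (Ideal.quotEquivOfEq (ker_toQuot v n).symm).trans
    (RingHom.quotientKerEquivOfSurjective (toQuot_surjective v WithZero.exp_ne_zero))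

lemma finite_quot {g : ℤᵐ⁰} (hg : g ≠ 0) (hg1 : g ≤ 1) : Finite (locRing v ⧸ ballIdeal v g) := by
  obtain ⟨n, rfl⟩ := exists_exp_neg hg hg1
  have : Finite (𝓞 K ⧸ v.asIdeal ^ n) :=
    Ideal.finiteQuotientOfFreeOfNeBot _ (pow_ne_zero n v.ne_bot)
  exact Finite.of_equiv _ (quotEquiv v n).toEquiv

/-- The order of the residue ring modulo `2`. -/
noncomputable def cNum : ℕ := Nat.card (locRing v ⧸ ballIdeal v (v.val 2))

lemma cNum_eq {n : ℕ} (h : v.val 2 = WithZero.exp (-(n : ℤ))) :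
    cNum v = Ideal.absNorm (v.asIdeal ^ n) := by
  rw [cNum, h, Ideal.absNorm_apply, Submodule.cardQuot_apply,
    Nat.card_congr (quotEquiv v n).toEquiv]

lemma cNum_pos : 0 < cNum v := by
  have := finite_quot v (g := v.val 2) (by simp) val_two_le
  exact Nat.card_pos

lemma exists_uniformizer : ∃ π : K, v.val π = WithZero.exp (-1) :=
  v.valuation_exists_uniformizer K

/-- Counting square roots of one modulo `4π`. -/
lemma card_sq_eq_one {π : K} (hπ : v.val π = WithZero.exp (-1)) :
    {x : locRing v ⧸ ballIdeal v (v.val (4 * π)) | x ^ 2 = 1}.ncard = 2 * cNum v := by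
  have hπ1 : v.val π < 1 := by
    rw [hπ, ← WithZero.exp_zero, WithZero.exp_lt_exp]; norm_num
  have hπ0 : π ≠ 0 := by rintro rfl; rw [map_zero] at hπ; exact WithZero.exp_ne_zero hπ.symm
  have hlt : ∀ x : K, v.val x < 1 ↔ v.val x ≤ v.val π := by
    intro x
    rw [hπ]
    by_cases hx : x = 0
    · simp [hx]
    rw [← WithZero.exp_log (x := v.val x) (by simpa using hx), ← WithZero.exp_zero,
      WithZero.exp_lt_exp, WithZero.exp_le_exp]
    omega
  have h2π : v.val (2 * π) ≤ 1 := (val_mul_lt_one val_two_le hπ1).le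
  let c : locRing v := ⟨2 * π, h2π⟩
  let I := ballIdeal v (v.val (4 * π))
  have hfin : Finite (locRing v ⧸ I) := finite_quot v (by simp [hπ0])
    (val_mul_lt_one val_four_le hπ1).le
  let f : locRing v →+ locRing v ⧸ I :=
    (Ideal.Quotient.mk I).toAddMonoidHom.comp (AddMonoidHom.mulLeft c)
  have hf : ∀ t, f t = Ideal.Quotient.mk I (c * t) := fun t => rfl
  have hker : f.ker = (ballIdeal v (v.val 2)).toAddSubgroup := by
    ext t
    rw [AddMonoidHom.mem_ker, hf, Ideal.Quotient.eq_zero_iff_mem, mem_ballIdeal]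
    change v.val (2 * π * (t : K)) ≤ v.val (4 * π) ↔ v.val (t : K) ≤ v.val 2
    rw [show (4 : K) * π = 2 * π * 2 by ring, map_mul v.val (2 * π), map_mul v.val (2 * π)]
    exact mul_le_mul_iff_right₀ (by simp [zero_lt_iff, hπ0])
  have hcard : Nat.card f.range = cNum v := by
    rw [← AddSubgroup.index_ker, hker]
    rfl
  have hset : {x : locRing v ⧸ I | x ^ 2 = 1} =
      (fun t => 1 + t) '' (f.range : Set (locRing v ⧸ I)) ∪
      (fun t => -1 + t) '' (f.range : Set (locRing v ⧸ I)) := by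
    ext x
    obtain ⟨x, rfl⟩ := Ideal.Quotient.mk_surjective x
    simp only [Set.mem_ofPred_eq, Set.mem_union, Set.mem_image, SetLike.mem_coe,
      AddMonoidHom.mem_range, exists_exists_eq_and]
    constructor
    · intro hx
      rw [← map_pow, ← map_one (Ideal.Quotient.mk I), Ideal.Quotient.eq, mem_ballIdeal] at hx
      have hx' : v.val ((x : K) ^ 2 - 1) < v.val 2 * v.val 2 := by
        refine lt_of_le_of_lt hx ?_
        rw [← map_mul, show (4 : K) * π = 2 * 2 * π by ring, map_mul]
        exact mul_lt_of_lt_one_right (by simp [zero_lt_iff]) hπ1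
      have key : ∀ y : K, v.val y < v.val 2 → ∃ t : locRing v, (c * t : K) = y := by
        intro y hy
        refine ⟨⟨y / (2 * π), ?_⟩, ?_⟩
        · change v.val (y / (2 * π)) ≤ 1
          have : v.val (y / 2) < 1 := by
            rw [map_div₀]; exact (div_lt_one₀ (by simp [zero_lt_iff])).2 hy
          rw [hlt] at this
          rw [show y / (2 * π) = y / 2 / π by field_simp, map_div₀ _ (y / 2)]
          exact (div_le_one₀ (by simp [zero_lt_iff, hπ0])).2 this
        · change 2 * π * (y / (2 * π)) = y
          field_simp
      rcases near_one_or_neg_one hx' with h | h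
      · left
        obtain ⟨t, ht⟩ := key _ h
        refine ⟨t, ?_⟩
        rw [hf, ← map_one (Ideal.Quotient.mk I), ← map_add]
        congr 1
        apply Subtype.ext
        push_cast
        rw [ht]; ring
      · right
        obtain ⟨t, ht⟩ := key _ h
        refine ⟨t, ?_⟩
        rw [hf, ← map_one (Ideal.Quotient.mk I), ← map_neg, ← map_add]
        congr 1
        apply Subtype.ext
        push_cast
        rw [ht]; ring
    · have h0 : ∀ e : locRing v, e ^ 2 = 1 → ∀ t : locRing v, (e + c * t) ^ 2 - 1 ∈ I := by
        intro e he t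
        have : (e + c * t) ^ 2 - 1 = c * 2 * (e * t) + c ^ 2 * t ^ 2 := by
          rw [← he]; ring
        rw [this]
        have h1 : c * 2 ∈ I := by
          change v.val (2 * π * 2) ≤ v.val (4 * π)
          rw [show (4 : K) * π = 2 * π * 2 by ring]
        have h2 : c ^ 2 ∈ I := by
          change v.val ((2 * π) ^ 2) ≤ v.val (4 * π)
          rw [show (2 * π) ^ 2 = 4 * π * π by ring, map_mul v.val (4 * π)]
          exact mul_le_of_le_one_right' hπ1.le
        exact I.add_mem (I.mul_mem_right _ h1) (I.mul_mem_right _ h2)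
      have h1 := fun e he t => (Ideal.Quotient.eq.2 (h0 e he t))
      rintro (⟨t, ht⟩ | ⟨t, ht⟩)
      · rw [← ht, hf, ← map_one (Ideal.Quotient.mk I), ← map_add, ← map_pow]
        exact h1 1 (by ring) t
      · rw [← ht, hf, ← map_one (Ideal.Quotient.mk I), ← map_neg, ← map_add, ← map_pow]
        exact h1 (-1) (by ring) t
  change {x : locRing v ⧸ I | x ^ 2 = 1}.ncard = _
  rw [hset, Set.ncard_union_eq _ (Set.toFinite _) (Set.toFinite _),
    Set.ncard_image_of_injective _ (add_right_injective _),
    Set.ncard_image_of_injective _ (add_right_injective _)]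
  · have : (f.range : Set (locRing v ⧸ I)).ncard = cNum v := by
      rw [← hcard]; rfl
    rw [this]; ring
  · rw [Set.disjoint_left]
    rintro _ ⟨_, ⟨s, rfl⟩, rfl⟩ ⟨_, ⟨t, rfl⟩, h⟩
    simp only [hf] at h
    rw [← map_one (Ideal.Quotient.mk I), ← map_neg, ← map_add, ← map_add, Ideal.Quotient.eq] at h
    change v.val ((-1 + 2 * π * (t : K)) - (1 + 2 * π * (s : K))) ≤ v.val (4 * π) at h
    have h2 : v.val (2 : K) = v.val ((-1 + 2 * π * (t : K)) - (1 + 2 * π * (s : K)) -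
        2 * π * (t - s : K)) := by
      rw [← Valuation.map_neg]; congr 1; ring
    have hts : v.val (t - s : K) ≤ 1 := v.val.map_sub_le t.2 s.2
    refine lt_irrefl (v.val (2 : K)) ?_
    have h3 : v.val (2 * π) < v.val 2 := by
      rw [map_mul]
      exact mul_lt_of_lt_one_right (by simp [zero_lt_iff]) hπ1
    conv_lhs => rw [h2]
    refine Valuation.map_sub_lt _ (h.trans_lt ?_) ?_
    · rw [show (4 : K) * π = 2 * (2 * π) by ring, map_mul v.val 2]
      exact (mul_le_of_le_one_left' val_two_le).trans_lt h3
    · rw [map_mul v.val (2 * π)]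
      exact (mul_le_of_le_one_right' hts).trans_lt h3

/-- The unit group at a prime, inside `Kˣ`. -/
def unitsAt : Subgroup Kˣ where
  carrier := {x | v.val (x : K) = 1}
  one_mem' := by simp
  mul_mem' := fun {x y} hx hy => by
    change v.val ((x : K) * y) = 1
    rw [map_mul, show v.val (x : K) = 1 from hx, show v.val (y : K) = 1 from hy, one_mul]
  inv_mem' := fun {x} hx => by
    change v.val ((x⁻¹ : Kˣ) : K) = 1
    rw [Units.val_inv_eq_inv_val, map_inv₀, show v.val (x : K) = 1 from hx, inv_one]

lemma mem_unitsAt {x : Kˣ} : x ∈ unitsAt v ↔ v.val (x : K) = 1 := Iff.rfl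

/-- Reduction of units. -/
noncomputable def redUnits (g : ℤᵐ⁰) : unitsAt v →* (locRing v ⧸ ballIdeal v g)ˣ :=
  MonoidHom.toHomUnits
    { toFun := fun x => Ideal.Quotient.mk _ ⟨((x : Kˣ) : K), le_of_eq x.2⟩
      map_one' := by rw [← map_one (Ideal.Quotient.mk (ballIdeal v g))]; rfl
      map_mul' := fun x y => by rw [← map_mul]; rfl }

lemma redUnits_eq_iff {g : ℤᵐ⁰} (x y : unitsAt v) :
    redUnits v g x = redUnits v g y ↔ v.val ((x : Kˣ) - (y : Kˣ) : K) ≤ g := by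
  rw [Units.ext_iff]
  change Ideal.Quotient.mk (ballIdeal v g) _ = Ideal.Quotient.mk _ _ ↔ _
  rw [Ideal.Quotient.eq]
  rfl

lemma redUnits_surjective {g : ℤᵐ⁰} (hg : g < 1) : Function.Surjective (redUnits v g) := by
  intro y
  obtain ⟨x, hx⟩ := Ideal.Quotient.mk_surjective (y : locRing v ⧸ ballIdeal v g)
  obtain ⟨x', hx'⟩ := Ideal.Quotient.mk_surjective
    ((y⁻¹ : (locRing v ⧸ ballIdeal v g)ˣ) : locRing v ⧸ ballIdeal v g)
  have h1 : x * x' - 1 ∈ ballIdeal v g := by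
    rw [← Ideal.Quotient.eq, map_mul, hx, hx', map_one, Units.mul_inv]
  have h2 : v.val ((x : K) * x') = 1 := by
    have := val_one_add (V := v.val) (lt_of_le_of_lt (show v.val ((x : K) * x' - 1) ≤ g from h1) hg)
    rwa [add_sub_cancel] at this
  have h3 : v.val (x : K) = 1 := by
    refine le_antisymm x.2 ?_
    rw [← h2, map_mul]
    exact mul_le_of_le_one_right' x'.2
  refine ⟨⟨Units.mk0 (x : K) (ne_zero_of_val_eq_one h3), h3⟩, Units.ext ?_⟩
  rw [← hx]
  rfl

lemma relIndex_nsq_unitsAt : (nsq v.val).relIndex (unitsAt v) = 2 * cNum v := by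
  obtain ⟨π, hπ⟩ := exists_uniformizer v
  have hπ1 : v.val π < 1 := by
    rw [hπ, ← WithZero.exp_zero, WithZero.exp_lt_exp]; norm_num
  have hπ0 : π ≠ 0 := by rintro rfl; rw [map_zero] at hπ; exact WithZero.exp_ne_zero hπ.symm
  rw [← card_sq_eq_one v hπ]
  set g := v.val (4 * π) with hg
  have hg4 : g < v.val 4 := by
    rw [hg, map_mul]; exact mul_lt_of_lt_one_right (by simp [zero_lt_iff]) hπ1
  have hfin : Finite (locRing v ⧸ ballIdeal v g) := finite_quot v (by simp [hg, hπ0])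
    (hg4.le.trans val_four_le)
  have hsub : (nsq v.val).subgroupOf (unitsAt v) =
      ((powMonoidHom (α := (locRing v ⧸ ballIdeal v g)ˣ) 2).range).comap (redUnits v g) := by
    ext u
    rw [Subgroup.mem_subgroupOf, Subgroup.mem_comap, MonoidHom.mem_range, mem_nsq]
    constructor
    · intro h
      obtain ⟨y, e, hy, he, -, hu⟩ := h.refine (one_ne_zero)
      have hu1 : v.val ((u : Kˣ) : K) = 1 := u.2
      have hy1 : v.val y = 1 := by
        rw [hu, map_mul, val_one_add (val_mul_lt_one val_four_le he), mul_one, map_pow] at hu1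
        exact (pow_eq_one_iff_of_nonneg zero_le two_ne_zero).1 hu1
      have he' : v.val e ≤ v.val π := by
        rw [hπ]
        by_cases hx : e = 0
        · simp [hx]
        rw [← WithZero.exp_log (x := v.val e) (by simpa using hx), ← WithZero.exp_zero,
          WithZero.exp_lt_exp] at he
        rw [← WithZero.exp_log (x := v.val e) (by simpa using hx), WithZero.exp_le_exp]
        omega
      let y' : unitsAt v := ⟨Units.mk0 y hy, hy1⟩
      refine ⟨redUnits v g y', ?_⟩
      rw [powMonoidHom_apply, ← map_pow, redUnits_eq_iff]
      change v.val (y ^ 2 - ((u : Kˣ) : K)) ≤ v.val (4 * π)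
      rw [hu, show y ^ 2 - y ^ 2 * (1 + 4 * e) = - (y ^ 2 * (4 * e)) by ring, Valuation.map_neg,
        map_mul, map_pow, hy1, one_pow, one_mul, map_mul, map_mul]
      exact mul_le_mul_right he' _
    · rintro ⟨w, hw⟩
      obtain ⟨y, rfl⟩ := redUnits_surjective v (hg4.trans_le val_four_le) w
      rw [powMonoidHom_apply, ← map_pow, eq_comm, redUnits_eq_iff] at hw
      refine nearSq_of_sub_sq (y := ((y : Kˣ) : K)) ?_
      rw [map_mul, map_pow, show v.val ((y : Kˣ) : K) = 1 from y.2, one_pow, mul_one]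
      exact lt_of_le_of_lt (by simpa using hw) hg4
  rw [Subgroup.relIndex, hsub,
    Subgroup.index_comap_of_surjective _ (redUnits_surjective v (hg4.trans_le val_four_le)),
    Subgroup.index_range]
  rw [← Nat.card_coe_set_eq]
  refine Nat.card_congr ⟨fun x => ⟨((x : (locRing v ⧸ ballIdeal v g)ˣ) : _), ?_⟩,
    fun x => ⟨⟨x, x, ?_, ?_⟩, ?_⟩, ?_, ?_⟩
  · have := x.2
    rw [MonoidHom.mem_ker, powMonoidHom_apply, Units.ext_iff] at this
    simpa using this
  · rw [← sq]; exact x.2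
  · rw [← sq]; exact x.2
  · rw [MonoidHom.mem_ker, powMonoidHom_apply, Units.ext_iff]
    exact x.2
  · intro x
    apply Subtype.ext
    apply Units.ext
    rfl
  · intro x
    rfl

lemma index_nsq : (nsq v.val).index = 4 * cNum v := by
  obtain ⟨π, hπ⟩ := exists_uniformizer v
  have hπ0 : π ≠ 0 := by rintro rfl; rw [map_zero] at hπ; exact WithZero.exp_ne_zero hπ.symm
  have hmem : ∀ x : Kˣ, x ∈ unitsAt v ⊔ nsq v.val ↔ Even (WithZero.log (v.val (x : K))) := by
    intro x
    rw [Subgroup.mem_sup]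
    constructor
    · rintro ⟨u, hu, z, ⟨y, e, hy, he, hz⟩, rfl⟩
      rw [Units.val_mul, map_mul, show v.val (u : K) = 1 from hu, one_mul, hz, map_mul,
        val_one_add (val_mul_lt_one val_four_le he), mul_one, map_pow, WithZero.log_pow]
      simp
    · rintro ⟨k, hk⟩
      have hπk : π ^ k ≠ 0 := zpow_ne_zero _ hπ0
      refine ⟨x * (Units.mk0 _ hπk) ^ 2, ?_, (Units.mk0 _ hπk)⁻¹ ^ 2, ?_, by
        rw [mul_assoc, ← mul_pow, mul_inv_cancel, one_pow, mul_one]⟩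
      · rw [mem_unitsAt]
        simp only [Units.val_mul, Units.val_pow_eq_pow_val, Units.val_mk0, map_mul, map_pow,
          map_zpow₀, hπ]
        rw [← WithZero.exp_log (x := v.val (x : K)) (by simp), hk, ← WithZero.exp_zsmul,
          ← WithZero.exp_nsmul, ← WithZero.exp_add, ← WithZero.exp_zero]
        congr 1
        simp
        ring
      · exact nearSq_sq (Units.ne_zero _)
  have h2 : (unitsAt v ⊔ nsq v.val).index = 2 := by
    rw [Subgroup.index_eq_two_iff]
    refine ⟨Units.mk0 π hπ0, fun b => ?_⟩
    rw [hmem, hmem, Units.val_mul, Units.val_mk0, map_mul, hπ,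
      WithZero.log_mul (by simp) WithZero.exp_ne_zero, WithZero.log_exp]
    rcases Int.even_or_odd (WithZero.log (v.val (b : K))) with h | h
    · right; exact ⟨h, by rw [Int.not_even_iff_odd]; exact h.add_odd (by decide)⟩
    · left; exact ⟨h.add_odd (by decide), by rwa [Int.not_even_iff_odd]⟩
  rw [← Subgroup.relIndex_mul_index (H := nsq v.val) (K := unitsAt v ⊔ nsq v.val) le_sup_right, h2,
    Subgroup.relIndex_sup_right, relIndex_nsq_unitsAt]
  ring

end LocalIndex

section Product

variable {K : Type*} [Field K] [NumberField K]

lemma cNum_eq_maxPowDividing (v : Prm K) :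
    cNum v = Ideal.absNorm (v.maxPowDividing (Ideal.span {(2 : 𝓞 K)})) := by
  refine cNum_eq v ?_
  rw [show (2 : K) = algebraMap (𝓞 K) K 2 by rw [map_ofNat], Prm.val, v.valuation_of_algebraMap,
    v.intValuation_if_neg two_ne_zero]

lemma cNum_eq_one {v : Prm K} (h : v.val 2 = 1) : cNum v = 1 := by
  have := cNum_eq v (n := 0) (by simpa using h)
  simpa using this

lemma prod_cNum {S : Finset (Prm K)} (hS : ∀ v : Prm K, v ∉ S → v.val 2 = 1) :
    ∏ v ∈ S, cNum v = 2 ^ Module.finrank ℚ K := by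
  simp_rw [cNum_eq_maxPowDividing]
  rw [← map_prod]
  have h1 := Ideal.finprod_heightOneSpectrum_factorization (R := 𝓞 K) (I := Ideal.span {(2 : 𝓞 K)})
    (by simp)
  rw [finprod_eq_prod_of_mulSupport_subset (s := S)] at h1
  · rw [h1, Ideal.absNorm_span_singleton]
    have : Algebra.norm ℤ (2 : 𝓞 K) = 2 ^ Module.finrank ℤ (𝓞 K) := by
      have := Algebra.norm_algebraMap (R := ℤ) (S := 𝓞 K) 2
      simpa using this
    rw [this, NumberField.RingOfIntegers.rank]
    simp
  · intro v hv
    by_contra hvS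
    apply hv
    have h2 := hS v hvS
    have h3 := cNum_eq_one h2
    rw [cNum_eq_maxPowDividing, Ideal.absNorm_eq_one_iff] at h3
    exact h3.trans Ideal.one_eq_top.symm

end Product

section Quad

variable {K L : Type*} [Field K] [NumberField K] [Field L] [NumberField L] [Algebra K L]
  {a : K} {r : L} {σ : L ≃ₐ[K] L}

lemma IsQuad.finrank_eq_two (h : IsQuad K L a r σ) : Module.finrank K L = 2 := by
  have hli : LinearIndependent K ![(1 : L), r] := by
    rw [LinearIndependent.pair_iff]
    intro s t hst
    have h1 := congrArg σ hst
    simp only [Algebra.smul_def, map_add, map_mul, AlgEquiv.commutes, h.conj, mul_one,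
      map_zero] at h1 hst
    have h2 : algebraMap K L s = 0 := by linear_combination (1 / 2) * (hst + h1)
    have h3 : algebraMap K L t * r = 0 := by linear_combination (1 / 2) * (hst - h1)
    refine ⟨by simpa using h2, ?_⟩
    rcases mul_eq_zero.1 h3 with h4 | h4
    · simpa using h4
    · exact absurd h4 h.ne
  have hsp : ⊤ ≤ Submodule.span K (Set.range ![(1 : L), r]) := by
    intro z _
    obtain ⟨p, q, rfl⟩ := h.span z
    rw [Matrix.range_cons, Matrix.range_cons, Matrix.range_empty, Set.union_empty]
    rw [← Algebra.smul_def, Algebra.algebraMap_eq_smul_one]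
    exact Submodule.add_mem _ (Submodule.smul_mem _ _ (Submodule.subset_span (by simp)))
      (Submodule.smul_mem _ _ (Submodule.subset_span (by simp)))
  rw [Module.finrank_eq_card_basis (Module.Basis.mk hli hsp)]
  simp

lemma map_below_eq_pow {w : Prm L} (hw : ∀ w' : Prm L, below K w' = below K w → w' = w) :
    Ideal.map (algebraMap (𝓞 K) (𝓞 L)) (below K w).asIdeal =
      w.asIdeal ^ (below K w).asIdeal.ramificationIdx' w.asIdeal := by
  set I := Ideal.map (algebraMap (𝓞 K) (𝓞 L)) (below K w).asIdeal with hI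
  have hI0 : I ≠ 0 := Ideal.map_ne_bot_of_ne_bot (below K w).ne_bot
  have h1 := Ideal.finprod_heightOneSpectrum_factorization hI0
  rw [finprod_eq_single _ w] at h1
  · rw [HeightOneSpectrum.maxPowDividing] at h1
    set n := (Associates.mk w.asIdeal).count (Associates.mk I).factors
    rw [Ideal.ramificationIdx'_spec (n := n) (h1.symm.le), h1]
    rw [← hI, ← h1]
    intro h2
    have h3 := Ideal.pow_right_strictAnti w.asIdeal w.ne_bot w.isPrime.ne_top (Nat.lt_succ_self n)
    exact absurd h2 (not_le_of_gt h3)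
  · intro w' hne
    rw [HeightOneSpectrum.maxPowDividing]
    have h0 : (Associates.mk w'.asIdeal).count (Associates.mk I).factors = 0 := by
      by_contra hc
      apply hne
      apply hw
      have h2 : I ≤ w'.asIdeal := by
        have := (Ideal.count_associates_factors_eq hI0 w'.isPrime w'.ne_bot).symm
        rw [← Ideal.dvd_iff_le]
        refine UniqueFactorizationMonoid.dvd_of_mem_normalizedFactors (Multiset.count_ne_zero.1 ?_)
        rwa [this]
      refine (Prm.eq_of_le fun x hx => ?_).symm
      exact h2 (Ideal.mem_map_of_mem _ hx)
    rw [h0, pow_zero]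

lemma cNum_sq (h : IsQuad K L a r σ) {w : Prm L} (hw : conjPrm σ w = w) :
    cNum w = cNum (below K w) ^ 2 := by
  have hl : w.asIdeal.LiesOver (below K w).asIdeal := ⟨rfl⟩
  obtain ⟨n, hn⟩ := exists_exp_neg (g := (below K w).val 2) (by simp) val_two_le
  set e := (below K w).asIdeal.ramificationIdx' w.asIdeal with he
  have h1 : w.val 2 = WithZero.exp (-((e * n : ℕ) : ℤ)) := by
    have := HeightOneSpectrum.valuation_liesOver L (below K w) w (2 : K)
    rw [show algebraMap K L 2 = 2 from map_ofNat _ 2] at this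
    rw [Prm.val, ← this, ← he]
    erw [hn]
    rw [← WithZero.exp_nsmul]
    congr 1
    push_cast
    ring
  rw [cNum_eq w h1, cNum_eq _ hn, pow_mul,
    ← map_below_eq_pow fun w' hb => eq_of_below_eq h hw hb, ← Ideal.map_pow,
    Ideal.absNorm_algebraMap]
  congr 1
  rw [← h.finrank_eq_two]
  exact (IsFractionRing.finrank_eq (𝓞 K) K (𝓞 L) L).symm

/-- Values of the norm form of `K(√a)`. -/
def normSol (K : Type*) [Field K] (a : K) : Subgroup Kˣ where
  carrier := {b | Sol K a b}
  one_mem' := by simpa using Sol.sq a 1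
  mul_mem' := fun h h' => by simpa using Sol.mul h h'
  inv_mem' := fun {x} h => by
    have := Sol.mul h (Sol.sq a ((x⁻¹ : Kˣ) : K))
    change Sol K a _
    rwa [sq, ← mul_assoc, Units.mul_inv, one_mul] at this

lemma mem_normSol {a : K} {b : Kˣ} : b ∈ normSol K a ↔ Sol K a b := Iff.rfl

/-- The norm on units. -/
noncomputable def IsQuad.normHom (h : IsQuad K L a r σ) : Lˣ →* Kˣ :=
  MonoidHom.toHomUnits
    { toFun := fun z => (h.norm_mem (z : L)).choose
      map_one' := (algebraMap K L).injective (by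
        rw [(h.norm_mem _).choose_spec]; simp)
      map_mul' := fun x y => (algebraMap K L).injective (by
        rw [map_mul, (h.norm_mem _).choose_spec, (h.norm_mem _).choose_spec,
          (h.norm_mem _).choose_spec, Units.val_mul, map_mul]
        ring) }

lemma IsQuad.normHom_spec (h : IsQuad K L a r σ) (z : Lˣ) :
    algebraMap K L (h.normHom z : Kˣ) = (z : L) * σ z := (h.norm_mem (z : L)).choose_spec

lemma IsQuad.range_normHom (h : IsQuad K L a r σ) : h.normHom.range = normSol K a := by
  ext b
  rw [mem_normSol, h.sol_iff, MonoidHom.mem_range]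
  constructor
  · rintro ⟨z, rfl⟩
    exact ⟨z, (h.normHom_spec z).symm⟩
  · rintro ⟨z, hz⟩
    have hz0 : z ≠ 0 := by
      rintro rfl
      rw [zero_mul] at hz
      exact b.ne_zero ((map_eq_zero _).1 hz.symm)
    exact ⟨Units.mk0 z hz0, Units.ext ((algebraMap K L).injective (by
      rw [h.normHom_spec, ← hz]; rfl))⟩

/-- The local norm index. -/
lemma index_local (h : IsQuad K L a r σ) (v : Prm K) (ha : ¬ NearSq v.val a) :
    (normSol K a ⊔ nsq v.val).index = 2 := by
  obtain ⟨w, rfl⟩ := exists_above (L := L) v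
  have hw : conjPrm σ w = w := by
    by_contra hc; exact ha ((conj_ne_iff h).1 hc)
  have hW : ∀ z, w.val (σ z) = w.val z := fun z => by rw [← conjPrm_val, hw]
  have hVW := below_isEquiv (K := K) w
  set P := nsq (below K w).val
  set Q := nsq w.val
  let i : Kˣ →* Lˣ := Units.map (algebraMap K L)
  let au : Kˣ := Units.mk0 a h.ne_zero
  have hcomap : Q.comap i = Subgroup.zpowers au ⊔ P := by
    apply le_antisymm
    · intro x hx
      rcases NearSq.descend h hW hVW (x := (x : K)) hx with h1 | h1
      · exact (le_sup_right : P ≤ _) h1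
      · rw [show x = au⁻¹ * (au * x) by group]
        exact mul_mem ((le_sup_left : Subgroup.zpowers au ≤ _) (inv_mem (Subgroup.mem_zpowers au)))
          ((le_sup_right : P ≤ _) (show NearSq _ ((au * x : Kˣ) : K) by simpa [au] using h1))
    · refine sup_le ?_ fun x hx => NearSq.map hVW hx
      rw [Subgroup.zpowers_le]
      change NearSq w.val (algebraMap K L a)
      rw [← h.sq]
      exact nearSq_sq h.ne
  have hau : P.relIndex (Subgroup.zpowers au) = 2 := by
    rw [Subgroup.relIndex, Subgroup.index_eq_two_iff]
    refine ⟨⟨au, Subgroup.mem_zpowers au⟩, ?_⟩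
    have hau2 : au ^ 2 ∈ P := nearSq_sq h.ne_zero
    have haun : au ∉ P := ha
    have hev : ∀ n : ℤ, Even n → au ^ n ∈ P := by
      rintro n ⟨m, rfl⟩
      rw [← two_mul, zpow_mul]
      exact zpow_mem (by exact_mod_cast hau2) m
    have hiff : ∀ n : ℤ, au ^ n ∈ P ↔ Even n := by
      intro n
      refine ⟨fun hn => ?_, hev n⟩
      by_contra hodd
      rw [Int.not_even_iff_odd] at hodd
      obtain ⟨m, rfl⟩ := hodd
      rw [zpow_add, zpow_one] at hn
      exact haun ((P.mul_mem_cancel_left (hev _ (even_two_mul m))).1 hn)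
    rintro ⟨b, hb⟩
    obtain ⟨n, rfl⟩ := Subgroup.mem_zpowers_iff.1 hb
    rw [Subgroup.mem_subgroupOf, Subgroup.mem_subgroupOf]
    change Xor (au ^ n * au ∈ P) (au ^ n ∈ P)
    rw [← zpow_add_one, hiff, hiff]
    rcases Int.even_or_odd n with h | h
    · right; exact ⟨h, by rw [Int.not_even_iff_odd]; exact h.add_odd (by decide)⟩
    · left; exact ⟨h.add_odd (by decide), by rwa [Int.not_even_iff_odd]⟩
  have hcomap2 : P.comap h.normHom = i.range ⊔ Q := by
    apply le_antisymm
    · intro z hz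
      obtain ⟨c, hc, hcz⟩ := NearSq.of_norm h hW hVW (h.normHom_spec z) hz
      let cu : Kˣ := Units.mk0 c hc
      rw [show z = i cu⁻¹ * (i cu * z) by rw [map_inv]; group]
      exact mul_mem ((le_sup_left : i.range ≤ _) ⟨_, rfl⟩) ((le_sup_right : Q ≤ _) hcz)
    · refine sup_le ?_ fun z hz => NearSq.norm h hW hVW hz (h.normHom_spec z)
      rintro _ ⟨c, rfl⟩
      have : h.normHom (i c) = c ^ 2 := Units.ext ((algebraMap K L).injective (by
        rw [h.normHom_spec]
        change algebraMap K L c * σ (algebraMap K L c) = _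
        rw [AlgEquiv.commutes, ← map_mul, ← sq]; rfl))
      rw [Subgroup.mem_comap, this]
      exact nearSq_sq c.ne_zero
  have e1 : P.relIndex (normSol K a) = (i.range ⊔ Q).index := by
    rw [← h.range_normHom, ← Subgroup.index_comap, hcomap2]
  have e2 : P.relIndex (normSol K a) * (normSol K a ⊔ P).index = P.index := by
    rw [← Subgroup.relIndex_sup_right, Subgroup.relIndex_mul_index le_sup_right]
  have e3 : Q.relIndex i.range * (i.range ⊔ Q).index = Q.index := by
    rw [← Subgroup.relIndex_sup_right, Subgroup.relIndex_mul_index le_sup_right]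
  have e4 : 2 * Q.relIndex i.range = P.index := by
    rw [← Subgroup.index_comap, hcomap, ← hau, ← Subgroup.relIndex_sup_right,
      Subgroup.relIndex_mul_index le_sup_right]
  rw [← e1] at e3
  rw [index_nsq] at e2 e3 e4
  rw [cNum_sq h hw] at e3
  have hc := cNum_pos (below K w)
  have e5 : Q.relIndex i.range = 2 * cNum (below K w) := by omega
  rw [e5] at e3
  have e6 : P.relIndex (normSol K a) = 2 * cNum (below K w) := by
    have : (2 * cNum (below K w)) * P.relIndex (normSol K a) =
        (2 * cNum (below K w)) * (2 * cNum (below K w)) := by rw [e3]; ring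
    exact Nat.eq_of_mul_eq_mul_left (by omega) this
  rw [e6] at e2
  exact Nat.eq_of_mul_eq_mul_left (show 0 < 2 * cNum (below K w) by omega) (by rw [e2]; ring)

end Quad

section Exists

universe u

/-- Every nonsquare has a quadratic extension adjoining its square root. -/
lemma exists_isQuad {K : Type u} [Field K] [CharZero K] {a : K} (ha : ¬ IsSquare a) :
    ∃ (L : Type u) (_ : Field L) (_ : Algebra K L) (_ : FiniteDimensional K L)
      (r : L) (σ : L ≃ₐ[K] L), IsQuad K L a r σ := by
  have : Fact (∀ r : K, r ^ 2 ≠ a + 0 * r) := ⟨fun r hr => ha ⟨r, by rw [← sq, hr]; ring⟩⟩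
  let σ : QuadraticAlgebra K a 0 →ₐ[K] QuadraticAlgebra K a 0 :=
    { toFun := star
      map_one' := star_one _
      map_mul' := fun x y => by rw [star_mul, mul_comm]
      map_zero' := star_zero _
      map_add' := star_add
      commutes' := fun r => by
        ext <;> simp }
  have hσ : ∀ z, σ z = star z := fun z => rfl
  refine ⟨QuadraticAlgebra K a 0, inferInstance, inferInstance, inferInstance, ⟨0, 1⟩,
    AlgEquiv.ofAlgHom σ σ ?_ ?_, ⟨?_, ?_, ?_, ?_⟩⟩
  · ext <;> simp [hσ]
  · ext <;> simp [hσ]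
  · ext <;> simp [sq]
  · change star _ = _
    ext <;> simp
  · intro h
    have := congrArg QuadraticAlgebra.im h
    simp at this
  · intro z
    exact ⟨z.re, z.im, by ext <;> simp⟩

lemma exists_isQuad_numberField {K : Type u} [Field K] [NumberField K] {a : K}
    (ha : ¬ IsSquare a) :
    ∃ (L : Type u) (_ : Field L) (_ : NumberField L) (_ : Algebra K L)
      (r : L) (σ : L ≃ₐ[K] L), IsQuad K L a r σ := by
  obtain ⟨L, _, _, _, r, σ, h⟩ := exists_isQuad ha
  have : CharZero L := h.charZeroL
  have : NumberField L := { to_finiteDimensional := Module.Finite.trans (R := ℚ) K L }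
  exact ⟨L, _, this, _, r, σ, h⟩

end Exists

section Places

variable {K : Type*} [Field K] [NumberField K]

/-- Positivity at an infinite place (no condition at complex places). -/
def posAt (v : NumberField.InfinitePlace K) : Subgroup Kˣ where
  carrier := {x | v.IsReal → 0 < (v.embedding (x : K)).re}
  one_mem' := fun _ => by simp
  mul_mem' := fun {x y} hx hy hv => by
    have h1 := hx hv
    have h2 := hy hv
    have h3 : (v.embedding (x : K)).im = 0 := by
      have := NumberField.InfinitePlace.isReal_iff.1 hv
      exact NumberField.ComplexEmbedding.IsReal.coe_embedding_apply this (x : K) ▸ Complex.ofReal_im _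
    rw [Units.val_mul, map_mul, Complex.mul_re, h3, zero_mul, sub_zero]
    exact mul_pos h1 h2
  inv_mem' := fun {x} hx hv => by
    have h1 := hx hv
    rw [Units.val_inv_eq_inv_val, map_inv₀, Complex.inv_re]
    refine div_pos h1 (Complex.normSq_pos.2 ?_)
    simp

/-- The real number attached to an element by a real place. -/
lemma embedding_im {v : NumberField.InfinitePlace K} (hv : v.IsReal) (x : K) :
    (v.embedding x).im = 0 := by
  have := NumberField.InfinitePlace.isReal_iff.1 hv
  exact NumberField.ComplexEmbedding.IsReal.coe_embedding_apply this x ▸ Complex.ofReal_im _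

lemma mem_posAt {v : NumberField.InfinitePlace K} {x : Kˣ} :
    x ∈ posAt v ↔ (v.IsReal → 0 < (v.embedding (x : K)).re) := Iff.rfl

lemma embedding_re_mul {v : NumberField.InfinitePlace K} (hv : v.IsReal) (x y : K) :
    (v.embedding (x * y)).re = (v.embedding x).re * (v.embedding y).re := by
  rw [map_mul, Complex.mul_re, embedding_im hv, zero_mul, sub_zero]

lemma embedding_re_ne_zero {v : NumberField.InfinitePlace K} (hv : v.IsReal) (x : Kˣ) :
    (v.embedding (x : K)).re ≠ 0 := by
  intro h
  have : v.embedding (x : K) = 0 := Complex.ext h (embedding_im hv _)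
  simp at this

lemma index_posAt_real {v : NumberField.InfinitePlace K} (hv : v.IsReal) :
    (posAt v).index = 2 := by
  rw [Subgroup.index_eq_two_iff]
  refine ⟨-1, fun b => ?_⟩
  have h := embedding_re_ne_zero hv b
  simp only [mem_posAt, hv, true_imp_iff, mul_neg, mul_one, Units.val_neg, map_neg, Complex.neg_re,
    Left.neg_pos_iff]
  rcases lt_or_gt_of_ne h with h | h
  · left; exact ⟨h, h.le.not_gt⟩
  · right; exact ⟨h, h.le.not_gt⟩

lemma posAt_complex {v : NumberField.InfinitePlace K} (hv : ¬ v.IsReal) : posAt v = ⊤ := by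
  rw [eq_top_iff]
  exact fun x _ h => absurd h hv

variable (K) in
/-- All places. -/
abbrev Plc := Prm K ⊕ NumberField.InfinitePlace K

/-- Local squares. -/
noncomputable def loc : Plc K → Subgroup Kˣ
  | .inl v => nsq v.val
  | .inr v => posAt v

lemma mem_loc_inl {v : Prm K} {x : Kˣ} : x ∈ loc (.inl v) ↔ NearSq v.val (x : K) := Iff.rfl

lemma sq_mem_loc (v : Plc K) (x : Kˣ) : x ^ 2 ∈ loc v := by
  rcases v with v | v
  · exact nearSq_sq x.ne_zero
  · intro hv
    have := embedding_re_ne_zero hv x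
    rw [Units.val_pow_eq_pow_val, sq, embedding_re_mul hv]
    exact mul_self_pos.2 this

lemma mul_sq_mem_loc (v : Plc K) {x y : Kˣ} : x * y ^ 2 ∈ loc v ↔ x ∈ loc v :=
  Subgroup.mul_mem_cancel_right _ (sq_mem_loc v y)

/-- Local norms. -/
noncomputable def nrm (v : Plc K) (a : K) : Subgroup Kˣ := normSol K a ⊔ loc v

lemma mem_nrm {v : Plc K} {a : K} {b : Kˣ} :
    b ∈ nrm v a ↔ ∃ c : Kˣ, Sol K a c ∧ b * c⁻¹ ∈ loc v := by
  rw [nrm, Subgroup.mem_sup]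
  constructor
  · rintro ⟨y, hy, z, hz, rfl⟩
    exact ⟨y, hy, by simpa [mul_comm] using hz⟩
  · rintro ⟨c, hc, h⟩
    exact ⟨c, hc, _, h, by rw [mul_comm b, mul_inv_cancel_left]⟩

lemma loc_le_nrm (v : Plc K) (a : K) : loc v ≤ nrm v a := le_sup_right

lemma nrm_of_sol {v : Plc K} {a : K} {b : Kˣ} (h : Sol K a b) : b ∈ nrm v a :=
  (le_sup_left : normSol K a ≤ _) h

lemma sol_zero_one {a : K} : Sol K a (-a) := ⟨0, 1, by ring⟩

lemma nrm_eq_top {v : Plc K} {a : Kˣ} (ha : a ∈ loc v) : nrm v (a : K) = ⊤ := by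
  rw [eq_top_iff]
  intro b _
  rcases v with v | v
  · by_cases hb1 : (b : K) = 1
    · rw [show b = 1 from Units.ext hb1]; exact one_mem _
    have hb1' : (b : K) - 1 ≠ 0 := sub_ne_zero.2 hb1
    obtain ⟨y, e, hy, he, he2, hay⟩ := NearSq.refine (d := 4 * (b : K) / ((b : K) - 1) ^ 2)
      (mem_loc_inl.1 ha) (by simp [hb1'])
    have hb0 := b.ne_zero
    set n : K := ((b + 1) / 2) ^ 2 - a * ((b - 1) / (2 * y)) ^ 2 with hn
    have hnb : n = b * (1 - e * (b - 1) ^ 2 / b) := by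
      rw [hn, hay]; field_simp; ring
    have hlt : v.val (n / b - 1) < v.val 4 := by
      rw [show n / b - 1 = - (e * (b - 1) ^ 2 / b) by rw [hnb]; field_simp; ring, Valuation.map_neg]
      rw [show (4 : K) = (4 * (b : K) / ((b : K) - 1) ^ 2) * ((b - 1) ^ 2 / b) by field_simp,
        mul_div_assoc, map_mul, map_mul]
      exact mul_lt_mul_of_pos_right he2 (by simp [zero_lt_iff, hb1'])
    have hnear := nearSq_of_sub_one hlt
    have hn0 : n ≠ 0 := by
      intro h0; apply hnear.ne_zero; rw [h0, zero_div]
    rw [mem_nrm]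
    refine ⟨Units.mk0 n hn0, ⟨_, _, hn.symm⟩, ?_⟩
    have := hnear.inv
    rw [inv_div] at this
    rw [mem_loc_inl, Units.val_mul, Units.val_inv_eq_inv_val, Units.val_mk0, ← div_eq_mul_inv]
    exact this
  · by_cases hv : v.IsReal
    · rcases lt_or_gt_of_ne (embedding_re_ne_zero hv b) with h | h
      · rw [mem_nrm]
        refine ⟨-a, by simpa using sol_zero_one (a := (a : K)), fun _ => ?_⟩
        have ha' : 0 < (v.embedding ((a⁻¹ : Kˣ) : K)).re := (posAt v).inv_mem ha hv
        rw [inv_neg, mul_neg, Units.val_neg, map_neg, Complex.neg_re, Units.val_mul,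
          embedding_re_mul hv]
        nlinarith
      · exact loc_le_nrm _ _ fun _ => h
    · exact loc_le_nrm _ _ fun h => absurd h hv

lemma nrm_real {v : NumberField.InfinitePlace K} (hv : v.IsReal) {a : Kˣ}
    (ha : a ∉ loc (.inr v)) : nrm (.inr v) (a : K) = posAt v := by
  refine le_antisymm (sup_le ?_ le_rfl) le_sup_right
  rintro b ⟨p, q, hpq⟩ _
  have h1 : (v.embedding (a : K)).re < 0 := by
    refine lt_of_le_of_ne (not_lt.1 fun h => ha fun _ => h) (embedding_re_ne_zero hv a)
  have h2 := embedding_re_ne_zero hv b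
  rw [← hpq, map_sub, Complex.sub_re, sq, sq, embedding_re_mul hv, embedding_re_mul hv,
    embedding_re_mul hv] at h2 ⊢
  refine lt_of_le_of_ne ?_ h2.symm
  nlinarith [mul_self_nonneg (v.embedding p).re, mul_self_nonneg (v.embedding q).re]

lemma index_nrm {v : Plc K} {a : Kˣ} (ha : a ∉ loc v) : (nrm v (a : K)).index = 2 := by
  rcases v with v | v
  · have hns : ¬ IsSquare (a : K) := by
      rintro ⟨c, hc⟩
      apply ha
      rw [mem_loc_inl, hc, ← sq]
      refine nearSq_sq ?_
      rintro rfl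
      simp at hc
    obtain ⟨L, _, _, _, r, σ, h⟩ := exists_isQuad_numberField hns
    exact index_local h v ha
  · have hv : v.IsReal := by
      by_contra hv
      exact ha fun h => absurd h hv
    rw [nrm_real hv ha, index_posAt_real hv]

lemma mul_mem_nrm {v : Plc K} {a b c : Kˣ} (hb : b ∉ nrm v (a : K)) (hc : c ∉ nrm v (a : K)) :
    b * c ∈ nrm v (a : K) := by
  have ha : a ∉ loc v := fun ha => hb (by rw [nrm_eq_top ha]; trivial)
  rw [Subgroup.mul_mem_iff_of_index_two (index_nrm ha)]
  simp [hb, hc]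

/-- Local norms only depend on the local class. -/
lemma nrm_congr_le {v : Plc K} {a s : Kˣ} (hs : s ∈ loc v) :
    nrm v ((a * s : Kˣ) : K) ≤ nrm v (a : K) := by
  by_cases ha : a ∈ loc v
  · rw [nrm_eq_top ha]; exact le_top
  have has : a * s ∉ loc v := fun h => ha ((Subgroup.mul_mem_cancel_right _ hs).1 h)
  rcases v with v | v
  · refine sup_le ?_ le_sup_right
    rintro n ⟨p, q, hpq⟩
    by_cases hq : q = 0
    · have hp : p ≠ 0 := by
        rintro rfl
        exact n.ne_zero (by rw [← hpq, hq]; ring)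
      refine loc_le_nrm _ _ ?_
      rw [mem_loc_inl, ← hpq, hq]
      simpa using nearSq_sq hp
    have hn0 := n.ne_zero
    obtain ⟨y, e, hy, he, he2, hay⟩ := NearSq.refine (d := (n : K) / (a * s * q ^ 2))
      (mem_loc_inl.1 hs) (by simp [hq])
    have hVs : v.val (s : K) = v.val (y ^ 2) := by
      rw [hay, map_mul, val_one_add (val_mul_lt_one val_four_le he), mul_one]
    set n' : K := p ^ 2 - a * (y * q) ^ 2 with hn'
    have hnn : n' = n + 4 * (e * (a * y ^ 2 * q ^ 2)) := by
      rw [hn', ← hpq, Units.val_mul, hay]; ring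
    have hlt : v.val (n' / n - 1) < v.val 4 := by
      rw [show n' / n - 1 = 4 * (e * (a * y ^ 2 * q ^ 2) / n) by rw [hnn]; field_simp; ring, map_mul]
      refine mul_lt_of_lt_one_right (by simp [zero_lt_iff]) ?_
      rw [map_div₀, div_lt_one₀ (by simp [zero_lt_iff])]
      calc v.val (e * (a * y ^ 2 * q ^ 2)) = v.val e * v.val (a * s * q ^ 2) := by
            simp only [map_mul, hVs]
        _ < v.val ((n : K) / (a * s * q ^ 2)) * v.val (a * s * q ^ 2) :=
            mul_lt_mul_of_pos_right he2 (by simp [zero_lt_iff, hq])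
        _ = v.val n := by rw [← map_mul]; congr 1; field_simp
    have hnear := nearSq_of_sub_one hlt
    have hn'0 : n' ≠ 0 := by
      intro h0; apply hnear.ne_zero; rw [h0, zero_div]
    rw [mem_nrm]
    refine ⟨Units.mk0 n' hn'0, ⟨_, _, hn'.symm⟩, ?_⟩
    have := hnear.inv
    rw [inv_div] at this
    rw [mem_loc_inl, Units.val_mul, Units.val_inv_eq_inv_val, Units.val_mk0, ← div_eq_mul_inv]
    exact this
  · have hv : v.IsReal := by
      by_contra hv
      exact ha fun h => absurd h hv
    rw [nrm_real hv ha, nrm_real hv has]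

lemma nrm_symm {v : Plc K} {a b : Kˣ} (h : b ∈ nrm v (a : K)) : a ∈ nrm v (b : K) := by
  obtain ⟨c, ⟨p, q, hpq⟩, hbc⟩ := mem_nrm.1 h
  by_cases hq : q = 0
  · have hp : p ≠ 0 := by
      rintro rfl
      exact c.ne_zero (by rw [← hpq, hq]; ring)
    have : b ∈ loc v := by
      have hc : c ∈ loc v := by
        rw [show c = (Units.mk0 p hp) ^ 2 from Units.ext (by simp [← hpq, hq])]
        exact sq_mem_loc v _
      simpa using mul_mem hbc hc
    rw [nrm_eq_top this]; trivial
  · have h1 : a ∈ nrm v (c : K) := by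
      refine nrm_of_sol ⟨p / q, 1 / q, ?_⟩
      rw [← hpq]; field_simp; ring
    have h2 := nrm_congr_le (v := v) (a := b) (s := (b * c⁻¹)⁻¹) (inv_mem hbc)
    rw [show b * (b * c⁻¹)⁻¹ = c by simp] at h2
    exact h2 h1

lemma mem_nrm_of_units {v : Prm K} (h2 : v.val 2 = 1) {a b : Kˣ} (ha : v.val (a : K) = 1)
    (hb : v.val (b : K) = 1) : b ∈ nrm (.inl v) (a : K) := by
  obtain ⟨a', ha'⟩ := v.exists_valuation_sub_lt_of_integer (K := K) ha.le 1
  obtain ⟨b', hb'⟩ := v.exists_valuation_sub_lt_of_integer (K := K) hb.le 1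
  have hmax := v.isMaximal
  let k := 𝓞 K ⧸ v.asIdeal
  let _ : Field k := Ideal.Quotient.field _
  have : Finite k := Ideal.finiteQuotientOfFreeOfNeBot _ v.ne_bot
  have : Fintype k := Fintype.ofFinite _
  let π := Ideal.Quotient.mk v.asIdeal
  have hval : ∀ x : 𝓞 K, π x ≠ 0 ↔ v.val (x : K) = 1 := by
    intro x
    rw [Prm.val_eq_one_iff, Ne, Ideal.Quotient.eq_zero_iff_mem]
  have hk2 : (2 : k) ≠ 0 := by
    have := (hval 2).2 (by rw [show ((2 : 𝓞 K) : K) = 2 from map_ofNat _ 2]; exact h2)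
    rwa [map_ofNat] at this
  have hka : π a' ≠ 0 := by
    rw [hval]
    have := Valuation.map_add_eq_of_lt_right v.val (x := (a' : K) - a) (y := a) (by rw [ha]; exact ha')
    rw [sub_add_cancel] at this
    exact this.trans ha
  have hodd : Fintype.card k % 2 = 1 := by
    refine FiniteField.odd_card_of_char_ne_two ?_
    intro hc
    apply hk2
    have := CharP.cast_eq_zero k (ringChar k)
    rw [hc] at this
    exact_mod_cast this
  obtain ⟨x, y, hxy⟩ := FiniteField.exists_root_sum_quadratic (R := k)
    (f := Polynomial.X ^ 2 - Polynomial.C (π b')) (g := Polynomial.C (-π a') * Polynomial.X ^ 2)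
    (Polynomial.degree_X_pow_sub_C (by norm_num) _)
    (Polynomial.degree_C_mul_X_pow 2 (neg_ne_zero.2 hka)) hodd
  obtain ⟨p, rfl⟩ := Ideal.Quotient.mk_surjective x
  obtain ⟨q, rfl⟩ := Ideal.Quotient.mk_surjective y
  have hmem : p ^ 2 - b' - a' * q ^ 2 ∈ v.asIdeal := by
    rw [← Ideal.Quotient.eq_zero_iff_mem]
    simp only [Polynomial.eval_sub, Polynomial.eval_pow, Polynomial.eval_X, Polynomial.eval_C,
      Polynomial.eval_mul] at hxy
    simp only [map_sub, map_mul, map_pow]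
    rw [← hxy]; ring
  rw [← Prm.val_lt_one_iff] at hmem
  set n : K := (p : K) ^ 2 - a * (q : K) ^ 2 with hn
  have h4 : v.val 4 = 1 := by
    rw [show (4 : K) = 2 * 2 by norm_num, map_mul, h2, one_mul]
  have hnb : v.val (n - b) < 1 := by
    have : n - b = ((p ^ 2 - b' - a' * q ^ 2 : 𝓞 K) : K) + ((b' : K) - b) +
        ((a' : K) - a) * (q : K) ^ 2 := by
      rw [hn]; push_cast; ring
    rw [this]
    refine val_add_lt (val_add_lt hmem hb') ?_
    rw [mul_comm]
    exact val_mul_lt_one (by rw [map_pow]; exact pow_le_one₀ zero_le (v.val_le_one q)) ha'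
  have hb0 := b.ne_zero
  have hnear : NearSq v.val (n / b) := nearSq_of_sub_one (by
    rw [show n / b - 1 = (n - b) / b by field_simp, map_div₀, hb, div_one, h4]; exact hnb)
  have hn0 : n ≠ 0 := by
    intro h0; apply hnear.ne_zero; rw [h0, zero_div]
  rw [mem_nrm]
  refine ⟨Units.mk0 n hn0, ⟨_, _, hn.symm⟩, ?_⟩
  have := hnear.inv
  rw [inv_div] at this
  rw [mem_loc_inl, Units.val_mul, Units.val_inv_eq_inv_val, Units.val_mk0, ← div_eq_mul_inv]
  exact this

end Places

section Ext

variable {K L : Type*} [Field K] [NumberField K] [Field L] [NumberField L] [Algebra K L]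

lemma map_mem_loc (w : Prm L) {x : Kˣ} (h : x ∈ loc (.inl (below K w))) :
    Units.map (algebraMap K L : K →* L) x ∈ loc (.inl w) :=
  NearSq.map (below_isEquiv w) h

lemma map_mem_nrm (w : Prm L) {a : K} {x : Kˣ} (h : x ∈ nrm (.inl (below K w)) a) :
    Units.map (algebraMap K L : K →* L) x ∈ nrm (.inl w) (algebraMap K L a) := by
  obtain ⟨c, ⟨p, q, hc⟩, h⟩ := mem_nrm.1 h
  refine mem_nrm.2 ⟨Units.map (algebraMap K L : K →* L) c,
    ⟨algebraMap K L p, algebraMap K L q, ?_⟩, ?_⟩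
  · rw [Units.coe_map, ← hc]; simp
  · rw [← map_inv, ← map_mul]; exact map_mem_loc w h

/-- All symbols from below die over an extension containing a local nonsquare. -/
lemma mem_nrm_of_isSquare (w : Prm L) {t : Kˣ} (ht : t ∉ loc (.inl (below K w)))
    (hts : IsSquare (algebraMap K L t)) (a b : Kˣ) :
    Units.map (algebraMap K L : K →* L) b ∈ nrm (.inl w) (algebraMap K L a) := by
  set v : Plc K := .inl (below K w) with hv
  set i := Units.map (algebraMap K L : K →* L)
  have hit : ∀ c : L, i t ∈ nrm (.inl w) c := by
    intro c
    obtain ⟨d, hd⟩ := hts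
    have hd0 : d ≠ 0 := by
      rintro rfl
      simp at hd
    refine loc_le_nrm _ _ ?_
    rw [show i t = (Units.mk0 d hd0) ^ 2 from Units.ext (by simp [i, hd, sq])]
    exact sq_mem_loc _ _
  by_cases ha : a ∈ loc v
  · have := map_mem_loc w ha
    rw [show algebraMap K L a = (i a : Lˣ) from rfl, nrm_eq_top this]; trivial
  by_cases hb : b ∈ nrm v (a : K)
  · exact map_mem_nrm w hb
  have h2t := index_nrm ht
  obtain ⟨x, hxa, hxt⟩ : ∃ x, x ∉ nrm v (a : K) ∧ x ∉ nrm v (t : K) := by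
    obtain ⟨y, hy⟩ : ∃ y, y ∉ nrm v (t : K) := by
      by_contra! hc
      rw [show nrm v (t : K) = ⊤ from eq_top_iff.2 fun x _ => hc x, Subgroup.index_top] at h2t
      omega
    by_cases hya : y ∈ nrm v (a : K)
    · by_cases hbt : b ∈ nrm v (t : K)
      · refine ⟨b * y, ?_, ?_⟩
        · rwa [Subgroup.mul_mem_cancel_right _ hya]
        · rwa [Subgroup.mul_mem_cancel_left _ hbt]
      · exact ⟨b, hb, hbt⟩
    · exact ⟨y, hya, hy⟩
  have h1 : a * t ∈ nrm v (x : K) :=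
    mul_mem_nrm (fun h => hxa (nrm_symm h)) (fun h => hxt (nrm_symm h))
  have h2 := map_mem_nrm w h1
  rw [map_mul, Subgroup.mul_mem_cancel_right _ (hit _)] at h2
  have h3 := nrm_symm (b := i a) (a := i x) h2
  have h4 : b * x ∈ nrm v (a : K) := mul_mem_nrm hb hxa
  have h5 := map_mem_nrm w h4
  rw [map_mul] at h5
  exact (Subgroup.mul_mem_cancel_right _ h3).1 h5

end Ext

section SqIdx

/-- The index of the subgroup of squares. -/
noncomputable def sqIdx (G : Type*) [CommGroup G] : ℕ := (powMonoidHom 2 : G →* G).range.index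

lemma sqIdx_congr {G H : Type*} [CommGroup G] [CommGroup H] (e : G ≃* H) : sqIdx G = sqIdx H := by
  rw [sqIdx, sqIdx, ← Subgroup.index_map_equiv (powMonoidHom 2 : G →* G).range e]
  congr 1
  ext x
  simp only [Subgroup.mem_map, MonoidHom.mem_range, powMonoidHom_apply]
  constructor
  · rintro ⟨_, ⟨y, rfl⟩, rfl⟩
    exact ⟨e y, by simp⟩
  · rintro ⟨y, rfl⟩
    exact ⟨e.symm y ^ 2, ⟨_, rfl⟩, by simp⟩

lemma sqIdx_prod (G H : Type*) [CommGroup G] [CommGroup H] :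
    sqIdx (G × H) = sqIdx G * sqIdx H := by
  rw [sqIdx, sqIdx, sqIdx, ← Subgroup.index_prod]
  congr 1
  ext ⟨x, y⟩
  simp only [Subgroup.mem_prod, MonoidHom.mem_range, powMonoidHom_apply]
  constructor
  · rintro ⟨⟨a, b⟩, h⟩
    exact ⟨⟨a, congrArg Prod.fst h⟩, ⟨b, congrArg Prod.snd h⟩⟩
  · rintro ⟨⟨a, rfl⟩, ⟨b, rfl⟩⟩
    exact ⟨(a, b), rfl⟩

lemma sqIdx_pi (ι : Type*) [Fintype ι] (G : Type*) [CommGroup G] :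
    sqIdx (ι → G) = sqIdx G ^ Fintype.card ι := by
  rw [sqIdx, sqIdx, ← Finset.card_univ, ← Finset.prod_const, ← Subgroup.index_pi]
  congr 1
  ext x
  simp only [Subgroup.mem_pi, MonoidHom.mem_range, powMonoidHom_apply]
  constructor
  · rintro ⟨y, rfl⟩ i _
    exact ⟨y i, rfl⟩
  · intro h
    choose y hy using fun i => h i trivial
    exact ⟨y, funext hy⟩

lemma sqIdx_int : sqIdx (Multiplicative ℤ) = 2 := by
  rw [sqIdx, Subgroup.index_eq_two_iff]
  refine ⟨Multiplicative.ofAdd 1, fun b => ?_⟩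
  have key : ∀ b : Multiplicative ℤ, b ∈ (powMonoidHom 2 : Multiplicative ℤ →* _).range ↔
      Even (Multiplicative.toAdd b) := by
    intro b
    constructor
    · rintro ⟨c, rfl⟩
      exact ⟨Multiplicative.toAdd c, by simp [two_mul]⟩
    · rintro ⟨c, hc⟩
      exact ⟨Multiplicative.ofAdd c, by
        apply Multiplicative.toAdd.injective; simp [hc, two_mul]⟩
  rw [key, key, toAdd_mul, toAdd_ofAdd, Int.even_add_one]
  by_cases h : Even (Multiplicative.toAdd b) <;> simp [h]

/-- Adding an infinite cyclic quotient doubles the index of the squares. -/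
lemma sqIdx_ker {G : Type*} [CommGroup G] (φ : G →* Multiplicative ℤ) (hφ : φ ≠ 1) :
    sqIdx G = 2 * sqIdx φ.ker := by
  obtain ⟨g, hg⟩ := Subgroup.isCyclic_iff_exists_zpowers_eq_top (φ.range) |>.1 inferInstance
  obtain ⟨b, hb⟩ : g ∈ φ.range := by rw [← hg]; exact Subgroup.mem_zpowers g
  have hg1 : g ≠ 1 := by
    rintro rfl
    apply hφ
    rw [← MonoidHom.range_eq_bot_iff, ← hg, Subgroup.zpowers_one_eq_bot]
  let f : φ.ker × Multiplicative ℤ →* G :=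
    (φ.ker.subtype).coprod (zpowersHom G b)
  have hf : ∀ p, f p = p.1 * b ^ (Multiplicative.toAdd p.2) := fun p => rfl
  have hbij : Function.Bijective f := by
    constructor
    · rw [injective_iff_map_eq_one]
      rintro ⟨k, n⟩ h
      have h1 := congrArg φ h
      rw [hf, map_mul, map_one, map_zpow, hb, (MonoidHom.mem_ker).1 k.2, one_mul] at h1
      have hn : Multiplicative.toAdd n = 0 := by
        have h2 := congrArg Multiplicative.toAdd h1
        rw [toAdd_zpow, toAdd_one, smul_eq_mul, mul_eq_zero] at h2
        exact h2.resolve_right fun h => hg1 (Multiplicative.toAdd.injective h)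
      have hk : k = 1 := by
        rw [hf, hn] at h
        exact Subtype.ext (by simpa using h)
      rw [hk, show n = 1 from Multiplicative.toAdd.injective hn]; rfl
    · intro x
      have : φ x ∈ Subgroup.zpowers g := by rw [hg]; exact ⟨x, rfl⟩
      obtain ⟨n, hn⟩ := this
      refine ⟨(⟨x * (b ^ n)⁻¹, ?_⟩, Multiplicative.ofAdd n), ?_⟩
      · rw [MonoidHom.mem_ker, map_mul, map_inv, map_zpow, hb]
        simp only at hn
        rw [hn, mul_inv_cancel]
      · rw [hf]; simp
  rw [← sqIdx_congr (MulEquiv.ofBijective f hbij), sqIdx_prod, sqIdx_int, mul_comm]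

end SqIdx

section Units

variable {K : Type*} [Field K] [NumberField K]

open NumberField

lemma sqIdx_units : sqIdx (𝓞 K)ˣ = 2 ^ Fintype.card (InfinitePlace K) := by
  let f : Units.torsion K × (Fin (Units.rank K) → Multiplicative ℤ) →* (𝓞 K)ˣ :=
    { toFun := fun p => p.1 * ∏ i, Units.fundSystem K i ^ (Multiplicative.toAdd (p.2 i))
      map_one' := by simp
      map_mul' := by
        intro p q
        simp only [Prod.fst_mul, Subgroup.coe_mul, Prod.snd_mul, Pi.mul_apply, toAdd_mul, zpow_add,
          Finset.prod_mul_distrib]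
        exact mul_mul_mul_comm _ _ _ _ }
  have hbij : Function.Bijective f := by
    rw [Function.bijective_iff_existsUnique]
    intro x
    obtain ⟨⟨ζ, e⟩, h1, h2⟩ := Units.exist_unique_eq_mul_prod K x
    refine ⟨(ζ, fun i => Multiplicative.ofAdd (e i)), h1.symm, ?_⟩
    rintro ⟨ζ', e'⟩ h
    have := h2 (ζ', fun i => Multiplicative.toAdd (e' i)) h.symm
    rw [Prod.mk.injEq] at this
    rw [Prod.mk.injEq]
    refine ⟨this.1, ?_⟩
    rw [← this.2]; rfl
  have htor : sqIdx (Units.torsion K) = 2 := by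
    rw [sqIdx, IsCyclic.index_powMonoidHom_range]
    refine Nat.gcd_eq_right ?_
    have h : orderOf (-1 : (𝓞 K)ˣ) = 2 := by
      rw [orderOf_eq_prime_iff]
      refine ⟨by simp, ?_⟩
      intro h
      have h1 := congrArg (fun x : (𝓞 K)ˣ => ((x : 𝓞 K) : K)) h
      simp only [Units.val_neg, Units.val_one, map_neg, map_one] at h1
      norm_num at h1
    have hm : (-1 : (𝓞 K)ˣ) ∈ Units.torsion K := by
      rw [Units.torsion, CommGroup.mem_torsion, ← orderOf_pos_iff, h]; norm_num
    rw [← h, ← Subgroup.orderOf_mk _ hm]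
    exact orderOf_dvd_natCard _
  rw [← sqIdx_congr (MulEquiv.ofBijective f hbij), sqIdx_prod, htor, sqIdx_pi, sqIdx_int,
    Fintype.card_fin, Units.rank, ← pow_succ']
  congr 1
  have : 0 < Fintype.card (InfinitePlace K) := Fintype.card_pos
  omega

/-- The group of `S`-units. -/
def uS (S : Finset (Prm K)) : Subgroup Kˣ where
  carrier := {x | ∀ v : Prm K, v ∉ S → Prm.val v (x : K) = 1}
  one_mem' := fun v _ => by simp
  mul_mem' := fun hx hy v hv => by rw [Units.val_mul, map_mul, hx v hv, hy v hv, one_mul]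
  inv_mem' := fun hx v hv => by rw [Units.val_inv_eq_inv_val, map_inv₀, hx v hv, inv_one]

lemma uS_mono {S T : Finset (Prm K)} (h : S ⊆ T) : uS S ≤ uS T :=
  fun _ hx v hv => hx v fun h' => hv (h h')

lemma exists_mem_uS (x : Kˣ) : ∃ S : Finset (Prm K), x ∈ uS S :=
  ⟨(finite_val_ne_one x.ne_zero).toFinset, fun v hv => by simpa using hv⟩

lemma mem_uS_of_sq {S : Finset (Prm K)} {x : Kˣ} (h : x ^ 2 ∈ uS S) : x ∈ uS S := by
  intro v hv
  have := h v hv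
  rw [Units.val_pow_eq_pow_val, map_pow] at this
  exact (pow_eq_one_iff_of_nonneg zero_le two_ne_zero).1 this

lemma units_mem_uS (x : (𝓞 K)ˣ) : Units.map (algebraMap (𝓞 K) K : 𝓞 K →* K) x ∈
    uS (∅ : Finset (Prm K)) := by
  intro v _
  have h1 := v.val_le_one (x : 𝓞 K)
  have h2 := v.val_le_one ((x⁻¹ : (𝓞 K)ˣ) : 𝓞 K)
  refine le_antisymm h1 (not_lt.1 fun h => ?_)
  have h3 : v.val (((x⁻¹ : (𝓞 K)ˣ) : 𝓞 K) : K) * v.val ((x : 𝓞 K) : K) < 1 := by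
    rw [← map_mul]
    exact val_mul_lt_one h2 h
  rw [← map_mul, ← map_mul, ← Units.val_mul, inv_mul_cancel] at h3
  simp at h3

/-- `∅`-units are the units of the ring of integers. -/
noncomputable def unitsEquiv : (𝓞 K)ˣ ≃* uS (∅ : Finset (Prm K)) :=
  MulEquiv.ofBijective
    ((Units.map (algebraMap (𝓞 K) K : 𝓞 K →* K)).codRestrict _ units_mem_uS) (by
    constructor
    · intro x y h
      have h := congrArg Subtype.val h
      exact Units.map_injective (RingOfIntegers.coe_injective) h
    · rintro ⟨x, hx⟩
      have h_int : ∀ y : Kˣ, y ∈ uS (∅ : Finset (Prm K)) → ∃ z : 𝓞 K, algebraMap (𝓞 K) K z = y :=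
        fun y hy => HeightOneSpectrum.mem_integers_of_valuation_le_one K (y : K)
          fun v => (hy v (by simp)).le
      obtain ⟨y, hy⟩ := h_int x hx
      obtain ⟨z, hz⟩ := h_int x⁻¹ (inv_mem hx)
      have hyz : y * z = 1 := by
        apply RingOfIntegers.coe_injective
        rw [map_mul, hy, hz]; simp
      refine ⟨⟨y, z, hyz, by rw [mul_comm, hyz]⟩, Subtype.ext (Units.ext hy)⟩)

lemma exists_generator_pow (v : Prm K) :
    ∃ x : Kˣ, v.val (x : K) ≠ 1 ∧ ∀ w : Prm K, w ≠ v → w.val (x : K) = 1 := by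
  let I : nonZeroDivisors (Ideal (𝓞 K)) := ⟨v.asIdeal, mem_nonZeroDivisors_of_ne_zero v.ne_bot⟩
  have h1 : ClassGroup.mk0 (I ^ Fintype.card (ClassGroup (𝓞 K))) = 1 := by
    rw [map_pow, pow_card_eq_one]
  have hcard : Fintype.card (ClassGroup (𝓞 K)) ≠ 0 := Fintype.card_ne_zero
  rw [ClassGroup.mk0_eq_one_iff] at h1
  obtain ⟨k, hk⟩ := h1
  have hk : v.asIdeal ^ Fintype.card (ClassGroup (𝓞 K)) = Ideal.span {k} := hk
  have hk0 : k ≠ 0 := by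
    rintro rfl
    rw [Ideal.span_singleton_eq_bot.2 rfl] at hk
    exact v.ne_bot (pow_eq_zero_iff hcard |>.1 hk)
  have hk0' : (k : K) ≠ 0 := by simpa using hk0
  refine ⟨Units.mk0 (k : K) hk0', ?_, fun w hw => ?_⟩
  · refine ne_of_lt ((v.val_lt_one_iff k).2 ?_)
    have : k ∈ v.asIdeal ^ Fintype.card (ClassGroup (𝓞 K)) := by
      rw [hk]; exact Ideal.mem_span_singleton_self k
    exact Ideal.pow_le_self hcard this
  · refine (w.val_eq_one_iff k).2 fun h => hw ?_
    have h2 : v.asIdeal ^ Fintype.card (ClassGroup (𝓞 K)) ≤ w.asIdeal := by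
      rw [hk, Ideal.span_singleton_le_iff_mem]; exact h
    exact (Prm.eq_of_le (w.isPrime.le_of_pow_le h2)).symm

/-- The order of an `S`-unit at a prime. -/
noncomputable def ordHom (v : Prm K) (S : Finset (Prm K)) : uS S →* Multiplicative ℤ where
  toFun x := Multiplicative.ofAdd (WithZero.log (v.val ((x : Kˣ) : K)))
  map_one' := by simp
  map_mul' x y := by
    rw [← ofAdd_add, ← WithZero.log_mul (by simp) (by simp)]
    simp

lemma ordHom_eq_one {v : Prm K} {S : Finset (Prm K)} {x : uS S} :
    ordHom v S x = 1 ↔ v.val ((x : Kˣ) : K) = 1 := by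
  change Multiplicative.ofAdd (WithZero.log (v.val ((x : Kˣ) : K))) = Multiplicative.ofAdd 0 ↔ _
  rw [Multiplicative.ofAdd.injective.eq_iff]
  constructor
  · intro h
    rw [← WithZero.exp_log (x := v.val ((x : Kˣ) : K)) (by simp), h, WithZero.exp_zero]
  · intro h; rw [h, WithZero.log_one]

lemma sqIdx_uS (S : Finset (Prm K)) :
    sqIdx (uS S) = 2 ^ (S.card + Fintype.card (InfinitePlace K)) := by
  classical
  induction S using Finset.induction_on with
  | empty => rw [← sqIdx_congr unitsEquiv, sqIdx_units, Finset.card_empty, zero_add]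
  | insert v S hv ih =>
    rw [sqIdx_ker (ordHom v (insert v S)), Finset.card_insert_of_notMem hv, add_right_comm,
      pow_succ', ← ih]
    · congr 1
      refine sqIdx_congr (MulEquiv.ofBijective
        (((uS (insert v S)).subtype.comp (ordHom v (insert v S)).ker.subtype).codRestrict (uS S)
          fun x w hw => ?_) ⟨fun x y h => ?_, fun x => ?_⟩)
      · by_cases hwv : w = v
        · rw [hwv]; exact ordHom_eq_one.1 x.2
        · exact x.1.2 w (by simp [hwv, hw])
      · have h' := congrArg Subtype.val h
        exact Subtype.ext (Subtype.ext h')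
      · exact ⟨⟨⟨x, uS_mono (Finset.subset_insert v S) x.2⟩, ordHom_eq_one.2 (x.2 v hv)⟩, rfl⟩
    · obtain ⟨x, hx, hx'⟩ := exists_generator_pow v
      intro h
      have hxS : x ∈ uS (insert v S) := fun w hw => hx' w fun h => hw (by simp [h])
      exact hx (ordHom_eq_one.1 (DFunLike.congr_fun h ⟨x, hxS⟩))

/-- Subgroups of `S`-units containing all squares. -/
lemma relIndex_sq_uS (S : Finset (Prm K)) :
    ((uS S).map (powMonoidHom 2)).relIndex (uS S) =
      2 ^ (S.card + Fintype.card (InfinitePlace K)) := by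
  rw [← sqIdx_uS, sqIdx, Subgroup.relIndex]
  congr 1
  ext x
  rw [Subgroup.mem_subgroupOf, Subgroup.mem_map, MonoidHom.mem_range]
  constructor
  · rintro ⟨y, hy, h⟩
    exact ⟨⟨y, hy⟩, Subtype.ext h⟩
  · rintro ⟨y, rfl⟩
    exact ⟨y, y.2, rfl⟩

/-- `S` is large enough to generate the class group. -/
def Good (S : Finset (Prm K)) : Prop :=
  ∀ I : Ideal (𝓞 K), I ≠ ⊥ → ∃ k ∈ I, k ≠ 0 ∧
    ∀ v : Prm K, v ∉ S → ∀ x ∈ I, v.val (x : K) ≤ v.val (k : K)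

lemma Good.mono {S T : Finset (Prm K)} (hS : Good S) (h : S ⊆ T) : Good T := by
  intro I hI
  obtain ⟨k, hk, hk0, H⟩ := hS I hI
  exact ⟨k, hk, hk0, fun v hv => H v fun hv' => hv (h hv')⟩

variable (K) in
lemma exists_good : ∃ S : Finset (Prm K), Good S := by
  have h1 : ∀ c : ClassGroup (𝓞 K), ∃ J : nonZeroDivisors (Ideal (𝓞 K)), ClassGroup.mk0 J = c⁻¹ :=
    fun c => ClassGroup.mk0_surjective _
  choose J hJ using h1
  have h2 : ∀ c, ∃ x : 𝓞 K, x ∈ (J c : Ideal (𝓞 K)) ∧ x ≠ 0 := fun c =>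
    Submodule.exists_mem_ne_zero_of_ne_bot (nonZeroDivisors.ne_zero (J c).2)
  choose x hxJ hx using h2
  have hfin : (⋃ c, {v : Prm K | v.val ((x c : 𝓞 K) : K) ≠ 1}).Finite :=
    Set.finite_iUnion fun c => finite_val_ne_one (by simpa using hx c)
  refine ⟨hfin.toFinset, fun I hI => ?_⟩
  let I' : nonZeroDivisors (Ideal (𝓞 K)) := ⟨I, mem_nonZeroDivisors_of_ne_zero hI⟩
  obtain ⟨c, hc⟩ : ∃ c, ClassGroup.mk0 I' = c := ⟨_, rfl⟩
  have h3 : ClassGroup.mk0 (I' * J c) = 1 := by rw [map_mul, hJ, hc, mul_inv_cancel]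
  rw [ClassGroup.mk0_eq_one_iff] at h3
  obtain ⟨k, hk⟩ := h3
  have hk : I * (J c : Ideal (𝓞 K)) = Ideal.span {k} := hk
  have hkI : k ∈ I := by
    refine Ideal.mul_le_left (I := I) (J := (J c : Ideal (𝓞 K))) ?_
    rw [hk]
    exact Ideal.mem_span_singleton_self k
  refine ⟨k, hkI, ?_, fun v hv y hy => ?_⟩
  · rintro rfl
    rw [Ideal.span_singleton_eq_bot.2 rfl, Ideal.mul_eq_bot] at hk
    exact hk.elim hI (nonZeroDivisors.ne_zero (J c).2)
  · have hvx : v.val (x c : K) = 1 := by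
      by_contra h
      exact hv (hfin.mem_toFinset.2 (Set.mem_iUnion.2 ⟨c, h⟩))
    have h4 : y * x c ∈ Ideal.span {k} := by
      rw [← hk]
      exact Ideal.mul_mem_mul hy (hxJ c)
    obtain ⟨z, hz⟩ := Ideal.mem_span_singleton.1 h4
    have h5 : v.val (y : K) * v.val (x c : K) = v.val (k : K) * v.val (z : K) := by
      rw [← map_mul, ← map_mul, ← map_mul, ← map_mul, hz]
    rw [hvx, mul_one] at h5
    rw [h5]
    exact mul_le_of_le_one_right zero_le (v.val_le_one z)

lemma Good.exists_val {S : Finset (Prm K)} (hS : Good S) {p q : K} (h : p ≠ 0 ∨ q ≠ 0) :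
    ∃ k : Kˣ, ∀ v : Prm K, v ∉ S → v.val (k : K) = max (v.val p) (v.val q) := by
  obtain ⟨a, b, hb, rfl⟩ := IsFractionRing.div_surjective (A := 𝓞 K) p
  obtain ⟨c, d, hd, rfl⟩ := IsFractionRing.div_surjective (A := 𝓞 K) q
  have hb0 : (b : K) ≠ 0 := by simpa using nonZeroDivisors.ne_zero hb
  have hd0 : (d : K) ≠ 0 := by simpa using nonZeroDivisors.ne_zero hd
  have hI : Ideal.span {a * d, c * b} ≠ ⊥ := by
    rw [Ne, Ideal.span_eq_bot]
    intro hz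
    have h1 : (a : K) * d = 0 := by
      rw [← map_mul, hz (a * d) (by simp), map_zero]
    have h2 : (c : K) * b = 0 := by
      rw [← map_mul, hz (c * b) (by simp), map_zero]
    rcases h with h | h
    · exact h (div_eq_zero_iff.2 (.inl ((mul_eq_zero.1 h1).resolve_right hd0)))
    · exact h (div_eq_zero_iff.2 (.inl ((mul_eq_zero.1 h2).resolve_right hb0)))
  obtain ⟨k, hk, hk0, H⟩ := hS _ hI
  have hk0' : (k : K) ≠ 0 := by simpa using hk0
  refine ⟨Units.mk0 ((k : K) / (b * d)) (div_ne_zero hk0' (mul_ne_zero hb0 hd0)), fun v hv => ?_⟩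
  have hbd : (0 : ℤᵐ⁰) < v.val ((b : K) * d) := by
    rw [zero_lt_iff]; exact v.val.ne_zero_iff.2 (mul_ne_zero hb0 hd0)
  have e1 : v.val ((a : K) / b) = v.val ((a : K) * d) / v.val ((b : K) * d) := by
    rw [← map_div₀ v.val, mul_div_mul_right _ _ hd0]
  have e2 : v.val ((c : K) / d) = v.val ((c : K) * b) / v.val ((b : K) * d) := by
    rw [← map_div₀ v.val, mul_comm (b : K), mul_div_mul_right _ _ hb0]
  rw [e1, e2, Units.val_mk0, map_div₀, ← Monotone.map_max (f := (· / v.val ((b : K) * d)))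
    fun _ _ h => div_le_div_of_nonneg_right h hbd.le]
  congr 1
  refine le_antisymm ?_ (max_le ?_ ?_)
  · obtain ⟨x, y, hxy⟩ := Ideal.mem_span_pair.1 hk
    have : (k : K) = x * (a * d) + y * (c * b) := by rw [← hxy]; simp
    rw [this]
    refine (v.val.map_add _ _).trans (max_le_max ?_ ?_)
    · rw [map_mul]; exact mul_le_of_le_one_left zero_le (v.val_le_one x)
    · rw [map_mul]; exact mul_le_of_le_one_left zero_le (v.val_le_one y)
  · have := H v hv (a * d) (Ideal.subset_span (by simp))
    rw [← map_mul (algebraMap (𝓞 K) K)]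
    exact this
  · have := H v hv (c * b) (Ideal.subset_span (by simp))
    rw [← map_mul (algebraMap (𝓞 K) K)]
    exact this

lemma Good.exists_uniformizer {S : Finset (Prm K)} (hS : Good S) {v : Prm K} (hv : v ∉ S) :
    ∃ π : Kˣ, v.val (π : K) = WithZero.exp (-1) ∧
      ∀ w : Prm K, w ∉ S → w ≠ v → w.val (π : K) = 1 := by
  obtain ⟨k, hk, hk0, H⟩ := hS v.asIdeal v.ne_bot
  refine ⟨Units.mk0 (k : K) (by simpa using hk0), ?_, fun w hw hwv => ?_⟩
  · refine le_antisymm ?_ ?_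
    · have := (v.val_le_pow_iff k 1).2 (by simpa using hk)
      simpa using this
    · obtain ⟨π, hπ⟩ := v.intValuation_exists_uniformizer
      rw [← hπ, ← v.valuation_of_algebraMap (K := K)]
      refine H v hv π ?_
      rw [← Prm.val_lt_one_iff, v.valuation_of_algebraMap, hπ, ← WithZero.exp_zero,
        WithZero.exp_lt_exp]
      norm_num
  · obtain ⟨x, hx, hxw⟩ := SetLike.not_le_iff_exists.1 fun h => hwv (Prm.eq_of_le (v := v) h).symm
    have := H w hw x hx
    rw [(w.val_eq_one_iff x).2 hxw] at this
    exact le_antisymm (w.val_le_one k) this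

end Units

section Group

/-- Index of an intersection of independent subgroups. -/
lemma relIndex_iInf_of_surj {G ι : Type*} [CommGroup G] (T : Finset ι) (M : ι → Subgroup G)
    (H : Subgroup G) (h : ∀ x : ι → G, ∃ k ∈ H, ∀ v ∈ T, k * (x v)⁻¹ ∈ M v) :
    (⨅ v ∈ T, M v).relIndex H = ∏ v ∈ T, (M v).index := by
  classical
  let f : G →* ∀ v : T, G ⧸ M v := MonoidHom.pi fun v => QuotientGroup.mk' (M v)
  have hker : f.ker = ⨅ v ∈ T, M v := by
    ext x
    simp only [f, MonoidHom.mem_ker, Subgroup.mem_iInf, funext_iff, MonoidHom.pi_apply,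
      QuotientGroup.mk'_apply, Pi.one_apply, QuotientGroup.eq_one_iff, Subtype.forall]
  have hsurj : Function.Surjective (f.comp H.subtype) := by
    intro y
    choose x hx using fun v : T => QuotientGroup.mk_surjective (y v)
    obtain ⟨k, hk, H'⟩ := h fun v => if hv : v ∈ T then x ⟨v, hv⟩ else 1
    refine ⟨⟨k, hk⟩, funext fun v => ?_⟩
    have := H' v v.2
    simp only [v.2, dite_true] at this
    rw [← hx v]
    change (QuotientGroup.mk k : G ⧸ M v) = QuotientGroup.mk (x v)
    rw [eq_comm, QuotientGroup.eq]
    rwa [mul_comm]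
  rw [← hker, Subgroup.relIndex, show f.ker.subgroupOf H = (f.comp H.subtype).ker from rfl,
    Subgroup.index_ker,
    Nat.card_congr (MonoidHom.range_eq_top.2 hsurj ▸ Subgroup.topEquiv.toEquiv :
      (f.comp H.subtype).range ≃ _),
    Nat.card_pi]
  exact Finset.prod_coe_sort T fun v => (M v).index

end Group

section Approx

variable {K : Type*} [Field K] [NumberField K]

open NumberField

/-- The places in `S` and the infinite places. -/
noncomputable def plc (S : Finset (Prm K)) : Finset (Plc K) := S.disjSum Finset.univ

lemma inl_mem_plc {S : Finset (Prm K)} {v : Prm K} : (.inl v : Plc K) ∈ plc S ↔ v ∈ S := by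
  simp [plc]

lemma inr_mem_plc {S : Finset (Prm K)} {v : InfinitePlace K} : (.inr v : Plc K) ∈ plc S := by
  simp [plc]

lemma card_plc (S : Finset (Prm K)) :
    (plc S).card = S.card + Fintype.card (InfinitePlace K) := by
  rw [plc, Finset.card_disjSum, Finset.card_univ]

lemma prod_index_loc {S : Finset (Prm K)} (hS : ∀ v : Prm K, v ∉ S → v.val 2 = 1) :
    ∏ v ∈ plc S, (loc v).index = 4 ^ (plc S).card := by
  classical
  rw [card_plc, plc, Finset.prod_disjSum]
  have h1 : ∏ v ∈ S, (loc (.inl v : Plc K)).index = 4 ^ S.card * 2 ^ Module.finrank ℚ K := by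
    rw [← prod_cNum hS, ← Finset.prod_const, ← Finset.prod_mul_distrib]
    exact Finset.prod_congr rfl fun v _ => index_nsq v
  have h2 : ∏ v : InfinitePlace K, (loc (.inr v : Plc K)).index =
      2 ^ InfinitePlace.nrRealPlaces K := by
    have : ∀ v : InfinitePlace K, (loc (.inr v : Plc K)).index = if v.IsReal then 2 else 1 := by
      intro v
      split_ifs with hv
      · exact index_posAt_real hv
      · change (posAt v).index = 1
        rw [posAt_complex hv, Subgroup.index_top]
    simp_rw [this]
    rw [Finset.prod_ite, Finset.prod_const, Finset.prod_const_one, mul_one,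
      InfinitePlace.nrRealPlaces, Fintype.card_subtype]
  rw [h1, h2, ← InfinitePlace.card_add_two_mul_card_eq_rank,
    InfinitePlace.card_eq_nrRealPlaces_add_nrComplexPlaces, mul_assoc, ← pow_add,
    show (4 : ℕ) = 2 ^ 2 by norm_num, ← pow_mul, ← pow_mul, ← pow_add]
  congr 1
  ring

lemma exists_sign (x : InfinitePlace K → Kˣ) : ∃ k : K, ∀ v : InfinitePlace K,
    0 < (v.embedding (k * ((x v)⁻¹ : Kˣ))).re := by
  have hd := InfinitePlace.denseRange_algebraMap_pi K
  obtain ⟨k, hk⟩ := hd.exists_mem_open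
    (s := Set.pi Set.univ fun v : InfinitePlace K => Metric.ball (WithAbs.toAbs v.1 (x v : K)) (v (x v : K)))
    (isOpen_set_pi Set.finite_univ fun v _ => Metric.isOpen_ball)
    ⟨fun v => WithAbs.toAbs v.1 (x v : K), fun v _ => Metric.mem_ball_self (by
      rw [← InfinitePlace.norm_embedding_eq, norm_pos_iff]; simp)⟩
  refine ⟨k, fun v => ?_⟩
  have h1 := hk v trivial
  rw [Metric.mem_ball, dist_eq_norm] at h1
  have h2 : v (k - x v) < v (x v : K) := h1
  rw [← InfinitePlace.norm_embedding_eq, ← InfinitePlace.norm_embedding_eq] at h2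
  have h3 : ‖v.embedding (k * ((x v)⁻¹ : Kˣ)) - 1‖ < 1 := by
    have hx := (x v).ne_zero
    rw [show v.embedding (k * ((x v)⁻¹ : Kˣ)) - 1 = v.embedding (k - x v) / v.embedding (x v) by
      rw [← map_div₀, ← map_one v.embedding, ← map_sub]; congr 1
      rw [Units.val_inv_eq_inv_val]; field_simp, norm_div, div_lt_one (by simp)]
    exact h2
  have h4 := (abs_lt.1 ((Complex.abs_re_le_norm _).trans_lt h3)).1
  rw [Complex.sub_re, Complex.one_re] at h4
  linarith

/-- Weak approximation, modulo local squares. -/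
lemma approx (S : Finset (Prm K)) (x : Plc K → Kˣ) :
    ∃ k : Kˣ, ∀ v ∈ plc S, k * (x v)⁻¹ ∈ loc v := by
  classical
  obtain ⟨s, hs⟩ := exists_sign fun v => x (.inr v)
  have hs0 : s ≠ 0 := by
    rintro rfl
    obtain ⟨v⟩ := (inferInstance : Nonempty (InfinitePlace K))
    simpa using hs v
  let X : Prm K → K := fun v => x (.inl v)
  have hX : ∀ v, X v ≠ 0 := fun v => (x (.inl v)).ne_zero
  obtain ⟨⟨d, hd'⟩, hd⟩ := IsLocalization.exist_integer_multiples_of_finset (nonZeroDivisors (𝓞 K))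
    (S.image X)
  have hd0 : (d : K) ≠ 0 := by simpa using nonZeroDivisors.ne_zero hd'
  have h1 : ∀ v : S, ∃ z : 𝓞 K, algebraMap (𝓞 K) K z = (d : K) * X v := by
    intro v
    obtain ⟨z, hz⟩ := hd (X v) (Finset.mem_image_of_mem X v.2)
    exact ⟨z, by rw [hz, Algebra.smul_def]⟩
  choose z hz using h1
  have h2 : ∀ v : Prm K, ∃ N : ℕ, ∀ n ≥ N, ∀ y ∈ v.asIdeal ^ n,
      v.val ((y : 𝓞 K) : K) < v.val (4 * ((d : K) * X v)) := fun v =>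
    v.exists_pow_small (mul_ne_zero (by norm_num : (4 : K) ≠ 0) (mul_ne_zero hd0 (hX v)))
  choose N hN using h2
  obtain ⟨y, hy⟩ := IsDedekindDomain.exists_forall_sub_mem_ideal (s := S)
    (fun v : Prm K => v.asIdeal) N (fun v _ => v.prime)
    (fun v _ w _ hvw h => hvw (HeightOneSpectrum.ext h)) z
  have h3 : ∀ v : Prm K, ∃ N : ℕ, ∀ n ≥ N, ∀ y ∈ v.asIdeal ^ n,
      v.val ((y : 𝓞 K) : K) < v.val (4 * X v / s) := fun v =>
    v.exists_pow_small (div_ne_zero (mul_ne_zero (by norm_num : (4 : K) ≠ 0) (hX v)) hs0)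
  choose N' hN' using h3
  let m : ℕ := 2 * ∏ v ∈ S, Ideal.absNorm v.asIdeal
  have hm1 : 1 < m := by
    have : 0 < ∏ v ∈ S, Ideal.absNorm v.asIdeal := Finset.prod_pos fun v _ =>
      Nat.pos_of_ne_zero (Ideal.absNorm_ne_zero_of_nonZeroDivisors
        ⟨v.asIdeal, mem_nonZeroDivisors_of_ne_zero v.ne_bot⟩)
    simp only [m]; omega
  have hmS : ∀ v ∈ S, (m : 𝓞 K) ∈ v.asIdeal := by
    intro v hv
    have : Ideal.absNorm v.asIdeal ∣ m := Dvd.dvd.mul_left (Finset.dvd_prod_of_mem _ hv) 2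
    obtain ⟨c, hc⟩ := this
    rw [hc, Nat.cast_mul]
    exact Ideal.mul_mem_right _ _ (Ideal.absNorm_mem _)
  have hev : ∀ᶠ j : ℕ in Filter.atTop, (∀ v ∈ S, N' v ≤ j) ∧ ∀ v : InfinitePlace K,
      0 < (v.embedding (((y : K) / (d : K) + (m : K) ^ j * s) * ((x (.inr v))⁻¹ : Kˣ))).re := by
    refine Filter.Eventually.and ?_ ?_
    · rw [Filter.eventually_all_finset]
      exact fun v _ => Filter.eventually_ge_atTop _
    · rw [Filter.eventually_all]
      intro v
      have h4 : Filter.Tendsto (fun j : ℕ => (m : ℝ) ^ j * (v.embedding (s * ((x (.inr v))⁻¹ : Kˣ))).re)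
          Filter.atTop Filter.atTop :=
        (tendsto_pow_atTop_atTop_of_one_lt (by exact_mod_cast hm1)).atTop_mul_const (hs v)
      filter_upwards [h4.eventually_gt_atTop
        (-(v.embedding ((y : K) / (d : K) * ((x (.inr v))⁻¹ : Kˣ) : K)).re)] with j hj
      have h5 : v.embedding ((m : K) ^ j * (s * ((x (.inr v))⁻¹ : Kˣ))) =
          ((m : ℝ) ^ j : ℝ) * v.embedding (s * ((x (.inr v))⁻¹ : Kˣ)) := by
        rw [map_mul _ ((m : K) ^ j), map_pow, map_natCast]
        push_cast
        rfl
      rw [add_mul, map_add, Complex.add_re, mul_assoc, h5, Complex.re_ofReal_mul]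
      linarith
  obtain ⟨j, hj1, hj2⟩ := hev.exists
  set k : K := (y : K) / (d : K) + (m : K) ^ j * s with hk
  have hfin : ∀ v ∈ S, v.val (k / X v - 1) < v.val 4 := by
    intro v hv
    have e : k / X v - 1 = ((y - z ⟨v, hv⟩ : 𝓞 K) : K) / ((d : K) * X v) + ((m ^ j : 𝓞 K) : K) * (s / X v) := by
      rw [hk, show ((y - z ⟨v, hv⟩ : 𝓞 K) : K) = (y : K) - d * X v by
        rw [← hz ⟨v, hv⟩]; exact map_sub (algebraMap (𝓞 K) K) _ _,
        show ((m ^ j : 𝓞 K) : K) = (m : K) ^ j by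
        exact (map_pow (algebraMap (𝓞 K) K) _ _).trans (by rw [map_natCast])]
      have := hX v
      field_simp
      ring
    rw [e]
    refine val_add_lt ?_ ?_
    · have := hN v _ le_rfl _ (hy v hv)
      rw [map_div₀]
      rw [map_mul] at this
      rwa [div_lt_iff₀ (by rw [zero_lt_iff]; exact v.val.ne_zero_iff.2 (mul_ne_zero hd0 (hX v)))]
    · have := hN' v j (hj1 v hv) _ (Ideal.pow_mem_pow (hmS v hv) j)
      rw [map_mul, ← lt_div_iff₀ (by
        rw [zero_lt_iff]; exact v.val.ne_zero_iff.2 (div_ne_zero hs0 (hX v))), ← map_div₀]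
      rwa [show (4 : K) / (s / X v) = 4 * X v / s by rw [div_div_eq_mul_div]]
  have hk0 : k ≠ 0 := by
    intro h
    obtain ⟨v⟩ := (inferInstance : Nonempty (InfinitePlace K))
    simpa [h] using hj2 v
  refine ⟨Units.mk0 k hk0, fun v hv => ?_⟩
  rcases v with v | v
  · exact nearSq_of_sub_one (by
      rw [Units.val_mul, Units.val_inv_eq_inv_val, Units.val_mk0, ← div_eq_mul_inv]
      exact hfin v (inl_mem_plc.1 hv))
  · exact fun _ => hj2 v

end Approx

section Above

variable {K L : Type*} [Field K] [NumberField K] [Field L] [NumberField L] [Algebra K L]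

lemma val_eq_iff (w : Prm L) {x y : K} :
    w.val (algebraMap K L x) = w.val (algebraMap K L y) ↔
      (below K w).val x = (below K w).val y :=
  (below_isEquiv (K := K) w).eq_iff (r := x) (s := y)

lemma val_le_iff (w : Prm L) {x y : K} :
    w.val (algebraMap K L x) ≤ w.val (algebraMap K L y) ↔
      (below K w).val x ≤ (below K w).val y :=
  below_isEquiv w x y

lemma val_eq_one_iff_below (w : Prm L) {x : K} :
    w.val (algebraMap K L x) = 1 ↔ (below K w).val x = 1 := by
  simpa using val_eq_iff w (x := x) (y := 1)

lemma finite_above (v : Prm K) : {w : Prm L | below K w = v}.Finite := by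
  obtain ⟨x, hx, hx0⟩ := Submodule.exists_mem_ne_zero_of_ne_bot v.ne_bot
  have hx1 : algebraMap K L (x : K) ≠ 0 := by
    rw [Ne, map_eq_zero]
    simpa using hx0
  refine (finite_val_ne_one hx1).subset fun w hw => ?_
  have hw' : below K w = v := hw
  change w.val (algebraMap K L (x : K)) ≠ 1
  rw [Ne, val_eq_one_iff_below, hw', v.val_eq_one_iff]
  exact fun h => h hx

variable (L) in
/-- The primes of `L` above a finite set of primes of `K`. -/
noncomputable def aboveSet (S : Finset (Prm K)) : Finset (Prm L) :=
  (S.finite_toSet.biUnion fun v _ => finite_above (L := L) v).toFinset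

lemma mem_aboveSet {S : Finset (Prm K)} {w : Prm L} : w ∈ aboveSet L S ↔ below K w ∈ S := by
  simp [aboveSet]

lemma map_mem_uS_aboveSet {S : Finset (Prm K)} {x : Kˣ} :
    Units.map (algebraMap K L : K →* L) x ∈ uS (aboveSet L S) ↔ x ∈ uS S := by
  constructor
  · intro h v hv
    obtain ⟨w, rfl⟩ := exists_above (L := L) v
    rw [← val_eq_one_iff_below]
    exact h w fun hw => hv (mem_aboveSet.1 hw)
  · intro h w hw
    change w.val (algebraMap K L (x : K)) = 1
    rw [val_eq_one_iff_below]
    exact h _ fun h' => hw (mem_aboveSet.2 h')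

variable {a : Kˣ} {r : L} {σ : L ≃ₐ[K] L}

lemma normHom_mem_uS (h : IsQuad K L (a : K) r σ) {S : Finset (Prm K)} {z : Lˣ}
    (hz : z ∈ uS (aboveSet L S)) : h.normHom z ∈ uS S := by
  intro v hv
  obtain ⟨w, rfl⟩ := exists_above (L := L) v
  have hw : w ∉ aboveSet L S := fun hw => hv (mem_aboveSet.1 hw)
  have hσw : conjPrm σ w ∉ aboveSet L S := fun hw => hv (by
    have := mem_aboveSet.1 hw
    rwa [below_conjPrm] at this)
  rw [← val_eq_one_iff_below, h.normHom_spec, map_mul, hz w hw, ← conjPrm_val, hz _ hσw, one_mul]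

/-- Units of norm one are products of units of the base and squares of units. -/
lemma exists_of_normHom_eq_one (h : IsQuad K L (a : K) r σ) {S : Finset (Prm K)} (hS : Good S)
    (hS2 : ∀ v : Prm K, v ∉ S → v.val 2 = 1) (ha : a ∈ uS S) {u : Lˣ}
    (hu : u ∈ uS (aboveSet L S)) (hN : h.normHom u = 1) :
    ∃ x ∈ uS S, ∃ z ∈ uS (aboveSet L S), u = Units.map (algebraMap K L : K →* L) x * z ^ 2 := by
  have hN' : (u : L) * σ u = 1 := by
    rw [← h.normHom_spec, hN]; simp
  obtain ⟨z0, hz0, hu0⟩ : ∃ z0 : L, z0 ≠ 0 ∧ (u : L) * z0 = σ z0 := by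
    by_cases hu1 : 1 + σ u = 0
    · refine ⟨r, h.ne, ?_⟩
      have : σ (u : L) = -1 := by linear_combination hu1
      rw [this] at hN'
      rw [h.conj]
      linear_combination -r * hN'
    · refine ⟨1 + σ u, hu1, ?_⟩
      rw [map_add, map_one, h.conj_conj]
      linear_combination hN'
  obtain ⟨p, q, hpq⟩ := h.span z0
  have hpq0 : p ≠ 0 ∨ q ≠ 0 := by
    by_contra hc
    push Not at hc
    apply hz0
    rw [hpq, hc.1, hc.2]; simp
  obtain ⟨k, hk⟩ := hS.exists_val hpq0
  have hk0 : algebraMap K L (k : K) ≠ 0 := by simp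
  have hval : ∀ w : Prm L, w ∉ aboveSet L S → w.val z0 = w.val (algebraMap K L (k : K)) := by
    intro w hw
    have hv : below K w ∉ S := fun h => hw (mem_aboveSet.2 h)
    have hσ : w.val (σ z0) = w.val z0 := by rw [← hu0, map_mul, hu w hw, one_mul]
    have hr : w.val r = 1 := by
      have : w.val (r ^ 2) = 1 := by rw [h.sq, val_eq_one_iff_below]; exact ha _ hv
      rw [map_pow] at this
      exact (pow_eq_one_iff_of_nonneg zero_le (by norm_num)).1 this
    have h2 : w.val 2 = 1 := by
      have := (val_eq_one_iff_below (K := K) w (x := 2)).2 (hS2 _ hv)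
      rwa [map_ofNat] at this
    have hσz : σ z0 = algebraMap K L p - algebraMap K L q * r := by
      rw [hpq, map_add, map_mul, h.conj, AlgEquiv.commutes, AlgEquiv.commutes]; ring
    have hp : w.val (algebraMap K L p) ≤ w.val z0 := by
      have : w.val (2 * algebraMap K L p) ≤ w.val z0 := by
        rw [show 2 * algebraMap K L p = z0 + σ z0 by rw [hσz, hpq]; ring]
        exact (w.val.map_add _ _).trans (by rw [hσ, max_self])
      rwa [map_mul, h2, one_mul] at this
    have hq : w.val (algebraMap K L q) ≤ w.val z0 := by
      have : w.val (2 * (algebraMap K L q * r)) ≤ w.val z0 := by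
        rw [show 2 * (algebraMap K L q * r) = z0 - σ z0 by rw [hσz, hpq]; ring]
        exact (w.val.map_sub _ _).trans (by rw [hσ, max_self])
      rwa [map_mul, h2, one_mul, map_mul, hr, mul_one] at this
    have hle : w.val z0 ≤ max (w.val (algebraMap K L p)) (w.val (algebraMap K L q)) := by
      conv_lhs => rw [hpq]
      refine (w.val.map_add _ _).trans ?_
      rw [map_mul, hr, mul_one]
    have hkv := hk _ hv
    rcases le_total ((below K w).val p) ((below K w).val q) with hl | hl
    · rw [max_eq_right hl, ← val_eq_iff] at hkv
      rw [max_eq_right ((val_le_iff w).2 hl)] at hle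
      rw [hkv]
      exact le_antisymm hle hq
    · rw [max_eq_left hl, ← val_eq_iff] at hkv
      rw [max_eq_left ((val_le_iff w).2 hl)] at hle
      rw [hkv]
      exact le_antisymm hle hp
  let z : Lˣ := Units.mk0 (z0 / algebraMap K L (k : K)) (div_ne_zero hz0 hk0)
  have hz : z ∈ uS (aboveSet L S) := by
    intro w hw
    change w.val (z0 / algebraMap K L (k : K)) = 1
    rw [map_div₀, hval w hw, div_self]
    exact w.val.ne_zero_iff.2 hk0
  refine ⟨h.normHom z, normHom_mem_uS h hz, z⁻¹, inv_mem hz, ?_⟩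
  ext
  change (u : L) = algebraMap K L (h.normHom z : Kˣ) * ((z⁻¹ ^ 2 : Lˣ) : L)
  rw [h.normHom_spec]
  have hz' : (u : L) * z = σ z := by
    change (u : L) * (z0 / algebraMap K L (k : K)) = σ (z0 / algebraMap K L (k : K))
    rw [map_div₀, AlgEquiv.commutes, ← hu0, mul_div_assoc]
  rw [← hz']
  push_cast
  field_simp [z.ne_zero]

open Classical in
/-- Number of places of a quadratic extension: finite places. -/
lemma card_aboveSet (h : IsQuad K L (a : K) r σ) (S : Finset (Prm K)) :
    2 * S.card ≤ (aboveSet L S).card + (S.filter fun v => a ∉ loc (.inl v)).card := by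
  classical
  rw [Finset.card_eq_sum_card_fiberwise (f := below K) (t := S)
    (fun w hw => mem_aboveSet.1 hw), Finset.card_filter, ← Finset.sum_add_distrib, mul_comm,
    ← smul_eq_mul, ← Finset.sum_const]
  refine Finset.sum_le_sum fun v hv => ?_
  obtain ⟨w, rfl⟩ := exists_above (L := L) v
  have hw : w ∈ (aboveSet L S).filter fun w' => below K w' = below K w := by
    simp [mem_aboveSet, hv]
  by_cases hs : a ∈ loc (.inl (below K w))
  · simp only [hs, not_true_eq_false, if_false, add_zero]
    refine Finset.one_lt_card.2 ⟨conjPrm σ w, ?_, w, hw, (conj_ne_iff h).2 hs⟩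
    simp [mem_aboveSet, below_conjPrm, hv]
  · simp only [hs, not_false_eq_true, if_true]
    have := Finset.card_pos.2 ⟨w, hw⟩
    omega

open NumberField Classical in
/-- Number of places of a quadratic extension: infinite places. -/
lemma card_infinitePlace_above (h : IsQuad K L (a : K) r σ) :
    2 * Fintype.card (InfinitePlace K) ≤ Fintype.card (InfinitePlace L) +
      ((Finset.univ : Finset (InfinitePlace K)).filter fun v => a ∉ loc (.inr v)).card := by
  classical
  rw [← Finset.card_univ (α := InfinitePlace L),
    Finset.card_eq_sum_card_fiberwise (s := (Finset.univ : Finset (InfinitePlace L)))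
    (f := fun w => w.comap (algebraMap K L)) (t := (Finset.univ : Finset (InfinitePlace K)))
    (fun w _ => Finset.mem_coe.2 (Finset.mem_univ _)), Finset.card_filter, ← Finset.sum_add_distrib,
    ← Finset.card_univ, mul_comm, ← smul_eq_mul, ← Finset.sum_const]
  refine Finset.sum_le_sum fun v _ => ?_
  obtain ⟨w, hw⟩ := InfinitePlace.comap_surjective (k := K) (K := L) v
  have hw' : w ∈ (Finset.univ : Finset (InfinitePlace L)).filter
      fun w' => w'.comap (algebraMap K L) = v := by simp [hw]
  by_cases hs : a ∈ loc (.inr v)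
  · simp only [hs, not_true_eq_false, if_false, add_zero]
    let ψ := w.embedding
    refine Finset.one_lt_card.2 ⟨InfinitePlace.mk (ψ.comp (σ : L →+* L)), ?_, w, hw', fun heq => ?_⟩
    · simp only [Finset.mem_filter, Finset.mem_univ, true_and]
      rw [← InfinitePlace.mk_embedding w] at hw
      rw [← hw]
      change _ = (InfinitePlace.mk w.embedding).comap _
      rw [InfinitePlace.comap_mk, InfinitePlace.comap_mk, RingHom.comp_assoc]
      congr 2
      ext x
      simp
    · rw [← InfinitePlace.mk_embedding w, InfinitePlace.mk_eq_iff] at heq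
      have hψr : ψ r ≠ 0 := by simpa using h.ne
      rcases heq with heq | heq
      · have h1 := RingHom.congr_fun heq r
        change ψ (σ r) = ψ r at h1
        rw [h.conj, map_neg] at h1
        exact hψr (by linear_combination (-1 / 2 : ℂ) * h1)
      · have h1 := RingHom.congr_fun heq r
        have h2 : ∀ x : K, star (ψ (algebraMap K L x)) = ψ (algebraMap K L x) := by
          intro x
          have h1 := RingHom.congr_fun heq (algebraMap K L x)
          change star (ψ (σ (algebraMap K L x))) = ψ (algebraMap K L x) at h1
          rwa [AlgEquiv.commutes] at h1
        change star (ψ (σ r)) = ψ r at h1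
        rw [h.conj, map_neg, star_neg] at h1
        have h3 : ComplexEmbedding.IsReal (ψ.comp (algebraMap K L)) := RingHom.ext h2
        have hv : v = InfinitePlace.mk (ψ.comp (algebraMap K L)) := by
          rw [← hw, ← InfinitePlace.comap_mk, InfinitePlace.mk_embedding]
        have hvr : v.IsReal := ⟨_, h3, hv.symm⟩
        have hve : v.embedding = ψ.comp (algebraMap K L) := by
          rw [hv]; exact InfinitePlace.embedding_mk_eq_of_isReal h3
        have hpos := hs hvr
        rw [hve] at hpos
        change 0 < (ψ (algebraMap K L (a : K))).re at hpos
        rw [← h.sq, map_pow, sq, Complex.mul_re] at hpos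
        have h4 : (ψ r).re = 0 := by
          have := congrArg Complex.re h1
          simp at this
          linarith
        rw [h4] at hpos
        nlinarith [sq_nonneg (ψ r).im]
  · simp only [hs, not_false_eq_true, if_true]
    have := Finset.card_pos.2 ⟨w, hw'⟩
    omega

lemma card_plc_filter (S : Finset (Prm K)) (P : Plc K → Prop) [DecidablePred P] :
    ((plc S).filter P).card = (S.filter fun v => P (.inl v)).card +
      ((Finset.univ : Finset (NumberField.InfinitePlace K)).filter fun v => P (.inr v)).card := by
  rw [plc, Finset.card_filter, Finset.sum_disjSum, ← Finset.card_filter, ← Finset.card_filter]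

end Above

section NormIndex

variable {K : Type*} [Field K] [NumberField K]

open Classical in
/-- The first inequality for the norm index of `S`-units. -/
theorem relIndex_normSol_le {S : Finset (Prm K)} (hS : Good S)
    (hS2 : ∀ v : Prm K, v ∉ S → v.val 2 = 1) {a : Kˣ} (ha : a ∈ uS S) (hsq : ¬ IsSquare (a : K)) :
    (normSol K (a : K)).relIndex (uS S) ≠ 0 ∧
    2 * (normSol K (a : K)).relIndex (uS S) ≤ 2 ^ ((plc S).filter fun v => a ∉ loc v).card := by
  obtain ⟨L, _, _, _, r, σ, h⟩ := exists_isQuad_numberField hsq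
  set U := uS S
  set M := uS (aboveSet L S)
  set N := h.normHom
  set ι : Kˣ →* Lˣ := Units.map (algebraMap K L : K →* L)
  set U2 := U.map (powMonoidHom 2)
  set M2 := M.map (powMonoidHom 2)
  set s := (plc S).card
  have hU2 : U2.relIndex U = 2 ^ s := by simp only [s, card_plc]; exact relIndex_sq_uS S
  have hM2 : M2.relIndex M = 2 ^ (plc (aboveSet L S)).card := by rw [relIndex_sq_uS, card_plc]
  have hNι : ∀ x : Kˣ, N (ι x) = x ^ 2 := by
    intro x
    ext
    apply (algebraMap K L).injective
    rw [h.normHom_spec]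
    change algebraMap K L (x : K) * σ (algebraMap K L (x : K)) = _
    rw [AlgEquiv.commutes]
    rw [Units.val_pow_eq_pow_val, map_pow, sq]
  have hNM : M.map N ≤ U := by
    rintro _ ⟨z, hz, rfl⟩
    exact normHom_mem_uS h hz
  have hNM' : M.map N ≤ normSol K (a : K) := by
    rw [← h.range_normHom]
    rintro _ ⟨z, hz, rfl⟩
    exact ⟨z, rfl⟩
  have hU2N : U2 ≤ M.map N := by
    rintro _ ⟨x, hx, rfl⟩
    exact ⟨ι x, map_mem_uS_aboveSet.2 hx, hNι x⟩
  have hιU : U.map ι ≤ M := by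
    rintro _ ⟨x, hx, rfl⟩
    exact map_mem_uS_aboveSet.2 hx
  have hM2M : M2 ≤ M := by
    rintro _ ⟨x, hx, rfl⟩
    exact pow_mem hx 2
  have hU2U : U2 ≤ U := hU2N.trans hNM
  have e1 : U2.relIndex (M.map N) * (M.map N).relIndex U = 2 ^ s := by
    rw [Subgroup.relIndex_mul_relIndex _ _ _ hU2N hNM, hU2]
  have e2 : M2.relIndex (U.map ι ⊔ M2) * (U.map ι ⊔ M2).relIndex M =
      2 ^ (plc (aboveSet L S)).card := by
    rw [Subgroup.relIndex_mul_relIndex _ _ _ le_sup_right (sup_le hιU hM2M), hM2]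
  have e3 : (U.map ι ⊔ M2).relIndex M ≤ U2.relIndex (M.map N) := by
    rw [← Subgroup.relIndex_comap, ← Subgroup.inf_relIndex_right (U2.comap N)]
    refine Subgroup.relIndex_le_of_le_left ?_ ?_
    · rintro z ⟨⟨x, hx, hxz⟩, hz⟩
      have h1 : N (z * (ι x)⁻¹) = 1 := by
        rw [map_mul, map_inv, hNι, ← hxz]
        exact mul_inv_cancel _
      obtain ⟨y, hy, z', hz', e⟩ := exists_of_normHom_eq_one h hS hS2 ha
        (mul_mem hz (inv_mem (map_mem_uS_aboveSet.2 hx))) h1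
      have : z = ι (x * y) * z' ^ 2 := by
        rw [map_mul, mul_assoc, ← e, mul_comm z, mul_inv_cancel_left]
      rw [this]
      exact Subgroup.mul_mem_sup ⟨_, mul_mem hx hy, rfl⟩ ⟨z', hz', rfl⟩
    · rw [Subgroup.inf_relIndex_right, Subgroup.relIndex_comap]
      intro h0
      rw [h0, zero_mul] at e1
      exact (pow_pos (by norm_num : 0 < 2) s).ne e1
  set C := M2.comap ι ⊓ U
  have hU2C : U2 ≤ C := by
    rintro _ ⟨x, hx, rfl⟩
    exact ⟨⟨ι x, map_mem_uS_aboveSet.2 hx, (map_pow ι x 2).symm⟩, hU2U ⟨x, hx, rfl⟩⟩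
  have e4 : M2.relIndex (U.map ι ⊔ M2) = C.relIndex U := by
    rw [Subgroup.relIndex_sup_right, ← Subgroup.relIndex_comap, Subgroup.inf_relIndex_right]
  have e5 : U2.relIndex C * C.relIndex U = 2 ^ s := by
    rw [Subgroup.relIndex_mul_relIndex _ _ _ hU2C inf_le_right, hU2]
  have haC : a ∈ C := by
    refine ⟨?_, ha⟩
    have hra : (Units.mk0 r h.ne) ^ 2 = ι a := by
      ext
      push_cast
      exact h.sq
    have hrM : Units.mk0 r h.ne ∈ M := mem_uS_of_sq (by rw [hra]; exact map_mem_uS_aboveSet.2 ha)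
    exact ⟨_, hrM, hra⟩
  have haU2 : a ∉ U2 := by
    rintro ⟨x, -, hx⟩
    exact hsq ⟨x, by rw [← hx]; simp [sq]⟩
  have e6 : 2 ≤ U2.relIndex C := by
    have h0 : U2.relIndex C ≠ 0 := by
      intro h0
      rw [h0, zero_mul] at e5
      exact (pow_pos (by norm_num : 0 < 2) s).ne e5
    have h1 : U2.relIndex C ≠ 1 := fun h1 => haU2 (Subgroup.relIndex_eq_one.1 h1 haC)
    omega
  have e7 : 2 * s ≤ (plc (aboveSet L S)).card + ((plc S).filter fun v => a ∉ loc v).card := by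
    have h1 := card_aboveSet h S
    have h2 := card_infinitePlace_above h
    rw [card_plc_filter, card_plc]
    simp only [s, card_plc]
    linarith
  have hne : (M.map N).relIndex U ≠ 0 := by
    intro h0
    rw [h0, mul_zero] at e1
    exact (pow_pos (by norm_num : 0 < 2) s).ne e1
  refine ⟨fun h0 => hne ?_, (Nat.mul_le_mul_left 2
    (Subgroup.relIndex_le_of_le_left hNM' hne)).trans ?_⟩
  · have := Subgroup.relIndex_dvd_of_le_left U hNM'
    rw [h0] at this
    exact Nat.eq_zero_of_zero_dvd this
  · set n := (M.map N).relIndex U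
    set e := U2.relIndex (M.map N)
    set c := C.relIndex U
    set d := (U.map ι ⊔ M2).relIndex M
    set sL := (plc (aboveSet L S)).card
    set t := ((plc S).filter fun v => a ∉ loc v).card
    rw [e4] at e2
    have h1 : 2 * n * 2 ^ sL ≤ 2 ^ t * 2 ^ sL :=
      calc 2 * n * 2 ^ sL = (2 * c) * (d * n) := by rw [← e2]; ring
        _ ≤ (U2.relIndex C * c) * (e * n) :=
          Nat.mul_le_mul (Nat.mul_le_mul_right _ e6) (Nat.mul_le_mul_right _ e3)
        _ = 2 ^ (2 * s) := by rw [e5, e1]; ring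
        _ ≤ 2 ^ (sL + t) := Nat.pow_le_pow_right (by norm_num) e7
        _ = 2 ^ t * 2 ^ sL := by ring
    exact Nat.le_of_mul_le_mul_right h1 (by positivity)

end NormIndex

section Density

variable {K : Type*} [Field K] [NumberField K]

lemma exists_good_set (T : Finset (Prm K)) (xs : Finset Kˣ) : ∃ S : Finset (Prm K), T ⊆ S ∧
    Good S ∧ (∀ v : Prm K, v ∉ S → v.val 2 = 1) ∧ ∀ x ∈ xs, x ∈ uS S := by
  classical
  obtain ⟨S1, h1⟩ := exists_good K
  obtain ⟨S2, h2⟩ := exists_mem_uS (Units.mk0 (2 : K) two_ne_zero)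
  choose f hf using fun x : Kˣ => exists_mem_uS x
  refine ⟨T ∪ (S1 ∪ (S2 ∪ xs.biUnion f)), Finset.subset_union_left, h1.mono ?_, ?_, ?_⟩
  · exact Finset.subset_union_left.trans Finset.subset_union_right
  · intro v hv
    simp only [Finset.mem_union, not_or] at hv
    exact h2 v hv.2.2.1
  · intro x hx v hv
    simp only [Finset.mem_union, not_or, Finset.mem_biUnion, not_exists, not_and] at hv
    exact hf x v (hv.2.2.2 x hx)

lemma mem_iInf_finset {G ι : Type*} [Group G] {T : Finset ι} {M : ι → Subgroup G} {x : G} :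
    x ∈ ⨅ v ∈ T, M v ↔ ∀ v ∈ T, x ∈ M v := by
  simp only [Subgroup.mem_iInf]

lemma normSol_le_iInf (R : Finset (Plc K)) (a : K) : normSol K a ≤ ⨅ v ∈ R, nrm v a :=
  le_iInf₂ fun _ _ => le_sup_left

lemma index_iInf_nrm {S : Finset (Prm K)} {R : Finset (Plc K)} (hR : R ⊆ plc S) {a : Kˣ}
    (ha : ∀ v ∈ R, a ∉ loc v) : (⨅ v ∈ R, nrm v (a : K)).index = 2 ^ R.card := by
  rw [← Subgroup.relIndex_top_right, relIndex_iInf_of_surj, ← Finset.prod_const]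
  · exact Finset.prod_congr rfl fun v hv => index_nrm (ha v hv)
  · intro x
    obtain ⟨k, hk⟩ := approx S x
    exact ⟨k, trivial, fun v hv => loc_le_nrm v _ (hk v (hR hv))⟩

/-- A non-square is a local non-square at a prime outside any given finite set. -/
lemma exists_not_mem_loc {a : Kˣ} (ha : ¬ IsSquare (a : K)) (S0 : Finset (Prm K)) :
    ∃ v : Prm K, v ∉ S0 ∧ a ∉ loc (.inl v) := by
  classical
  by_contra! hc
  obtain ⟨S1, h01, -, -, -⟩ := exists_good_set S0 ∅
  set R := (plc S1).filter fun v => a ∉ loc v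
  set N := ⨅ v ∈ R, nrm v (a : K)
  have hN : N.index = 2 ^ R.card :=
    index_iInf_nrm (Finset.filter_subset _ _) fun v hv => (Finset.mem_filter.1 hv).2
  have : N.FiniteIndex := ⟨by rw [hN]; positivity⟩
  have hfin : Finite (Kˣ ⧸ N) :=
    Subgroup.finite_quotient_of_finiteIndex 
  have := Fintype.ofFinite (Kˣ ⧸ N)
  obtain ⟨S, h1S, hg, h2, hx⟩ := exists_good_set S1
    (insert a (Finset.univ.image fun q : Kˣ ⧸ N => q.out))
  have hsup : uS S ⊔ N = ⊤ := by
    rw [eq_top_iff]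
    intro x _
    have h1 : (QuotientGroup.mk x : Kˣ ⧸ N).out ∈ uS S :=
      hx _ (Finset.mem_insert_of_mem (Finset.mem_image_of_mem _ (Finset.mem_univ _)))
    have h3 : ((QuotientGroup.mk x : Kˣ ⧸ N).out)⁻¹ * x ∈ N :=
      QuotientGroup.eq.1 (QuotientGroup.out_eq' _)
    rw [← mul_inv_cancel_left (QuotientGroup.mk x : Kˣ ⧸ N).out x]
    exact Subgroup.mul_mem_sup h1 h3
  have e1 : N.relIndex (uS S) = 2 ^ R.card := by
    rw [← Subgroup.relIndex_sup_right, hsup, Subgroup.relIndex_top_right, hN]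
  obtain ⟨h0, hA⟩ := relIndex_normSol_le hg h2 (hx a (Finset.mem_insert_self _ _)) ha
  have hR : ((plc S).filter fun v => a ∉ loc v) ⊆ R := by
    intro v hv
    rw [Finset.mem_filter] at hv ⊢
    refine ⟨?_, hv.2⟩
    rcases v with v | v
    · by_contra hv1
      exact hv.2 (hc v fun h => hv1 (inl_mem_plc.2 (h01 h)))
    · exact inr_mem_plc
  have h4 := Subgroup.relIndex_le_of_le_left (normSol_le_iInf R (a : K)) h0
  have h5 : 2 ^ ((plc S).filter fun v => a ∉ loc v).card ≤ 2 ^ R.card :=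
    Nat.pow_le_pow_right (by norm_num) (Finset.card_le_card hR)
  have h6 : N.relIndex (uS S) ≤ (normSol K (a : K)).relIndex (uS S) := h4
  have h7 : 0 < 2 ^ R.card := by positivity
  rw [e1] at h6
  omega

lemma mul_mem_loc_of_units {v : Prm K} (h2 : v.val 2 = 1) {x y : Kˣ} (hx : v.val (x : K) = 1)
    (hy : v.val (y : K) = 1) (hx' : x ∉ loc (.inl v)) (hy' : y ∉ loc (.inl v)) :
    x * y ∈ loc (.inl v) := by
  have h : ((nsq v.val).subgroupOf (unitsAt v)).index = 2 := by
    have := relIndex_nsq_unitsAt v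
    rwa [cNum_eq_one h2, mul_one] at this
  have := Subgroup.mul_mem_iff_of_index_two h (a := ⟨x, hx⟩) (b := ⟨y, hy⟩)
  exact this.2 ⟨fun h => absurd h hx', fun h => absurd h hy'⟩

lemma not_isSquare_map {L : Type*} [Field L] [Algebra K L] {a : K} {r : L} {σ : L ≃ₐ[K] L}
    (h : IsQuad K L a r σ) {x : K} (hx : ¬ IsSquare x) (hxa : ¬ IsSquare (x * a)) :
    ¬ IsSquare (algebraMap K L x) := by
  rintro ⟨z, hz⟩
  obtain ⟨p, q, rfl⟩ := h.span z
  have hc : algebraMap K L x = (algebraMap K L p - algebraMap K L q * r) *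
      (algebraMap K L p - algebraMap K L q * r) := by
    have := congrArg σ hz
    rw [AlgEquiv.commutes, map_mul, map_add, map_mul, h.conj, AlgEquiv.commutes,
      AlgEquiv.commutes] at this
    rw [this]; ring
  have : algebraMap K L (2 * (p * q)) * r = 0 := by
    have := h.charZeroL
    push_cast [map_mul, map_ofNat]
    linear_combination (1 / 2 : L) * (hc - hz)
  rw [mul_eq_zero, or_iff_left h.ne, map_eq_zero, mul_eq_zero, or_iff_right two_ne_zero,
    mul_eq_zero] at this
  rcases this with rfl | rfl
  · apply hxa
    refine ⟨q * a, (algebraMap K L).injective ?_⟩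
    rw [map_mul, hz, map_mul, map_mul, map_zero, ← h.sq]
    ring
  · apply hx
    refine ⟨p, (algebraMap K L).injective ?_⟩
    rw [hz, map_mul, map_zero]
    ring

lemma exists_mem_loc_not_mem_loc {S : Finset (Prm K)} (hS2 : ∀ v : Prm K, v ∉ S → v.val 2 = 1)
    {a x : Kˣ} (ha : a ∈ uS S) (hx : x ∈ uS S) (ha' : ¬ IsSquare (a : K))
    (hx' : ¬ IsSquare (x : K)) (hxa : ¬ IsSquare (x * a : K)) :
    ∃ v : Prm K, v ∉ S ∧ a ∈ loc (.inl v) ∧ x ∉ loc (.inl v) := by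
  obtain ⟨L, _, _, _, r, σ, h⟩ := exists_isQuad_numberField ha'
  let ι : Kˣ →* Lˣ := Units.map (algebraMap K L : K →* L)
  obtain ⟨w, hw, hxw⟩ := exists_not_mem_loc (a := ι x) (not_isSquare_map h hx' hxa) (aboveSet L S)
  have hv : below K w ∉ S := fun h => hw (mem_aboveSet.2 h)
  have hxv : x ∉ loc (.inl (below K w)) := fun h => hxw (map_mem_loc w h)
  refine ⟨below K w, hv, ?_, hxv⟩
  by_contra hav
  have h1 := map_mem_loc w (mul_mem_loc_of_units (hS2 _ hv) (hx _ hv) (ha _ hv) hxv hav)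
  have hra : (Units.mk0 r h.ne) ^ 2 = ι a := by
    ext
    push_cast
    exact h.sq
  rw [map_mul] at h1
  change ι x * ι a ∈ _ at h1
  rw [← hra, mul_sq_mem_loc] at h1
  exact hxw h1

lemma relIndex_iInf_loc_le {S T : Finset (Prm K)} (hS2 : ∀ v : Prm K, v ∉ S → v.val 2 = 1)
    (hT : Disjoint S T) : (⨅ v ∈ T, loc (.inl v : Plc K)).relIndex (uS S) ≤ 2 ^ T.card := by
  classical
  induction T using Finset.induction_on with
  | empty => simp
  | insert v T hv ih =>
    rw [Finset.iInf_insert, Finset.card_insert_of_notMem hv, pow_succ']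
    refine Subgroup.relIndex_inf_le.trans (Nat.mul_le_mul ?_ (ih ?_))
    · have hvS : v ∉ S := fun h => Finset.disjoint_left.1 hT h (Finset.mem_insert_self _ _)
      have h1 : (loc (.inl v : Plc K)).relIndex (unitsAt v) = 2 := by
        have := relIndex_nsq_unitsAt v
        rwa [cNum_eq_one (hS2 v hvS), mul_one] at this
      rw [← h1]
      exact Subgroup.relIndex_le_of_le_right (fun x hx => hx v hvS) (by rw [h1]; norm_num)
    · exact hT.mono_right (Finset.subset_insert _ _)

/-- Auxiliary primes at which `a` is a local square, and at which `S`-units approximate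
local units independently. -/
lemma exists_auxiliary {S : Finset (Prm K)} (hS2 : ∀ v : Prm K, v ∉ S → v.val 2 = 1)
    {a : Kˣ} (ha : a ∈ uS S) (ha' : ¬ IsSquare (a : K)) (j : ℕ) (hj : j + 1 ≤ (plc S).card) :
    ∃ T : Finset (Prm K), T.card = j ∧ Disjoint S T ∧ (∀ v ∈ T, a ∈ loc (.inl v)) ∧
      ∀ o : Prm K → Kˣ, (∀ v ∈ T, o v ∈ unitsAt v) →
        ∃ u ∈ uS S, ∀ v ∈ T, u * (o v)⁻¹ ∈ loc (.inl v) := by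
  classical
  induction j with
  | zero => exact ⟨∅, rfl, Finset.disjoint_empty_right _, by simp, fun o _ => ⟨1, one_mem _, by simp⟩⟩
  | succ j ih =>
    obtain ⟨T, hTc, hTd, hTa, hTs⟩ := ih (by omega)
    set U := uS S
    set U2 := U.map (powMonoidHom 2)
    set C := (⨅ v ∈ T, loc (.inl v : Plc K)) ⊓ U
    have hU2C : U2 ≤ C := by
      rintro _ ⟨x, hx, rfl⟩
      exact ⟨mem_iInf_finset.2 fun v _ => sq_mem_loc _ x, pow_mem hx 2⟩
    have hU2 : U2.relIndex C * C.relIndex U = 2 ^ (plc S).card := by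
      rw [Subgroup.relIndex_mul_relIndex _ _ _ hU2C inf_le_right, card_plc]
      exact relIndex_sq_uS S
    have hCU : C.relIndex U ≤ 2 ^ j := by
      rw [Subgroup.inf_relIndex_right, ← hTc]
      exact relIndex_iInf_loc_le hS2 hTd
    have hsq : ∀ x ∈ U, IsSquare (x : K) → x ∈ U2 := by
      rintro x hx ⟨y, hy⟩
      have hy0 : y ≠ 0 := by
        rintro rfl
        simp at hy
      have : (Units.mk0 y hy0) ^ 2 = x := by ext; simp [hy, sq]
      exact ⟨_, mem_uS_of_sq (by rw [this]; exact hx), this⟩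
    have haU2 : a ∉ U2 := by
      rintro ⟨x, -, hx⟩
      exact ha' ⟨x, by rw [← hx]; simp [sq]⟩
    have haC : a ∈ C := ⟨mem_iInf_finset.2 hTa, ha⟩
    obtain ⟨x, hxC, hx1, hx2⟩ : ∃ x ∈ C, x ∉ U2 ∧ x * a ∉ U2 := by
      by_contra! hc
      have h1 : (U2.subgroupOf C).index = 2 := by
        rw [Subgroup.index_eq_two_iff]
        refine ⟨⟨a, haC⟩, fun b => ?_⟩
        by_cases hb : (b : Kˣ) ∈ U2
        · exact .inr ⟨hb, fun h => haU2 ((Subgroup.mul_mem_cancel_left _ hb).1 h)⟩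
        · exact .inl ⟨hc b b.2 hb, hb⟩
      change U2.relIndex C = 2 at h1
      rw [h1] at hU2
      have h3 : 2 ^ (j + 2) ≤ 2 ^ (plc S).card := Nat.pow_le_pow_right (by norm_num) (by omega)
      have : 2 ^ (j + 2) = 4 * 2 ^ j := by ring
      have : 0 < 2 ^ j := by positivity
      omega
    have hxU : x ∈ U := hxC.2
    obtain ⟨v, hvS, hav, hxv⟩ := exists_mem_loc_not_mem_loc hS2 ha hxU ha'
      (fun h => hx1 (hsq x hxU h))
      (fun h => hx2 (hsq _ (mul_mem hxU ha) (by simpa using h)))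
    have hxT : ∀ v ∈ T, x ∈ loc (.inl v) := mem_iInf_finset.1 hxC.1
    have hvT : v ∉ T := fun h => hxv (hxT v h)
    refine ⟨insert v T, by rw [Finset.card_insert_of_notMem hvT, hTc],
      Finset.disjoint_insert_right.2 ⟨hvS, hTd⟩, ?_, ?_⟩
    · intro w hw
      rcases Finset.mem_insert.1 hw with rfl | hw
      · exact hav
      · exact hTa w hw
    · intro o ho
      obtain ⟨u, hu, hu'⟩ := hTs o fun w hw => ho w (Finset.mem_insert_of_mem hw)
      by_cases hc : u * (o v)⁻¹ ∈ loc (.inl v)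
      · refine ⟨u, hu, fun w hw => ?_⟩
        rcases Finset.mem_insert.1 hw with rfl | hw
        · exact hc
        · exact hu' w hw
      · refine ⟨u * x, mul_mem hu hxU, fun w hw => ?_⟩
        rcases Finset.mem_insert.1 hw with rfl | hw
        · rw [mul_right_comm]
          exact mul_mem_loc_of_units (hS2 _ hvS)
            (mul_mem (show u ∈ unitsAt w from hu w hvS)
              (inv_mem (ho w (Finset.mem_insert_self _ _))) : _ ∈ unitsAt w)
            (hxU w hvS) hc hxv
        · rw [mul_right_comm]
          exact mul_mem (hu' w hw) (hxT w hw)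

end Density

section HasseMinkowski

variable {K : Type*} [Field K] [NumberField K]

lemma exists_uS_approx {S T : Finset (Prm K)} [DecidableEq (Prm K)] (hS : Good S)
    (hd : Disjoint S T)
    (hT : ∀ o : Prm K → Kˣ, (∀ v ∈ T, o v ∈ unitsAt v) →
        ∃ u ∈ uS S, ∀ v ∈ T, u * (o v)⁻¹ ∈ loc (.inl v)) (y : Prm K → Kˣ) :
    ∃ k ∈ uS (S ∪ T), ∀ v ∈ T, k * (y v)⁻¹ ∈ loc (.inl v) := by
  classical
  have h1 : ∀ v : Prm K, ∃ π : Kˣ, v ∉ S → v.val (π : K) = WithZero.exp (-1) ∧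
      ∀ w : Prm K, w ∉ S → w ≠ v → w.val (π : K) = 1 := by
    intro v
    by_cases hv : v ∈ S
    · exact ⟨1, fun h => absurd hv h⟩
    · obtain ⟨π, hπ⟩ := hS.exists_uniformizer hv
      exact ⟨π, fun _ => hπ⟩
  choose π hπ using h1
  have hTS : ∀ v ∈ T, v ∉ S := fun v hv h => Finset.disjoint_left.1 hd h hv
  let n : Prm K → ℤ := fun v => -WithZero.log (v.val (y v : K))
  let m : Kˣ := ∏ v ∈ T, π v ^ n v
  have hm : m ∈ uS (S ∪ T) := by
    refine prod_mem fun v hv => zpow_mem ?_ _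
    intro w hw
    rw [Finset.mem_union, not_or] at hw
    exact (hπ v (hTS v hv)).2 w hw.1 fun h => hw.2 (h ▸ hv)
  have hmv : ∀ v ∈ T, v.val (m : K) = v.val (y v : K) := by
    intro v hv
    have h2 : (m : K) = ∏ w ∈ T, (π w : K) ^ n w := by
      simp [m]
    rw [h2, map_prod, Finset.prod_eq_single_of_mem v hv]
    · rw [map_zpow₀, (hπ v (hTS v hv)).1, ← WithZero.exp_zsmul]
      simp only [n, smul_eq_mul, mul_neg, mul_one, neg_neg]
      exact WithZero.exp_log (v.val.ne_zero_iff.2 (y v).ne_zero)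
    · intro w hw hwv
      rw [map_zpow₀, (hπ w (hTS w hw)).2 v (hTS v hv) hwv.symm, one_zpow]
  obtain ⟨u, hu, hu'⟩ := hT (fun v => y v * m⁻¹) fun v hv => by
    change v.val ((y v * m⁻¹ : Kˣ) : K) = 1
    rw [Units.val_mul, Units.val_inv_eq_inv_val, map_mul, map_inv₀, hmv v hv, mul_inv_cancel₀]
    exact v.val.ne_zero_iff.2 (y v).ne_zero
  refine ⟨u * m, mul_mem (uS_mono Finset.subset_union_left hu) hm, fun v hv => ?_⟩
  have := hu' v hv
  rwa [mul_inv, inv_inv, mul_comm (y v)⁻¹, ← mul_assoc] at this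

lemma isSquare_of_mem_loc {S T : Finset (Prm K)} [DecidableEq (Prm K)] (hS : Good S)
    (hS2 : ∀ v : Prm K, v ∉ S → v.val 2 = 1) (hd : Disjoint S T)
    (hT : ∀ o : Prm K → Kˣ, (∀ v ∈ T, o v ∈ unitsAt v) →
        ∃ u ∈ uS S, ∀ v ∈ T, u * (o v)⁻¹ ∈ loc (.inl v)) {x : Kˣ} (hx : x ∈ uS (S ∪ T))
    (hxS : ∀ v ∈ plc S, x ∈ loc v) : IsSquare (x : K) := by
  classical
  by_contra hsq
  obtain ⟨h0, hA⟩ := relIndex_normSol_le (hS.mono Finset.subset_union_left)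
    (fun v hv => hS2 v fun h => hv (Finset.mem_union_left _ h)) hx hsq
  set R := (plc (S ∪ T)).filter fun v => x ∉ loc v
  have h1 : (⨅ v ∈ R, nrm v (x : K)).relIndex (uS (S ∪ T)) = 2 ^ R.card := by
    rw [relIndex_iInf_of_surj, ← Finset.prod_const]
    · exact Finset.prod_congr rfl fun v hv => index_nrm (Finset.mem_filter.1 hv).2
    · intro y
      obtain ⟨k, hk, hk'⟩ := exists_uS_approx hS hd hT fun v => y (.inl v)
      refine ⟨k, hk, fun v hv => loc_le_nrm _ _ ?_⟩
      obtain ⟨hv1, hv2⟩ := Finset.mem_filter.1 hv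
      rcases v with v | v
      · refine hk' v ?_
        rcases Finset.mem_union.1 (inl_mem_plc.1 hv1) with h | h
        · exact absurd (hxS _ (inl_mem_plc.2 h)) hv2
        · exact h
      · exact absurd (hxS _ inr_mem_plc) hv2
  have h2 := Subgroup.relIndex_le_of_le_left (normSol_le_iInf R (x : K)) h0
  have h3 : (⨅ v ∈ R, nrm v (x : K)).relIndex (uS (S ∪ T)) ≤
    (normSol K (x : K)).relIndex (uS (S ∪ T)) := h2
  have h4 : 0 < 2 ^ R.card := by positivity
  rw [h1] at h3
  omega

/-- The Hasse norm principle for quadratic extensions. -/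
theorem hasse_norm {a b : Kˣ} (hab : ∀ v : Plc K, b ∈ nrm v (a : K)) : Sol K (a : K) b := by
  classical
  by_cases hsq : IsSquare (a : K)
  · exact Sol.of_isSquare two_ne_zero hsq a.ne_zero
  obtain ⟨S, -, hS, hS2, hxs⟩ := exists_good_set (∅ : Finset (Prm K)) {a, b}
  have ha : a ∈ uS S := hxs a (by simp)
  have hb : b ∈ uS S := hxs b (by simp)
  set s := (plc S).card
  have hs : 1 ≤ s := by
    obtain ⟨v⟩ := (inferInstance : Nonempty (NumberField.InfinitePlace K))
    exact Finset.card_pos.2 ⟨.inr v, inr_mem_plc⟩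
  obtain ⟨T, hTc, hd, hTa, hTs⟩ := exists_auxiliary hS2 ha hsq (s - 1) (by omega)
  set U := uS (S ∪ T)
  have hSU : uS S ≤ U := uS_mono Finset.subset_union_left
  obtain ⟨h0, hA⟩ := relIndex_normSol_le (hS.mono Finset.subset_union_left)
    (fun v hv => hS2 v fun h => hv (Finset.mem_union_left _ h)) (hSU ha) hsq
  change 2 * (normSol K (a : K)).relIndex U ≤ _ at hA
  set R := (plc S).filter fun v => a ∉ loc v
  have hR : ((plc (S ∪ T)).filter fun v => a ∉ loc v) ⊆ R := by
    intro v hv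
    rw [Finset.mem_filter] at hv ⊢
    refine ⟨?_, hv.2⟩
    rcases v with v | v
    · rcases Finset.mem_union.1 (inl_mem_plc.1 hv.1) with h | h
      · exact inl_mem_plc.2 h
      · exact absurd (hTa v h) hv.2
    · exact inr_mem_plc
  set P := ⨅ v ∈ plc S, loc v
  set N := ⨅ v ∈ R, nrm v (a : K)
  have hPN : P ≤ N := le_iInf₂ fun v hv =>
    (iInf₂_le v (Finset.mem_filter.1 hv).1).trans (loc_le_nrm v _)
  have hP : P.index = 4 ^ s := by
    rw [← Subgroup.relIndex_top_right, relIndex_iInf_of_surj, prod_index_loc hS2]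
    intro x
    obtain ⟨k, hk⟩ := approx S x
    exact ⟨k, trivial, hk⟩
  have hN : N.index = 2 ^ R.card :=
    index_iInf_nrm (Finset.filter_subset _ _) fun v hv => (Finset.mem_filter.1 hv).2
  have hPU : P.relIndex U = 2 ^ (2 * s - 1) := by
    have h1 : P ⊓ U = U.map (powMonoidHom 2) := by
      apply le_antisymm
      · rintro x ⟨hxP, hxU⟩
        obtain ⟨y, hy⟩ := isSquare_of_mem_loc hS hS2 hd hTs hxU (mem_iInf_finset.1 hxP)
        have hy0 : y ≠ 0 := by
          rintro rfl
          simp at hy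
        have : (Units.mk0 y hy0) ^ 2 = x := by ext; simp [hy, sq]
        exact ⟨_, mem_uS_of_sq (by rw [this]; exact hxU), this⟩
      · rintro _ ⟨x, hx, rfl⟩
        exact ⟨mem_iInf_finset.2 fun v _ => sq_mem_loc _ x, pow_mem hx 2⟩
    rw [← Subgroup.inf_relIndex_right, h1, relIndex_sq_uS, Finset.card_union_of_disjoint hd, hTc]
    congr 1
    have := card_plc S
    omega
  have hidx : (U ⊔ P).index = 2 := by
    have h1 : P.relIndex (U ⊔ P) * (U ⊔ P).index = P.index :=
      Subgroup.relIndex_mul_index le_sup_right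
    rw [Subgroup.relIndex_sup_right, hPU, hP, show (4 : ℕ) ^ s = 2 ^ (2 * s - 1) * 2 by
      rw [← pow_succ, show 2 * s - 1 + 1 = 2 * s by omega, pow_mul]; norm_num] at h1
    exact Nat.eq_of_mul_eq_mul_left (by positivity) h1
  have hNU : 2 ^ R.card ≤ N.relIndex U * 2 := by
    have h1 : N.relIndex (U ⊔ N) * (U ⊔ N).index = N.index :=
      Subgroup.relIndex_mul_index le_sup_right
    rw [Subgroup.relIndex_sup_right, hN] at h1
    rw [← h1]
    refine Nat.mul_le_mul_left _ (Nat.le_of_dvd two_pos ?_)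
    rw [← hidx]
    exact Subgroup.index_dvd_of_le (sup_le_sup_left hPN _)
  have h5 : 2 ^ ((plc (S ∪ T)).filter fun v => a ∉ loc v).card ≤ 2 ^ R.card :=
    Nat.pow_le_pow_right (by norm_num) (Finset.card_le_card hR)
  have h6 : (normSol K (a : K)).relIndex U ≤ N.relIndex U := by omega
  have h7 : normSol K (a : K) ⊓ U ≤ N ⊓ U :=
    inf_le_inf_right _ (normSol_le_iInf R (a : K))
  have h8 := Subgroup.relIndex_mul_relIndex _ _ _ h7 inf_le_right
  rw [Subgroup.inf_relIndex_right, Subgroup.inf_relIndex_right] at h8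
  have h9 : (normSol K (a : K) ⊓ U).relIndex (N ⊓ U) = 1 := by
    have h10 : (normSol K (a : K) ⊓ U).relIndex (N ⊓ U) * N.relIndex U ≤ 1 * N.relIndex U := by
      rw [h8, one_mul]; exact h6
    have h11 : N.relIndex U ≠ 0 := fun h => h0 (by rw [← h8, h, mul_zero])
    have h12 := Nat.le_of_mul_le_mul_right h10 (Nat.pos_of_ne_zero h11)
    have h13 : (normSol K (a : K) ⊓ U).relIndex (N ⊓ U) ≠ 0 := fun h => h0 (by
      rw [← h8, h, zero_mul])
    omega
  have hbN : b ∈ N := mem_iInf_finset.2 fun v _ => hab v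
  exact (Subgroup.relIndex_eq_one.1 h9 ⟨hbN, hSU hb⟩).1

end HasseMinkowski

section CentralSimple

open scoped TensorProduct

variable {F X : Type*} [Field F] [Ring X] [Algebra F X] [FiniteDimensional F X]
  [Algebra.IsCentral F X] [IsSimpleRing X]

theorem mulLeftRight_surjective : Function.Surjective (AlgHom.mulLeftRight F X) := by
  classical
  let inst : Module (X ⊗[F] Xᵐᵒᵖ) X :=
    Module.compHom X (AlgHom.mulLeftRight F X).toRingHom
  have hs : ∀ (r : X ⊗[F] Xᵐᵒᵖ) (x : X), r • x = AlgHom.mulLeftRight F X r x := fun r x => rfl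
  have hs' : ∀ a b x : X, ((a ⊗ₜ[F] MulOpposite.op b : X ⊗[F] Xᵐᵒᵖ)) • x = a * x * b := by
    intro a b x
    rw [hs, AlgHom.mulLeftRight_apply, MulOpposite.unop_op]
  have hsimple : IsSimpleModule (X ⊗[F] Xᵐᵒᵖ) X := by
    rw [isSimpleModule_iff, isSimpleOrder_iff]
    refine ⟨inferInstance, fun N => ?_⟩
    by_cases hN : N = ⊥
    · exact Or.inl hN
    right
    obtain ⟨y, hyN, hy⟩ := N.ne_bot_iff.1 hN
    have hl : ∀ a x : X, x ∈ N → a * x ∈ N := fun a x hx => by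
      have := N.smul_mem (a ⊗ₜ[F] MulOpposite.op 1) hx
      rwa [hs', mul_one] at this
    have hr : ∀ a x : X, x ∈ N → x * a ∈ N := fun a x hx => by
      have := N.smul_mem (1 ⊗ₜ[F] MulOpposite.op a) hx
      rwa [hs', one_mul] at this
    let I : TwoSidedIdeal X := .mk' (N : Set X) N.zero_mem (fun h h' => N.add_mem h h')
      (fun h => N.neg_mem h) (fun h => hl _ _ h) (fun h => hr _ _ h)
    have h1 : (1 : X) ∈ I := IsSimpleRing.one_mem_of_ne_zero_mem (x := y) I hy (by
      simpa [I, TwoSidedIdeal.mem_mk'] using hyN)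
    have h1' : (1 : X) ∈ N := by simpa [I, TwoSidedIdeal.mem_mk'] using h1
    rw [eq_top_iff]
    intro x _
    simpa using hl x 1 h1'
  intro f
  have hEnd : ∀ φ : Module.End (X ⊗[F] Xᵐᵒᵖ) X, ∃ c : F, ∀ x, φ x = c • x := by
    intro φ
    have hl : ∀ x, φ x = x * φ 1 := fun x => by
      have := φ.map_smul (x ⊗ₜ[F] MulOpposite.op 1) 1
      rw [hs', hs'] at this
      simpa using this
    have hr : ∀ x, φ x = φ 1 * x := fun x => by
      have := φ.map_smul (1 ⊗ₜ[F] MulOpposite.op x) 1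
      rw [hs', hs'] at this
      simpa using this
    have hc : φ 1 ∈ Subalgebra.center F X := by
      rw [Subalgebra.mem_center_iff]
      intro x
      rw [← hl, hr]
    rw [Algebra.IsCentral.center_eq_bot, Algebra.mem_bot] at hc
    obtain ⟨c, hc⟩ := hc
    refine ⟨c, fun x => ?_⟩
    rw [hr, ← hc, Algebra.smul_def]
  let g : Module.End (Module.End (X ⊗[F] Xᵐᵒᵖ) X) X :=
    { toFun := f
      map_add' := f.map_add
      map_smul' := by
        intro φ x
        obtain ⟨c, hc⟩ := hEnd φ
        simp only [Module.End.smul_def, RingHom.id_apply, hc, map_smul] }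
  let b := Module.finBasis F X
  obtain ⟨r, hr⟩ := jacobson_density g (Finset.univ.image b)
  refine ⟨r, b.ext fun i => ?_⟩
  exact (hr (b i) (by simp)).symm

variable {E S : Type*} [Field E] [Ring S] [Algebra E S] [Nontrivial S] [Algebra F E] [Algebra F S]
  [IsScalarTower F E S]

theorem linearIndependent_map (ρ : X →ₐ[F] S) {ι : Type*} [Fintype ι] (b : Module.Basis ι F X) :
    LinearIndependent E (fun i => ρ (b i)) := by
  classical
  have key : ∀ r : X ⊗[F] Xᵐᵒᵖ, ∃ T : S →ₗ[E] S, ∀ x, T (ρ x) =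
      ρ (AlgHom.mulLeftRight F X r x) := by
    intro r
    induction r with
    | zero => exact ⟨0, by simp⟩
    | tmul a c =>
      refine ⟨LinearMap.mulLeft E (ρ a) ∘ₗ LinearMap.mulRight E (ρ c.unop), fun x => ?_⟩
      simp [mul_assoc]
    | add r s hr hs =>
      obtain ⟨T, hT⟩ := hr
      obtain ⟨U, hU⟩ := hs
      exact ⟨T + U, fun x => by simp [hT, hU]⟩
  rw [Fintype.linearIndependent_iff]
  intro c hc i
  obtain ⟨r, hr⟩ := mulLeftRight_surjective (F := F) (X := X)
    (b.constr F fun j => if j = i then (1 : X) else 0)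
  obtain ⟨T, hT⟩ := key r
  have := congrArg T hc
  simp only [map_sum, map_smul, hT, hr, Module.Basis.constr_basis, map_zero] at this
  simp only [apply_ite ρ, map_one, map_zero, smul_ite, smul_zero, Finset.sum_ite_eq',
    Finset.mem_univ, if_true] at this
  rwa [← Algebra.algebraMap_eq_smul_one, map_eq_zero_iff _ (algebraMap E S).injective] at this

theorem span_range_eq_top [FiniteDimensional E S] (ρ : X →ₐ[F] S)
    (hd : Module.finrank E S = Module.finrank F X) :
    Submodule.span E (Set.range ρ) = ⊤ := by
  have h := linearIndependent_map (E := E) ρ (Module.finBasis F X)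
  have := h.span_eq_top_of_card_eq_finrank' (by simp [hd])
  rw [eq_top_iff, ← this]
  exact Submodule.span_mono (by rintro _ ⟨i, rfl⟩; exact ⟨_, rfl⟩)

end CentralSimple

section Representations

open scoped TensorProduct

variable {F X : Type*} [Field F] [Ring X] [Algebra F X]
variable {E : Type*} [Field E] {ι : Type*} [Fintype ι] [DecidableEq ι]

/-- `ρ` is a matrix representation of `X` that is linear along `i : F →+* E`. -/
def IsRep (i : F →+* E) (ρ : X →+* Matrix ι ι E) : Prop :=
  ∀ a, ρ (algebraMap F X a) = i a • 1

lemma exists_algHom {i : F →+* E} {ρ : X →+* Matrix ι ι E} (h : IsRep i ρ) :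
    letI := i.toAlgebra
    ∃ ρ' : X →ₐ[F] Matrix ι ι E, ∀ x, ρ' x = ρ x := by
  let := i.toAlgebra
  refine ⟨{ ρ with commutes' := fun a => ?_ }, fun x => rfl⟩
  change ρ (algebraMap F X a) = _
  rw [h a, Algebra.algebraMap_eq_smul_one]
  rfl

lemma IsRep.comp {E' : Type*} [Field E'] {i : F →+* E} {ρ : X →+* Matrix ι ι E} (h : IsRep i ρ)
    (φ : E →+* E') : IsRep (φ.comp i) (φ.mapMatrix.comp ρ) := by
  intro a
  simp only [RingHom.comp_apply, h a]
  ext j k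
  simp [Matrix.one_apply, apply_ite φ]

variable [FiniteDimensional F X] [Algebra.IsCentral F X] [IsSimpleRing X]

theorem IsRep.span_eq_top {i : F →+* E} {ρ : X →+* Matrix ι ι E} (h : IsRep i ρ)
    (hι : Fintype.card ι ^ 2 = Module.finrank F X) : Submodule.span E (Set.range ρ) = ⊤ := by
  let := i.toAlgebra
  have : Nonempty ι := by
    rw [← Fintype.card_pos_iff]
    have : 0 < Module.finrank F X := Module.finrank_pos
    rw [← hι] at this
    exact Nat.pos_of_ne_zero fun h => by simp [h] at this
  obtain ⟨ρ', hρ'⟩ := exists_algHom h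
  have := span_range_eq_top (E := E) ρ' (by rw [Module.finrank_matrix, ← hι]; simp [sq])
  rwa [show (ρ' : X → Matrix ι ι E) = ρ from funext hρ'] at this

theorem IsRep.exists_smul_one {i : F →+* E} {ρ : X →+* Matrix ι ι E} (h : IsRep i ρ)
    (hι : Fintype.card ι ^ 2 = Module.finrank F X) {z : Matrix ι ι E}
    (hz : ∀ x, ρ x * z = z * ρ x) : ∃ c : E, z = c • 1 := by
  have hz' : ∀ y : Matrix ι ι E, y * z = z * y := by
    intro y
    have hy : y ∈ Submodule.span E (Set.range ρ) := by rw [h.span_eq_top hι]; trivial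
    induction hy using Submodule.span_induction with
    | mem y hy => obtain ⟨x, rfl⟩ := hy; exact hz x
    | zero => simp
    | add a b _ _ ha hb => rw [add_mul, mul_add, ha, hb]
    | smul c a _ ha => rw [smul_mul_assoc, mul_smul_comm, ha]
  have : z ∈ Subalgebra.center E (Matrix ι ι E) := Subalgebra.mem_center_iff.2 hz'
  rw [Algebra.IsCentral.center_eq_bot, Algebra.mem_bot] at this
  obtain ⟨c, rfl⟩ := this
  exact ⟨c, Algebra.algebraMap_eq_smul_one c⟩

theorem IsRep.exists_conj {i : F →+* E} {ρ ρ' : X →+* Matrix ι ι E} (h : IsRep i ρ)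
    (h' : IsRep i ρ') (hι : Fintype.card ι ^ 2 = Module.finrank F X) :
    ∃ P : (Matrix ι ι E)ˣ, ∀ x, ρ x * P = P * ρ' x := by
  let := i.toAlgebra
  have : Nonempty ι := by
    rw [← Fintype.card_pos_iff]
    have : 0 < Module.finrank F X := Module.finrank_pos
    rw [← hι] at this
    exact Nat.pos_of_ne_zero fun h => by simp [h] at this
  obtain ⟨τ, hτ⟩ := exists_algHom h
  obtain ⟨τ', hτ'⟩ := exists_algHom h'
  let b := Module.finBasis F X
  have hd : Module.finrank E (Matrix ι ι E) = Module.finrank F X := by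
    rw [Module.finrank_matrix, ← hι]; simp [sq]
  let B := basisOfLinearIndependentOfCardEqFinrank' _ (linearIndependent_map (E := E) τ b)
    (by simp [hd])
  let B' := basisOfLinearIndependentOfCardEqFinrank' _ (linearIndependent_map (E := E) τ' b)
    (by simp [hd])
  let L : Matrix ι ι E ≃ₗ[E] Matrix ι ι E := B'.equiv B (Equiv.refl _)
  have hLb : ∀ k, L (τ' (b k)) = τ (b k) := by
    intro k
    have := B'.equiv_apply (b' := B) (e := Equiv.refl _) k
    simpa [B, B', L] using this
  have hL : ∀ x, L (τ' x) = τ x := by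
    intro x
    have : (L.toLinearMap.restrictScalars F) ∘ₗ τ'.toLinearMap = τ.toLinearMap :=
      b.ext fun k => by simpa using hLb k
    exact congrArg (fun f => f x) this
  have hsp := h'.span_eq_top hι
  have hmul : ∀ y z, L (y * z) = L y * L z := by
    intro y z
    have hy : y ∈ Submodule.span E (Set.range ρ') := by rw [hsp]; trivial
    have hz : z ∈ Submodule.span E (Set.range ρ') := by rw [hsp]; trivial
    induction hy using Submodule.span_induction with
    | zero => simp
    | add a b _ _ ha hb => rw [add_mul, map_add, ha, hb, map_add, add_mul]
    | smul c a _ ha => rw [smul_mul_assoc, map_smul, ha, map_smul, smul_mul_assoc]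
    | mem y hy =>
      obtain ⟨x, rfl⟩ := hy
      induction hz using Submodule.span_induction with
      | zero => simp
      | add a b _ _ ha hb => rw [mul_add, map_add, ha, hb, map_add, mul_add]
      | smul c a _ ha => rw [mul_smul_comm, map_smul, ha, map_smul, mul_smul_comm]
      | mem z hz =>
        obtain ⟨x', rfl⟩ := hz
        rw [← hτ', ← hτ', ← map_mul, hL, hL, hL, map_mul]
  let f : Matrix ι ι E ≃ₐ[E] Matrix ι ι E :=
    AlgEquiv.ofLinearEquiv L (by have := hL 1; rwa [map_one τ', map_one τ] at this) hmul
  let f' := (Matrix.toLinAlgEquiv' (R := E) (n := ι)).symm.trans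
    (f.trans (Matrix.toLinAlgEquiv' (R := E) (n := ι)))
  obtain ⟨T, hT⟩ := f'.eq_linearEquivConjAlgEquiv
  have hT' : ∀ y : Matrix ι ι E, Matrix.toLin' (f y) ∘ₗ T.toLinearMap =
      T.toLinearMap ∘ₗ Matrix.toLin' y := by
    intro y
    have := congrArg (fun g => g (Matrix.toLin' y)) hT
    have h2 : f' (Matrix.toLin' y) = Matrix.toLin' (f y) := by
      change Matrix.toLinAlgEquiv' (f (Matrix.toLinAlgEquiv'.symm (Matrix.toLinAlgEquiv' y))) = _
      rw [AlgEquiv.symm_apply_apply]; rfl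
    simp only [h2] at this
    rw [this]
    refine LinearMap.ext fun v => ?_
    simp [LinearEquiv.conjAlgEquiv_apply]
  refine ⟨⟨LinearMap.toMatrix' T.toLinearMap, LinearMap.toMatrix' T.symm.toLinearMap, ?_, ?_⟩, ?_⟩
  · rw [← LinearMap.toMatrix'_comp]; simp
  · rw [← LinearMap.toMatrix'_comp]; simp
  intro x
  have := congrArg LinearMap.toMatrix' (hT' (τ' x))
  rw [LinearMap.toMatrix'_comp, LinearMap.toMatrix'_comp, LinearMap.toMatrix'_toLin',
    LinearMap.toMatrix'_toLin'] at this
  rw [← hτ, ← hτ', ← hL]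
  exact this

end Representations

section QuadraticDescent

variable {F X : Type*} [Field F] [Ring X] [Algebra F X]
variable {ι : Type*} [Fintype ι] [DecidableEq ι]

lemma map_eq_of_twist {R : Type*} [Ring R] (S : R →+* R) {P q y z : R} (hq : P * S q = q)
    (hz : z * P = P * S z) (hy : q * y = z * q) : q * S y = q * y := by
  have h := congrArg (P * S ·) hy
  simp only [map_mul] at h
  rw [← mul_assoc, hq, ← mul_assoc, ← hz, mul_assoc, hq] at h
  rw [h, hy]

lemma mapMatrix_smul {E E' : Type*} [Field E] [Field E'] (φ : E →+* E') (c : E)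
    (A : Matrix ι ι E) : φ.mapMatrix (c • A) = φ c • φ.mapMatrix A := by
  ext j k
  simp

lemma mapMatrix_injective {E E' : Type*} [Field E] [Field E'] (φ : E →+* E') :
    Function.Injective (φ.mapMatrix : Matrix ι ι E →+* Matrix ι ι E') := by
  intro A B h
  ext j k
  exact φ.injective (congrFun (congrFun h j) k)

/-- `X` is split by the field `M` along `i : F →+* M`, with matrices indexed by `ι`. -/
def Spl (ι X : Type*) [Fintype ι] [DecidableEq ι] [Ring X] {F M : Type*} [Field F] [Field M]
    [Algebra F X] (i : F →+* M) : Prop :=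
  ∃ ρ : X →+* Matrix ι ι M, IsRep i ρ

lemma Spl.map {M M' : Type*} [Field M] [Field M'] {i : F →+* M} (h : Spl ι X i) (φ : M →+* M') :
    Spl ι X (φ.comp i) := by
  obtain ⟨ρ, hρ⟩ := h
  exact ⟨_, hρ.comp φ⟩

lemma IsRep.descend {M E : Type*} [Field M] [Field E] {i : F →+* M} {φ : M →+* E}
    {ρ : X →+* Matrix ι ι E} (h : IsRep (φ.comp i) ρ) (hr : ∀ x j k, ∃ m, φ m = ρ x j k) :
    ∃ ρM : X →+* Matrix ι ι M, IsRep i ρM ∧ ∀ x, φ.mapMatrix (ρM x) = ρ x := by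
  choose f hf using hr
  have hf' : ∀ x, φ.mapMatrix (Matrix.of (f x)) = ρ x := fun x => by ext j k; exact hf x j k
  have hinj := mapMatrix_injective (ι := ι) φ
  refine ⟨⟨⟨⟨fun x => Matrix.of (f x), ?_⟩, ?_⟩, ?_, ?_⟩, ?_, hf'⟩
  · exact hinj (by rw [hf', map_one, map_one])
  · exact fun x y => hinj (by simp only [hf', map_mul])
  · exact hinj (by simp only [hf', map_zero])
  · exact fun x y => hinj (by simp only [hf', map_add])
  · intro a
    apply hinj
    change φ.mapMatrix (Matrix.of (f _)) = _
    rw [hf', h a, mapMatrix_smul, map_one]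
    rfl

variable {M E : Type*} [Field M] [Field E] [Algebra M E] {d : M} {r : E} {σ : E ≃ₐ[M] E}

lemma IsQuad.exists_mul_map_eq [CharZero M] (h : IsQuad M E d r σ) {P : Matrix ι ι E}
    (hP : P * (σ : E →+* E).mapMatrix P = 1) :
    ∃ Q : (Matrix ι ι E)ˣ, P * (σ : E →+* E).mapMatrix Q.val = Q := by
  have := h.charZeroL
  let p : Polynomial E := ((Polynomial.X : Polynomial E) • ((Polynomial.C : E →+* Polynomial E).mapMatrix
      (1 + P)) +
    (Polynomial.C : E →+* Polynomial E).mapMatrix (r • (1 - P))).det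
  have hev : ∀ c : E, p.eval c = (c • (1 + P) + r • (1 - P)).det := by
    intro c
    change Polynomial.evalRingHom c p = _
    rw [RingHom.map_det]
    congr 1
    ext j k
    simp
    ring
  have hp : p ≠ 0 := by
    intro h0
    have := hev r
    rw [h0, ← smul_add, show (1 + P) + (1 - P) = (2 : E) • (1 : Matrix ι ι E) by
      rw [two_smul]; abel, smul_smul, Matrix.det_smul] at this
    simp only [Polynomial.eval_zero, Matrix.det_one, mul_one] at this
    exact pow_ne_zero _ (mul_ne_zero h.ne two_ne_zero) this.symm
  obtain ⟨c, hc⟩ : ∃ c : M, ¬ p.IsRoot (algebraMap M E c) := by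
    by_contra! hcon
    apply hp
    apply Polynomial.eq_zero_of_infinite_isRoot
    refine Set.Infinite.mono ?_ (Set.infinite_range_of_injective (algebraMap M E).injective)
    rintro _ ⟨c, rfl⟩
    exact hcon c
  rw [Polynomial.IsRoot, hev] at hc
  have hu : IsUnit (algebraMap M E c • (1 + P) + r • (1 - P)) :=
    (Matrix.isUnit_iff_isUnit_det _).2 (isUnit_iff_ne_zero.2 hc)
  refine ⟨hu.unit, ?_⟩
  rw [hu.unit_spec, map_add, mapMatrix_smul, mapMatrix_smul, map_add, map_sub, map_one]
  simp only [RingHom.coe_coe, AlgEquiv.commutes, h.conj]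
  rw [mul_add, mul_smul_comm, mul_smul_comm, mul_add, mul_sub, hP, mul_one, neg_smul, ← smul_neg,
    add_comm P 1, neg_sub]

lemma IsQuad.descend [CharZero M] (h : IsQuad M E d r σ) {i : F →+* M} {ρ : X →+* Matrix ι ι E}
    (hρ : IsRep ((algebraMap M E).comp i) ρ) {P : Matrix ι ι E}
    (hP : P * (σ : E →+* E).mapMatrix P = 1)
    (hc : ∀ x, ρ x * P = P * (σ : E →+* E).mapMatrix (ρ x)) :
    ∃ (Q : (Matrix ι ι E)ˣ) (ρM : X →+* Matrix ι ι M), P * (σ : E →+* E).mapMatrix Q.val = Q ∧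
      IsRep i ρM ∧ ∀ x, Q * (algebraMap M E).mapMatrix (ρM x) = ρ x * Q := by
  obtain ⟨Q, hQ⟩ := h.exists_mul_map_eq hP
  let ρ' : X →+* Matrix ι ι E :=
    { toFun := fun x => Q⁻¹.val * ρ x * Q
      map_one' := by simp
      map_mul' := fun x y => by
        rw [map_mul]
        calc _ = Q⁻¹.val * ρ x * 1 * (ρ y * Q) := by simp only [mul_assoc, one_mul]
          _ = _ := by rw [← Q.mul_inv]; simp only [mul_assoc]
      map_zero' := by simp
      map_add' := fun x y => by simp [mul_add, add_mul] }
  have hρ' : IsRep ((algebraMap M E).comp i) ρ' := by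
    intro a
    change Q⁻¹.val * ρ _ * Q = _
    rw [hρ a]
    simp
  have e1 : ∀ x, Q.val * ρ' x = ρ x * Q.val := by
    intro x
    change Q.val * (Q⁻¹.val * ρ x * Q.val) = _
    rw [← mul_assoc, ← mul_assoc, Q.mul_inv, one_mul]
  clear_value ρ'
  have hfix : ∀ x, (σ : E →+* E).mapMatrix (ρ' x) = ρ' x := fun x =>
    (Units.mul_right_inj Q).1 (map_eq_of_twist (σ : E →+* E).mapMatrix hQ (hc x) (e1 x))
  obtain ⟨ρM, h1, h2⟩ := hρ'.descend (φ := algebraMap M E) (i := i) fun x j k =>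
    h.mem_of_fixed (congrFun (congrFun (hfix x) j) k)
  exact ⟨Q, ρM, hQ, h1, fun x => by rw [h2, e1]⟩

/-- Descent along a quadratic extension when the obstruction is a norm. -/
theorem IsQuad.spl [CharZero M] (h : IsQuad M E d r σ) {i : F →+* M} {ρ : X →+* Matrix ι ι E}
    (hρ : IsRep ((algebraMap M E).comp i) ρ) {P : Matrix ι ι E}
    (hc : ∀ x, ρ x * P = P * (σ : E →+* E).mapMatrix (ρ x)) {e : M} (he : e ≠ 0)
    (hP : P * (σ : E →+* E).mapMatrix P = algebraMap M E e • 1) (hs : Sol M d e) :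
    Spl ι X i := by
  obtain ⟨z, hz⟩ := h.sol_iff.1 hs
  have hz0 : z * σ z ≠ 0 := by
    rw [hz]; exact (map_ne_zero_iff _ (algebraMap M E).injective).2 he
  obtain ⟨Q, ρM, -, h1, -⟩ := h.descend hρ (P := z⁻¹ • P) (by
    rw [mapMatrix_smul, smul_mul_smul_comm, hP, ← hz, smul_smul]
    simp only [RingHom.coe_coe, map_inv₀]
    rw [← mul_inv, inv_mul_cancel₀ hz0, one_smul]) (fun x => by
    rw [mul_smul_comm, smul_mul_assoc, hc])
  exact ⟨ρM, h1⟩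

end QuadraticDescent

section Lift

variable {K L B : Type*} [Field K] [Field L] [Algebra K L] [Field B] {a : K} {r : L}
  {σ : L ≃ₐ[K] L}

lemma IsQuad.coeff_unique (h : IsQuad K L a r σ) [CharZero K] {p q p' q' : K}
    (he : algebraMap K L p + algebraMap K L q * r = algebraMap K L p' + algebraMap K L q' * r) :
    p = p' ∧ q = q' := by
  have := h.charZeroL
  have h2 := congrArg σ he
  simp only [map_add, map_mul, AlgEquiv.commutes, h.conj] at h2
  have hp : algebraMap K L p = algebraMap K L p' := by linear_combination (he + h2) / 2
  have hq : algebraMap K L q * r = algebraMap K L q' * r := by linear_combination he - hp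
  exact ⟨(algebraMap K L).injective hp, (algebraMap K L).injective (mul_right_cancel₀ h.ne hq)⟩

lemma IsQuad.exists_lift (h : IsQuad K L a r σ) [CharZero K] (j : K →+* B) {m : B}
    (hm : m ^ 2 = j a) :
    ∃ φ : L →+* B, φ.comp (algebraMap K L) = j ∧ φ r = m := by
  choose p q hpq using h.span
  have key : ∀ z p' q', z = algebraMap K L p' + algebraMap K L q' * r →
      j (p z) + j (q z) * m = j p' + j q' * m := by
    intro z p' q' hz
    have := h.coeff_unique ((hpq z).symm.trans hz)
    rw [this.1, this.2]
  have hr2 := h.sq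
  let φ : L →+* B :=
    { toFun := fun z => j (p z) + j (q z) * m
      map_one' := by rw [key 1 1 0 (by simp)]; simp
      map_zero' := by rw [key 0 0 0 (by simp)]; simp
      map_mul' := fun x y => by
        rw [key (x * y) (p x * p y + a * (q x * q y)) (p x * q y + q x * p y) (by
          conv_lhs => rw [hpq x, hpq y]
          simp only [map_add, map_mul]
          linear_combination (algebraMap K L (q x) * algebraMap K L (q y)) * hr2)]
        simp only [map_add, map_mul]
        linear_combination (- (j (q x) * j (q y))) * hm
      map_add' := fun x y => by
        rw [key (x + y) (p x + p y) (q x + q y) (by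
          conv_lhs => rw [hpq x, hpq y]
          simp only [map_add]
          ring)]
        simp only [map_add]
        ring }
  refine ⟨φ, ?_, ?_⟩
  · ext c
    change j (p _) + j (q _) * m = _
    rw [key _ c 0 (by simp)]
    simp
  · change j (p _) + j (q _) * m = _
    rw [key _ 0 1 (by simp)]
    simp

end Lift

section Intertwiners

universe u

open scoped TensorProduct Kronecker

variable {F X : Type*} [Field F] [Ring X] [Algebra F X]
variable {E : Type*} [Field E] {ι : Type*} [Fintype ι] [DecidableEq ι]

/-- `P` is an invertible intertwiner from `ρ'` to `ρ`. -/
def Itw (ρ : X →+* Matrix ι ι E) (P : Matrix ι ι E) (ρ' : X →+* Matrix ι ι E) : Prop :=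
  IsUnit P ∧ ∀ x, ρ x * P = P * ρ' x

lemma Itw.one (ρ : X →+* Matrix ι ι E) : Itw ρ 1 ρ := ⟨isUnit_one, fun x => by simp⟩

lemma Itw.trans {ρ ρ' ρ'' : X →+* Matrix ι ι E} {P R : Matrix ι ι E} (h : Itw ρ P ρ')
    (h' : Itw ρ' R ρ'') : Itw ρ (P * R) ρ'' :=
  ⟨h.1.mul h'.1, fun x => by rw [← mul_assoc, h.2, mul_assoc, h'.2, mul_assoc]⟩

lemma Itw.map {E' : Type*} [Field E'] {ρ ρ' : X →+* Matrix ι ι E} {P : Matrix ι ι E}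
    (h : Itw ρ P ρ') (g : E →+* E') :
    Itw (g.mapMatrix.comp ρ) (g.mapMatrix P) (g.mapMatrix.comp ρ') :=
  ⟨h.1.map _, fun x => by simp only [RingHom.comp_apply, ← map_mul, h.2]⟩

lemma Itw.smul {ρ ρ' : X →+* Matrix ι ι E} {P : Matrix ι ι E} (h : Itw ρ P ρ') {c : E}
    (hc : c ≠ 0) : Itw ρ (c • P) ρ' :=
  ⟨(h.1.smul (Units.mk0 c hc) : IsUnit (Units.mk0 c hc • P)),
    fun x => by rw [mul_smul_comm, smul_mul_assoc, h.2]⟩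

lemma smul_left_cancel_isUnit [Nonempty ι] {P : Matrix ι ι E} (h : IsUnit P) {c d : E}
    (hcd : c • P = d • P) : c = d := by
  obtain ⟨Q, rfl⟩ := h
  have := congrArg (· * Q⁻¹.val) hcd
  simp only [smul_mul_assoc, Q.mul_inv] at this
  obtain ⟨j⟩ := ‹Nonempty ι›
  simpa using congrFun (congrFun this j) j

section

variable [FiniteDimensional F X] [Algebra.IsCentral F X] [IsSimpleRing X]

lemma nonempty_of_card_sq (hι : Fintype.card ι ^ 2 = Module.finrank F X) : Nonempty ι := by
  rw [← Fintype.card_pos_iff]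
  have : 0 < Module.finrank F X := Module.finrank_pos
  rw [← hι] at this
  exact Nat.pos_of_ne_zero fun h => by simp [h] at this

lemma IsRep.exists_itw {i : F →+* E} {ρ ρ' : X →+* Matrix ι ι E} (h : IsRep i ρ)
    (h' : IsRep i ρ') (hι : Fintype.card ι ^ 2 = Module.finrank F X) : ∃ P, Itw ρ P ρ' := by
  obtain ⟨P, hP⟩ := h.exists_conj h' hι
  exact ⟨P, P.isUnit, hP⟩

lemma IsRep.itw_unique {i : F →+* E} {ρ ρ' : X →+* Matrix ι ι E} (h : IsRep i ρ)
    (hι : Fintype.card ι ^ 2 = Module.finrank F X) {P R : Matrix ι ι E} (hP : Itw ρ P ρ')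
    (hR : Itw ρ R ρ') : ∃ c : E, c ≠ 0 ∧ P = c • R := by
  have := nonempty_of_card_sq hι
  obtain ⟨⟨R, rfl⟩, hR⟩ := hR
  have hR' : ∀ x, ρ' x * R⁻¹.val = R⁻¹.val * ρ x := fun x => by
    rw [← Units.mul_right_inj R, ← mul_assoc, ← hR, mul_assoc, R.mul_inv, ← mul_assoc, R.mul_inv,
      one_mul, mul_one]
  obtain ⟨c, hc⟩ := h.exists_smul_one hι (z := P * R⁻¹.val) fun x => by
    rw [← mul_assoc, hP.2, mul_assoc, hR', mul_assoc]
  have hPc : P = c • R.val := by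
    rw [← one_mul R.val, ← smul_mul_assoc, ← hc, mul_assoc, R.inv_mul, mul_one]
  refine ⟨c, ?_, hPc⟩
  rintro rfl
  rw [zero_smul] at hPc
  exact not_isUnit_zero (hPc ▸ hP.1)

end

/-- `Q` trivialises the tensor square of `ρ`. -/
def Kr (Ψ : X → X → Matrix (ι × ι) (ι × ι) F) (i : F →+* E) (ρ : X →+* Matrix ι ι E)
    (Q : Matrix (ι × ι) (ι × ι) E) : Prop :=
  IsUnit Q ∧ ∀ x y, (ρ x ⊗ₖ ρ y) * Q = Q * i.mapMatrix (Ψ x y)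

lemma mapMatrix_kronecker {E' : Type*} [Field E'] (g : E →+* E') (A B : Matrix ι ι E) :
    g.mapMatrix (A ⊗ₖ B) = g.mapMatrix A ⊗ₖ g.mapMatrix B := by
  ext a b
  simp [Matrix.kroneckerMap_apply]

lemma Kr.map {E' : Type*} [Field E'] {Ψ : X → X → Matrix (ι × ι) (ι × ι) F} {i : F →+* E}
    {ρ : X →+* Matrix ι ι E} {Q : Matrix (ι × ι) (ι × ι) E} (h : Kr Ψ i ρ Q) (g : E →+* E') :
    Kr Ψ (g.comp i) (g.mapMatrix.comp ρ) (g.mapMatrix Q) := by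
  refine ⟨h.1.map _, fun x y => ?_⟩
  have := congrArg g.mapMatrix (h.2 x y)
  rw [map_mul, map_mul, mapMatrix_kronecker] at this
  exact this

lemma isUnit_kronecker {A B : Matrix ι ι E} (hA : IsUnit A) (hB : IsUnit B) :
    IsUnit (A ⊗ₖ B) := by
  rw [Matrix.isUnit_iff_isUnit_det] at *
  rw [Matrix.det_kronecker]
  exact (hA.pow _).mul (hB.pow _)

/-- The family `Ψ` splits the tensor square of `X` over every extension in a given universe. -/
structure IsKr (Ψ : X → X → Matrix (ι × ι) (ι × ι) F) : Prop where
  exists_kr : ∀ {E : Type u} [Field E] {i : F →+* E} {ρ : X →+* Matrix ι ι E}, IsRep i ρ →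
    ∃ Q, Kr Ψ i ρ Q
  eq_smul_one : ∀ {E : Type u} [Field E] (i : F →+* E) {z : Matrix (ι × ι) (ι × ι) E},
    (∀ x y, i.mapMatrix (Ψ x y) * z = z * i.mapMatrix (Ψ x y)) → ∃ c : E, z = c • 1

lemma exists_kronecker_rep {i : F →+* E} {ρ : X →+* Matrix ι ι E} (h : IsRep i ρ) :
    ∃ κ : X ⊗[F] X →+* Matrix (ι × ι) (ι × ι) E, IsRep i κ ∧ ∀ x y, κ (x ⊗ₜ y) = ρ x ⊗ₖ ρ y := by
  let := i.toAlgebra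
  obtain ⟨ρ', hρ'⟩ := exists_algHom h
  let f1 : X →ₐ[F] Matrix (ι × ι) (ι × ι) E := AlgHom.ofLinearMap
    { toFun := fun x => ρ' x ⊗ₖ (1 : Matrix ι ι E)
      map_add' := fun x y => by rw [map_add, Matrix.add_kronecker]
      map_smul' := fun c x => by rw [map_smul, Matrix.smul_kronecker, RingHom.id_apply] }
    (by simp) fun x y => by
      change ρ' (x * y) ⊗ₖ _ = (ρ' x ⊗ₖ (1 : Matrix ι ι E)) * (ρ' y ⊗ₖ (1 : Matrix ι ι E))
      rw [map_mul, ← Matrix.mul_kronecker_mul, mul_one]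
  let f2 : X →ₐ[F] Matrix (ι × ι) (ι × ι) E := AlgHom.ofLinearMap
    { toFun := fun x => (1 : Matrix ι ι E) ⊗ₖ ρ' x
      map_add' := fun x y => by rw [map_add, Matrix.kronecker_add]
      map_smul' := fun c x => by rw [map_smul, Matrix.kronecker_smul, RingHom.id_apply] }
    (by simp) fun x y => by
      change _ ⊗ₖ ρ' (x * y) = ((1 : Matrix ι ι E) ⊗ₖ ρ' x) * ((1 : Matrix ι ι E) ⊗ₖ ρ' y)
      rw [map_mul, ← Matrix.mul_kronecker_mul, mul_one]
  let κ : X ⊗[F] X →ₐ[F] Matrix (ι × ι) (ι × ι) E := Algebra.TensorProduct.lift f1 f2 fun x y => by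
    change (ρ' x ⊗ₖ (1 : Matrix ι ι E)) * ((1 : Matrix ι ι E) ⊗ₖ ρ' y) =
      ((1 : Matrix ι ι E) ⊗ₖ ρ' y) * (ρ' x ⊗ₖ (1 : Matrix ι ι E))
    rw [← Matrix.mul_kronecker_mul, ← Matrix.mul_kronecker_mul]
    simp
  refine ⟨κ, fun a => ?_, fun x y => ?_⟩
  · change κ (algebraMap F _ a) = _
    rw [κ.commutes, Algebra.algebraMap_eq_smul_one]
    rfl
  · change κ (x ⊗ₜ y) = _
    rw [Algebra.TensorProduct.lift_tmul]
    change (ρ' x ⊗ₖ (1 : Matrix ι ι E)) * ((1 : Matrix ι ι E) ⊗ₖ ρ' y) = _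
    rw [← Matrix.mul_kronecker_mul, mul_one, one_mul, hρ', hρ']

theorem exists_isKr [FiniteDimensional F X]
    (hι : Fintype.card ι ^ 2 = Module.finrank F X)
    (h2 : ∃ m : ℕ, 0 < m ∧ Nonempty ((X ⊗[F] X) ≃ₐ[F] Matrix (Fin m) (Fin m) F)) :
    ∃ Ψ : X → X → Matrix (ι × ι) (ι × ι) F, IsKr.{u} Ψ := by
  obtain ⟨m, hm, ⟨e⟩⟩ := h2
  have hm' : m = Fintype.card (ι × ι) := by
    have := e.toLinearEquiv.finrank_eq
    rw [Module.finrank_tensorProduct, ← hι, Module.finrank_matrix] at this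
    simp only [Fintype.card_fin, Module.finrank_self, mul_one] at this
    rw [Fintype.card_prod]
    exact Nat.pow_left_injective (n := 2) two_ne_zero (by simp only; nlinarith)
  let e1 : Fin m ≃ ι × ι := (Fintype.equivOfCardEq (by simpa using hm'))
  let e' : (X ⊗[F] X) ≃ₐ[F] Matrix (ι × ι) (ι × ι) F := e.trans (Matrix.reindexAlgEquiv F F e1)
  have : Nonempty (ι × ι) := ⟨e1 ⟨0, hm⟩⟩
  have : Algebra.IsCentral F (X ⊗[F] X) := ⟨fun z hz => by
    have h : e' z ∈ Subalgebra.center F (Matrix (ι × ι) (ι × ι) F) :=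
      Subalgebra.mem_center_iff.2 fun y => by
        obtain ⟨y, rfl⟩ := e'.surjective y
        rw [← map_mul, ← map_mul, Subalgebra.mem_center_iff.1 hz]
    rw [Algebra.IsCentral.center_eq_bot, Algebra.mem_bot] at h
    obtain ⟨c, hc⟩ := h
    exact Algebra.mem_bot.2 ⟨c, e'.injective (by rw [e'.commutes, hc])⟩⟩
  have : IsSimpleRing (X ⊗[F] X) := IsSimpleRing.of_ringEquiv e'.symm.toRingEquiv inferInstance
  have hι' : Fintype.card (ι × ι) ^ 2 = Module.finrank F (X ⊗[F] X) := by
    rw [Module.finrank_tensorProduct, ← hι, Fintype.card_prod]; ring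
  have hrep : ∀ {E : Type u} [Field E] (i : F →+* E),
      IsRep i (i.mapMatrix.comp (e' : X ⊗[F] X →+* Matrix (ι × ι) (ι × ι) F)) := by
    intro E _ i a
    change i.mapMatrix (e' (algebraMap F _ a)) = _
    rw [e'.commutes, Algebra.algebraMap_eq_smul_one, mapMatrix_smul, map_one]
  refine ⟨fun x y => e' (x ⊗ₜ y), fun {E} _ i ρ h => ?_, fun {E} _ i z hz => ?_⟩
  · obtain ⟨κ, h1, h2⟩ := exists_kronecker_rep h
    obtain ⟨Q, hQ⟩ := h1.exists_conj (hrep i) hι'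
    exact ⟨Q, Q.isUnit, fun x y => by rw [← h2]; exact hQ _⟩
  · refine (hrep i).exists_smul_one hι' fun t => ?_
    induction t with
    | zero => simp
    | add a b ha hb => rw [map_add, add_mul, mul_add, ha, hb]
    | tmul x y => exact hz x y

lemma IsKr.exists_smul [Nonempty ι] {E : Type u} [Field E]
    {Ψ : X → X → Matrix (ι × ι) (ι × ι) F} (hΨ : IsKr.{u} Ψ)
    {i : F →+* E} {ρ ρ' : X →+* Matrix ι ι E} {Q Q' : Matrix (ι × ι) (ι × ι) E} (h : Kr Ψ i ρ Q)
    (h' : Kr Ψ i ρ' Q') {P : Matrix ι ι E} (hP : Itw ρ P ρ') :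
    ∃ f : E, f ≠ 0 ∧ (P ⊗ₖ P) * Q' = f • Q := by
  obtain ⟨⟨Q, rfl⟩, hQ⟩ := h
  have hPP := isUnit_kronecker hP.1 hP.1
  obtain ⟨c, hc⟩ := hΨ.eq_smul_one i (z := Q⁻¹.val * ((P ⊗ₖ P) * Q')) fun x y => by
    have h1 : i.mapMatrix (Ψ x y) * Q⁻¹.val = Q⁻¹.val * (ρ x ⊗ₖ ρ y) := by
      rw [← Units.mul_right_inj Q, ← mul_assoc, ← mul_assoc, ← hQ, mul_assoc, Q.mul_inv, one_mul,
        mul_one]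
    rw [← mul_assoc, h1, mul_assoc, mul_assoc, mul_assoc, ← h'.2, ← mul_assoc (ρ x ⊗ₖ ρ y),
      ← mul_assoc (P ⊗ₖ P), ← Matrix.mul_kronecker_mul, ← Matrix.mul_kronecker_mul, hP.2, hP.2]
  have hc' : (P ⊗ₖ P) * Q' = c • Q.val := by
    rw [← Units.mul_right_inj Q⁻¹, hc, mul_smul_comm, Q.inv_mul]
  refine ⟨c, ?_, hc'⟩
  rintro rfl
  rw [zero_smul] at hc'
  have hT := h'.1
  exact not_isUnit_zero (hc' ▸ hPP.mul hT)

/-- Multiplicativity of the tensor square scalars. -/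
lemma kr_mul [Nonempty ι] {E' : Type*} [Field E'] {g : E →+* E'} {P T : Matrix ι ι E'}
    {R : Matrix ι ι E} {c fP fT : E'} {fR : E}
    {Q₁ Q₂ : Matrix (ι × ι) (ι × ι) E} {Q₀ : Matrix (ι × ι) (ι × ι) E'} (hQ : IsUnit Q₀)
    (hP : (P ⊗ₖ P) * g.mapMatrix Q₁ = fP • Q₀) (hR : (R ⊗ₖ R) * Q₂ = fR • Q₁)
    (hT : (T ⊗ₖ T) * g.mapMatrix Q₂ = fT • Q₀) (hPR : P * g.mapMatrix R = c • T) :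
    c ^ 2 * fT = g fR * fP := by
  refine smul_left_cancel_isUnit hQ ?_
  have h1 := congrArg g.mapMatrix hR
  rw [map_mul, mapMatrix_smul, mapMatrix_kronecker] at h1
  calc (c ^ 2 * fT) • Q₀ = c • c • ((T ⊗ₖ T) * g.mapMatrix Q₂) := by
        rw [hT, smul_smul, smul_smul]; ring_nf
    _ = ((P * g.mapMatrix R) ⊗ₖ (P * g.mapMatrix R)) * g.mapMatrix Q₂ := by
        rw [hPR, Matrix.smul_kronecker, Matrix.kronecker_smul, smul_mul_assoc, smul_mul_assoc]
    _ = _ := by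
        rw [Matrix.mul_kronecker_mul, mul_assoc, h1, mul_smul_comm, hP, smul_smul]

end Intertwiners

section QuadraticSteps

universe u

open scoped Kronecker

lemma IsQuad.hom_ext {K L B : Type*} [Field K] [Field L] [Algebra K L] [Field B] {a : K} {r : L}
    {σ : L ≃ₐ[K] L} (h : IsQuad K L a r σ) {f g : L →+* B}
    (hK : f.comp (algebraMap K L) = g.comp (algebraMap K L)) (hr : f r = g r) : f = g := by
  ext z
  obtain ⟨p, q, rfl⟩ := h.span z
  have hK' : ∀ p, f (algebraMap K L p) = g (algebraMap K L p) := fun p =>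
    congrArg (fun k : K →+* B => k p) hK
  simp only [map_add, map_mul, hK', hr]

lemma hilbert90_involution {E : Type*} [Field E] (g : E →+* E) {u : E}
    (hu : g u = -u) (hu0 : u ≠ 0) {x : E} (hx : x * g x = 1) : ∃ z, z ≠ 0 ∧ x * g z = z := by
  by_cases h : 1 + x = 0
  · refine ⟨u, hu0, ?_⟩
    rw [hu, show x = -1 by linear_combination h]
    ring
  · refine ⟨1 + x, h, ?_⟩
    rw [map_add, map_one, mul_add, hx]
    ring

variable {F X : Type*} [Field F] [Ring X] [Algebra F X]
  [FiniteDimensional F X] [Algebra.IsCentral F X] [IsSimpleRing X]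
  {ι : Type*} [Fintype ι] [DecidableEq ι]

lemma mapMatrix_involution {E : Type*} [Field E] {g : E →+* E} (hg : ∀ z, g (g z) = z)
    (A : Matrix ι ι E) : g.mapMatrix (g.mapMatrix A) = A := by
  ext j k
  exact hg _

lemma IsRep.exists_norm {E : Type*} [Field E] {i : F →+* E} {ρ : X →+* Matrix ι ι E}
    (h : IsRep i ρ) (hι : Fintype.card ι ^ 2 = Module.finrank F X) {g : E →+* E}
    (hg : ∀ z, g (g z) = z) {P : Matrix ι ι E} (hP : Itw ρ P (g.mapMatrix.comp ρ)) :
    ∃ c, c ≠ 0 ∧ P * g.mapMatrix P = c • 1 ∧ g c = c := by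
  have := nonempty_of_card_sq hι
  have h1 := hP.trans (hP.map g)
  rw [show g.mapMatrix.comp (g.mapMatrix.comp ρ) = ρ from
    RingHom.ext fun x => mapMatrix_involution hg _] at h1
  obtain ⟨c, hc, hPc⟩ := h.itw_unique hι h1 (Itw.one ρ)
  refine ⟨c, hc, hPc, ?_⟩
  have h2 := congrArg g.mapMatrix hPc
  rw [map_mul, mapMatrix_involution hg, mapMatrix_smul, map_one] at h2
  refine smul_left_cancel_isUnit hP.1 ?_
  calc g c • P = P * (g c • 1) := by rw [mul_smul_comm, mul_one]
    _ = c • P := by rw [← h2, ← mul_assoc, hPc, smul_mul_assoc, one_mul]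

lemma isRep_of_fixed {E : Type*} [Field E] {i : F →+* E} {ρ : X →+* Matrix ι ι E}
    (h : IsRep i ρ) {g : E →+* E} (hg : g.comp i = i) : IsRep i (g.mapMatrix.comp ρ) := by
  have := h.comp g
  rwa [hg] at this

theorem IsQuad.exists_spl_of_sol (hι : Fintype.card ι ^ 2 = Module.finrank F X)
    {A K : Type u} [Field A] [CharZero A] [Field K] [Algebra A K] {d : A} {r : K} {σ : K ≃ₐ[A] K}
    (h : IsQuad A K d r σ) {i : F →+* A} (hS : Spl ι X ((algebraMap A K).comp i)) :
    ∃ e : A, e ≠ 0 ∧ ∀ (M : Type u) [Field M] (j : A →+* M), Sol M (j d) (j e) →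
      Spl ι X (j.comp i) := by
  obtain ⟨ρ, hρ⟩ := hS
  have hσ : (σ : K →+* K).comp ((algebraMap A K).comp i) = (algebraMap A K).comp i := by
    ext x; simp
  obtain ⟨P, hP⟩ := hρ.exists_itw (isRep_of_fixed hρ hσ) hι
  obtain ⟨c, hc, hPc, hcσ⟩ := hρ.exists_norm hι h.conj_conj hP
  obtain ⟨e, rfl⟩ := h.mem_of_fixed hcσ
  refine ⟨e, by rintro rfl; simp at hc, fun M _ j hs => ?_⟩
  have : CharZero M := charZero_of_injective_ringHom j.injective
  by_cases hsq : IsSquare (j d)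
  · obtain ⟨w, hw⟩ := hsq
    obtain ⟨φ, hφ, -⟩ := h.exists_lift j (m := w) (by rw [hw, pow_two])
    have := Spl.map ⟨ρ, hρ⟩ φ
    rwa [← RingHom.comp_assoc, hφ] at this
  · obtain ⟨L, _, _, _, r', σ', h'⟩ := exists_isQuad hsq
    obtain ⟨φ, hφ, hφr⟩ : ∃ φ : K →+* L, φ.comp (algebraMap A K) = (algebraMap M L).comp j ∧ φ r = r' :=
      h.exists_lift ((algebraMap M L).comp j) (m := r') h'.sq
    have hcomm : (σ' : L →+* L).comp φ = φ.comp (σ : K →+* K) := by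
      apply h.hom_ext
      · rw [RingHom.comp_assoc, hφ, RingHom.comp_assoc,
          show (σ : K →+* K).comp (algebraMap A K) = algebraMap A K by ext; simp, hφ]
        ext; simp
      · simp [hφr, h.conj, h'.conj]
    have hρ' := hρ.comp φ
    rw [← RingHom.comp_assoc, hφ, RingHom.comp_assoc] at hρ'
    have hcommM : ∀ B : Matrix ι ι K, (σ' : L →+* L).mapMatrix (φ.mapMatrix B) =
        φ.mapMatrix ((σ : K →+* K).mapMatrix B) := fun B => by
      ext a b
      exact congrArg (fun k : K →+* L => k (B a b)) hcomm
    refine h'.spl (i := j.comp i) hρ' (P := φ.mapMatrix P) (fun x => ?_) (e := j e) ?_ ?_ hs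
    · have := congrArg φ.mapMatrix (hP.2 x)
      rw [map_mul, map_mul] at this
      rw [RingHom.comp_apply, hcommM]
      exact this
    · rw [map_ne_zero_iff _ j.injective]
      rintro rfl; simp at hc
    · rw [hcommM, ← map_mul, hPc, mapMatrix_smul, map_one]
      congr 1
      exact congrArg (fun k : A →+* L => k e) hφ

/-- Over a biquadratic extension, two-torsion allows commuting descent data. -/
theorem IsRep.exists_commuting {E : Type u} [Field E] {i : F →+* E} {ρ : X →+* Matrix ι ι E}
    (hι : Fintype.card ι ^ 2 = Module.finrank F X)
    {Ψ : X → X → Matrix (ι × ι) (ι × ι) F} (hΨ : IsKr.{u} Ψ)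
    (h : IsRep i ρ) {σ τ : E →+* E} (hσ : ∀ z, σ (σ z) = z) (hτ : ∀ z, τ (τ z) = z)
    (hστ : ∀ z, σ (τ z) = τ (σ z)) (hσi : σ.comp i = i) (hτi : τ.comp i = i) {u v : E}
    (hu : u ≠ 0) (hσu : σ u = -u) (hτu : τ u = u) (hv : v ≠ 0) (hτv : τ v = -v) :
    ∃ P R : Matrix ι ι E, Itw ρ P (σ.mapMatrix.comp ρ) ∧ Itw ρ R (τ.mapMatrix.comp ρ) ∧
      P * σ.mapMatrix R = R * τ.mapMatrix P ∧
      ∃ e g : E, e ≠ 0 ∧ g ≠ 0 ∧ P * σ.mapMatrix P = e • 1 ∧ R * τ.mapMatrix R = g • 1 ∧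
        σ e = e ∧ τ e = e ∧ σ g = g ∧ τ g = g := by
  have := nonempty_of_card_sq hι
  have hστM : ∀ B : Matrix ι ι E, σ.mapMatrix (τ.mapMatrix B) = τ.mapMatrix (σ.mapMatrix B) :=
    fun B => by ext a b; exact hστ _
  have hστQ : ∀ B : Matrix (ι × ι) (ι × ι) E,
      σ.mapMatrix (τ.mapMatrix B) = τ.mapMatrix (σ.mapMatrix B) :=
    fun B => by ext a b; exact hστ _
  -- the two relations satisfied by the norms when the commutation factor is `γ`
  have key : ∀ P R γ α β, Itw ρ P (σ.mapMatrix.comp ρ) → Itw ρ R (τ.mapMatrix.comp ρ) →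
      P * σ.mapMatrix R = γ • (R * τ.mapMatrix P) → P * σ.mapMatrix P = α • 1 →
      R * τ.mapMatrix R = β • 1 → γ * σ γ * τ α = α ∧ γ * τ γ * β = σ β := by
    intro P R γ α β hP hR hγ hα hβ
    constructor
    · refine smul_left_cancel_isUnit hR.1 ?_
      have h1 : P * σ.mapMatrix (P * σ.mapMatrix R) = α • R := by
        rw [map_mul, mapMatrix_involution hσ, ← mul_assoc, hα, smul_mul_assoc, one_mul]
      rw [hγ, mapMatrix_smul, map_mul, mul_smul_comm, ← mul_assoc, hγ, smul_mul_assoc, mul_assoc,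
        hστM, ← map_mul, hα, mapMatrix_smul, map_one, mul_smul_comm, mul_one, smul_smul,
        smul_smul] at h1
      rw [← h1]
      ring_nf
    · refine smul_left_cancel_isUnit hP.1 ?_
      have h1 : R * τ.mapMatrix (γ • (R * τ.mapMatrix P)) = (τ γ * β) • P := by
        rw [mapMatrix_smul, map_mul, mapMatrix_involution hτ, mul_smul_comm, ← mul_assoc, hβ,
          smul_mul_assoc, one_mul, smul_smul]
      rw [← hγ, map_mul, ← mul_assoc] at h1
      have h2 : P * σ.mapMatrix (R * τ.mapMatrix R) = σ β • P := by
        rw [hβ, mapMatrix_smul, map_one, mul_smul_comm, mul_one]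
      rw [← h2, map_mul, ← mul_assoc, hγ, hστM, smul_mul_assoc, h1, smul_smul]
      ring_nf
  obtain ⟨P, hP⟩ := h.exists_itw (isRep_of_fixed h hσi) hι
  obtain ⟨R, hR⟩ := h.exists_itw (isRep_of_fixed h hτi) hι
  obtain ⟨α, hα0, hα, hσα⟩ := h.exists_norm hι hσ hP
  obtain ⟨β, hβ0, hβ, hτβ⟩ := h.exists_norm hι hτ hR
  obtain ⟨γ, hγ0, hγ⟩ : ∃ γ : E, γ ≠ 0 ∧ P * σ.mapMatrix R = γ • (R * τ.mapMatrix P) := by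
    refine h.itw_unique hι (hP.trans (hR.map σ)) ?_
    have := hR.trans (hP.map τ)
    rwa [show τ.mapMatrix.comp (σ.mapMatrix.comp ρ) = σ.mapMatrix.comp (τ.mapMatrix.comp ρ) from
      RingHom.ext fun x => (hστM _).symm] at this
  obtain ⟨k1, k2⟩ := key P R γ α β hP hR hγ hα hβ
  obtain ⟨Q, hQ⟩ := hΨ.exists_kr h
  have hQσ := hQ.map σ
  have hQτ := hQ.map τ
  rw [hσi] at hQσ
  rw [hτi] at hQτ
  obtain ⟨x, hx0, hx⟩ := hΨ.exists_smul hQ hQσ hP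
  obtain ⟨y, hy0, hy⟩ := hΨ.exists_smul hQ hQτ hR
  have h1 : ((1 : Matrix ι ι E) ⊗ₖ (1 : Matrix ι ι E)) * σ.mapMatrix (σ.mapMatrix Q) = (1 : E) • Q := by
    rw [Matrix.one_kronecker_one, one_mul, one_smul, mapMatrix_involution hσ]
  have h2 : ((1 : Matrix ι ι E) ⊗ₖ (1 : Matrix ι ι E)) * τ.mapMatrix (τ.mapMatrix Q) = (1 : E) • Q := by
    rw [Matrix.one_kronecker_one, one_mul, one_smul, mapMatrix_involution hτ]
  have ex := kr_mul hQ.1 hx hx h1 hα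
  have ey := kr_mul hQ.1 hy hy h2 hβ
  obtain ⟨w, hw⟩ : ∃ w : E, ((R * τ.mapMatrix P) ⊗ₖ (R * τ.mapMatrix P)) *
      τ.mapMatrix (σ.mapMatrix Q) = w • Q := by
    have hx' := congrArg τ.mapMatrix hx
    rw [map_mul, mapMatrix_smul, mapMatrix_kronecker] at hx'
    exact ⟨τ x * y, by rw [Matrix.mul_kronecker_mul, mul_assoc, hx', mul_smul_comm, hy, smul_smul]⟩
  have ew := kr_mul hQ.1 hy hx hw (c := 1) (by rw [one_smul])
  have eg := kr_mul (g := σ) hQ.1 hx hy (by rw [hστQ]; exact hw) hγ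
  obtain ⟨z, hz0, hz⟩ := hilbert90_involution σ hσu hu (x := x / α) (by
    rw [map_div₀, hσα]; field_simp; linear_combination -ex)
  obtain ⟨z', hz0', hz'⟩ := hilbert90_involution τ hτv hv (x := y / β) (by
    rw [map_div₀, hτβ]; field_simp; linear_combination -ey)
  obtain ⟨ζ, hζ0, hζ⟩ : ∃ ζ, ζ ≠ 0 ∧ ζ = z / z' := ⟨_, div_ne_zero hz0 hz0', rfl⟩
  have hinj : ∀ {g : E →+* E} {a : E}, a ≠ 0 → g a ≠ 0 := fun {g a} ha =>
    (map_ne_zero_iff _ g.injective).2 ha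
  have hμ : σ (γ * σ ζ / ζ) * τ (γ * σ ζ / ζ) = 1 := by
    have ez : x = α * z / σ z := by
      have := hinj (g := σ) hz0
      rw [eq_div_iff this]; rw [div_mul_eq_mul_div, div_eq_iff hα0] at hz; rw [hz, mul_comm]
    have ez' : y = β * z' / τ z' := by
      have := hinj (g := τ) hz0'
      rw [eq_div_iff this]; rw [div_mul_eq_mul_div, div_eq_iff hβ0] at hz'; rw [hz', mul_comm]
    have n1 := hinj (g := σ) hz0
    have n2 := hinj (g := τ) hz0
    have n3 := hinj (g := σ) hz0'
    have n4 := hinj (g := τ) hz0'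
    have n5 := hinj (g := τ) n1
    have n6 := hinj (g := τ) n3
    have n7 := hinj (g := τ) hα0
    rw [one_pow, one_mul] at ew
    rw [hζ]
    rw [ew, ez, ez'] at eg
    simp only [map_div₀, map_mul, hσ, hστ] at eg ⊢
    rw [← k2] at eg
    nth_rewrite 2 [← k1] at eg
    field_simp at eg ⊢
    linear_combination -eg
  obtain ⟨η, hη0, hη⟩ := hilbert90_involution (σ.comp τ)
    (by rw [RingHom.comp_apply, hτu, hσu]) hu (x := γ * σ ζ / ζ) (by
      have := congrArg σ hμ
      rwa [map_mul, hσ, map_one] at this)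
  simp only [RingHom.comp_apply] at hη
  have hc : (η⁻¹ • P) * σ.mapMatrix ((ζ * τ η) • R) = ((ζ * τ η) • R) * τ.mapMatrix (η⁻¹ • P) := by
    have := hinj (g := τ) hη0
    rw [mapMatrix_smul, mapMatrix_smul, smul_mul_smul_comm, smul_mul_smul_comm, hγ, smul_smul]
    congr 1
    rw [map_mul, map_inv₀]
    field_simp
    rw [div_mul_eq_mul_div, div_eq_iff hζ0] at hη
    linear_combination hη
  have hP' := hP.smul (inv_ne_zero hη0)
  have hR' := hR.smul (mul_ne_zero hζ0 (hinj (g := τ) hη0))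
  obtain ⟨e, he0, he, hσe⟩ := h.exists_norm hι hσ hP'
  obtain ⟨g, hg0, hg, hτg⟩ := h.exists_norm hι hτ hR'
  obtain ⟨k3, k4⟩ := key _ _ 1 e g hP' hR' (by rw [one_smul]; exact hc) he hg
  exact ⟨_, _, hP', hR', hc, e, g, he0, hg0, he, hg, hσe, by simpa using k3, by simpa using k4.symm,
    hτg⟩

end QuadraticSteps

section BiquadraticStep

universe u

variable {F X : Type*} [Field F] [Ring X] [Algebra F X]
  {ι : Type*} [Fintype ι] [DecidableEq ι]

lemma mapMatrix_comm {B E₁ E₂ D : Type*} [Field B] [Field E₁] [Field E₂] [Field D]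
    {f : E₁ →+* D} {g : B →+* E₁} {f' : E₂ →+* D} {g' : B →+* E₂} (h : f.comp g = f'.comp g')
    (A : Matrix ι ι B) : f.mapMatrix (g.mapMatrix A) = f'.mapMatrix (g'.mapMatrix A) := by
  ext a b
  exact congrArg (fun k : B →+* D => k (A a b)) h

lemma spl_of_semilinear {A E M E₁ : Type*} [Field A] [Field E] [Field M] [CharZero M] [Field E₁]
    [Algebra M E₁] {c : M} {r₁ : E₁} {σ₁ : E₁ ≃ₐ[M] E₁} (hQ : IsQuad M E₁ c r₁ σ₁) {i : F →+* A}
    {a : A →+* E} {j : A →+* M} {φ : E →+* E₁} (hφ : φ.comp a = (algebraMap M E₁).comp j)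
    {θ : E →+* E} (hθ : (σ₁ : E₁ →+* E₁).comp φ = φ.comp θ) {ρ : X →+* Matrix ι ι E}
    (hρ : IsRep (a.comp i) ρ) {T : Matrix ι ι E} (hT : Itw ρ T (θ.mapMatrix.comp ρ)) {e : A}
    (he0 : e ≠ 0) (he : T * θ.mapMatrix T = a e • 1) (hs : Sol M c (j e)) :
    Spl ι X (j.comp i) := by
  have hρ' := hρ.comp φ
  rw [← RingHom.comp_assoc, hφ, RingHom.comp_assoc] at hρ'
  refine hQ.spl (i := j.comp i) hρ' (P := φ.mapMatrix T) (fun x => ?_) (e := j e)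
    ((map_ne_zero_iff _ j.injective).2 he0) ?_ hs
  · have := congrArg φ.mapMatrix (hT.2 x)
    rw [map_mul, map_mul] at this
    rw [RingHom.comp_apply, mapMatrix_comm hθ]
    exact this
  · rw [mapMatrix_comm hθ, ← map_mul, he, mapMatrix_smul, map_one]
    congr 1
    exact congrArg (fun k : A →+* E₁ => k e) hφ

lemma spl_of_two_steps {A E M E₁ E₂ : Type*} [Field A] [Field E] [Field M] [CharZero M] [Field E₁]
    [Algebra M E₁] [Field E₂] [Algebra E₁ E₂] {i : F →+* A} {j : A →+* M} {d t e g : A}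
    {r₁ : E₁} {σ₁ : E₁ ≃ₐ[M] E₁}
    (h₁ : IsQuad M E₁ (j d) r₁ σ₁) {s₂ : E₂} {τ₂ : E₂ ≃ₐ[E₁] E₂}
    (h₂ : IsQuad E₁ E₂ (algebraMap M E₁ (j t)) s₂ τ₂) {a : A →+* E} {φ : E →+* E₂}
    (hφ : φ.comp a = (algebraMap E₁ E₂).comp ((algebraMap M E₁).comp j)) {σ τ : E →+* E}
    {σ₂ : E₂ →+* E₂} (hσ₂ : σ₂.comp (algebraMap E₁ E₂) = (algebraMap E₁ E₂).comp (σ₁ : E₁ →+* E₁))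
    (hσs : σ₂ s₂ = s₂) (hσφ : σ₂.comp φ = φ.comp σ)
    (hτφ : (τ₂ : E₂ →+* E₂).comp φ = φ.comp τ) {ρ : X →+* Matrix ι ι E}
    (hρ : IsRep (a.comp i) ρ) {P R : Matrix ι ι E} (hP : Itw ρ P (σ.mapMatrix.comp ρ))
    (hR : Itw ρ R (τ.mapMatrix.comp ρ)) (hPR : P * σ.mapMatrix R = R * τ.mapMatrix P)
    (he0 : e ≠ 0) (hg0 : g ≠ 0) (he : P * σ.mapMatrix P = a e • 1)
    (hg : R * τ.mapMatrix R = a g • 1) (hd : Sol M (j d) (j e)) (ht : Sol M (j t) (j g)) :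
    Spl ι X (j.comp i) := by
  have : CharZero E₁ := h₁.charZeroL
  have hσa : ∀ z, σ₂ (algebraMap E₁ E₂ z) = algebraMap E₁ E₂ (σ₁ z) := fun z =>
    congrArg (fun k : E₁ →+* E₂ => k z) hσ₂
  have hφa : ∀ z, φ (a z) = algebraMap E₁ E₂ (algebraMap M E₁ (j z)) := fun z =>
    congrArg (fun k : A →+* E₂ => k z) hφ
  have hσσ : ∀ z, σ₂ (σ₂ z) = z := by
    have : σ₂.comp σ₂ = RingHom.id E₂ := by
      apply h₂.hom_ext
      · ext z
        simp [hσa, h₁.conj_conj]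
      · simp [hσs]
    exact fun z => congrArg (fun k : E₂ →+* E₂ => k z) this
  have hστ : σ₂.comp (τ₂ : E₂ →+* E₂) = (τ₂ : E₂ →+* E₂).comp σ₂ := by
    apply h₂.hom_ext
    · ext z
      simp [hσa]
    · simp [hσs, h₂.conj]
  obtain ⟨p, q, hpq⟩ := ht
  obtain ⟨z, hz⟩ : ∃ z, z = algebraMap E₁ E₂ (algebraMap M E₁ p) +
    algebraMap E₁ E₂ (algebraMap M E₁ q) * s₂ := ⟨_, rfl⟩
  have hσz : σ₂ z = z := by simp [hz, hσa, hσs]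
  have hzz : z * τ₂ z = φ (a g) := by
    rw [hφa, ← hpq]
    simp only [hz, map_add, map_mul, AlgEquiv.commutes, h₂.conj, map_sub, map_pow]
    linear_combination (-(algebraMap E₁ E₂ (algebraMap M E₁ q)) ^ 2) * h₂.sq
  have hzz0 : z * τ₂ z ≠ 0 := by
    rw [hzz]
    exact (map_ne_zero_iff _ φ.injective).2 ((map_ne_zero_iff _ a.injective).2 hg0)
  have hρ' := hρ.comp φ
  rw [← RingHom.comp_assoc, hφ, RingHom.comp_assoc] at hρ'
  have hP' := hP.map φ
  have hR' := (hR.map φ).smul (inv_ne_zero (left_ne_zero_of_mul hzz0))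
  obtain ⟨P₁, hP₁⟩ : ∃ P₁, P₁ = φ.mapMatrix P := ⟨_, rfl⟩
  obtain ⟨R₁, hR₁⟩ : ∃ R₁, R₁ = z⁻¹ • φ.mapMatrix R := ⟨_, rfl⟩
  have hR₁1 : R₁ * (τ₂ : E₂ →+* E₂).mapMatrix R₁ = 1 := by
    rw [hR₁, mapMatrix_smul, mapMatrix_comm hτφ, smul_mul_smul_comm, ← map_mul, hg,
      mapMatrix_smul, map_one, ← hzz, smul_smul]
    simp only [RingHom.coe_coe, map_inv₀]
    rw [← mul_inv, inv_mul_cancel₀ hzz0, one_smul]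
  have hP₁e : P₁ * σ₂.mapMatrix P₁ = φ (a e) • 1 := by
    rw [hP₁, mapMatrix_comm hσφ, ← map_mul, he, mapMatrix_smul, map_one]
  have hPR₁ : P₁ * σ₂.mapMatrix R₁ = R₁ * (τ₂ : E₂ →+* E₂).mapMatrix P₁ := by
    rw [hP₁, hR₁, mapMatrix_smul, mapMatrix_comm hτφ, mapMatrix_comm hσφ, map_inv₀, hσz,
      mul_smul_comm, smul_mul_assoc, ← map_mul, hPR, map_mul]
  have hcP : ∀ x, φ.mapMatrix (ρ x) * P₁ = P₁ * σ₂.mapMatrix (φ.mapMatrix (ρ x)) := fun x => by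
    rw [mapMatrix_comm hσφ, hP₁]; exact hP'.2 x
  obtain ⟨Q, ρM, hQ, hρM, hQρ⟩ := h₂.descend (i := ((algebraMap M E₁).comp j).comp i) hρ' (P := R₁)
    hR₁1 (fun x => by
      rw [hR₁, RingHom.comp_apply, mapMatrix_comm hτφ]; exact hR'.2 x)
  obtain ⟨T, hT⟩ : ∃ T, Q.val * T = P₁ * σ₂.mapMatrix Q.val :=
    ⟨Q⁻¹.val * (P₁ * σ₂.mapMatrix Q.val), by rw [← mul_assoc, Q.mul_inv, one_mul]⟩
  have hTτ : (τ₂ : E₂ →+* E₂).mapMatrix T = T := by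
    rw [← Units.mul_right_inj Q, hT]
    have := congrArg (R₁ * (τ₂ : E₂ →+* E₂).mapMatrix ·) hT
    simp only [map_mul] at this
    rw [← mul_assoc, hQ, ← mul_assoc, ← hPR₁, ← mapMatrix_comm hστ, mul_assoc, ← map_mul, hQ] at this
    exact this
  choose T₀ hT₀ using fun j k => h₂.mem_of_fixed (z := T j k) (congrFun (congrFun hTτ j) k)
  have hTT : (algebraMap E₁ E₂).mapMatrix (Matrix.of T₀) = T := by
    ext j k; exact hT₀ j k
  have hinj := mapMatrix_injective (ι := ι) (algebraMap E₁ E₂)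
  refine h₁.spl (i := j.comp i) hρM (P := Matrix.of T₀) (fun x => hinj ?_) (e := j e)
    ((map_ne_zero_iff _ j.injective).2 he0) (hinj ?_) hd
  · rw [map_mul, map_mul, ← mapMatrix_comm hσ₂, hTT, ← Units.mul_right_inj Q, ← mul_assoc, hQρ,
      mul_assoc, hT, ← mul_assoc, RingHom.comp_apply, hcP, mul_assoc, ← map_mul]
    have := hQρ x
    rw [RingHom.comp_apply] at this
    rw [← this, map_mul, ← mul_assoc, ← hT, mul_assoc]
  · rw [map_mul, ← mapMatrix_comm hσ₂, hTT, ← Units.mul_right_inj Q, ← mul_assoc, hT, mul_assoc,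
      ← map_mul, hT, map_mul, mapMatrix_involution hσσ, ← mul_assoc, hP₁e, mapMatrix_smul, map_one,
      hφa, smul_mul_assoc, one_mul, mul_smul_comm, mul_one]

variable [FiniteDimensional F X] [Algebra.IsCentral F X] [IsSimpleRing X]

theorem exists_spl_of_sol_sol (hι : Fintype.card ι ^ 2 = Module.finrank F X)
    {Ψ : X → X → Matrix (ι × ι) (ι × ι) F} (hΨ : IsKr.{u} Ψ)
    {A K E : Type u} [Field A] [CharZero A] [Field K] [Algebra A K] [Field E] [Algebra K E]
    {d t : A} {r : K} {σ₀ : K ≃ₐ[A] K} (hK : IsQuad A K d r σ₀) {s : E} {τ : E ≃ₐ[K] E}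
    (hE : IsQuad K E (algebraMap A K t) s τ) {i : F →+* A}
    (hS : Spl ι X (((algebraMap K E).comp (algebraMap A K)).comp i)) :
    ∃ e g : A, e ≠ 0 ∧ g ≠ 0 ∧ ∀ (M : Type u) [Field M] (j : A →+* M), Sol M (j d) (j e) →
      Sol M (j t) (j g) → Spl ι X (j.comp i) := by
  obtain ⟨ρ, hρ⟩ := hS
  have : CharZero K := hK.charZeroL
  obtain ⟨σ, hσ, hσs⟩ : ∃ σ : E →+* E, σ.comp (algebraMap K E) =
      (algebraMap K E).comp (σ₀ : K →+* K) ∧ σ s = s := hE.exists_lift _ (m := s) (by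
    rw [hE.sq]; simp)
  have hσa : ∀ z, σ (algebraMap K E z) = algebraMap K E (σ₀ z) := fun z =>
    congrArg (fun k : K →+* E => k z) hσ
  have hσσ : ∀ z, σ (σ z) = z := by
    have : σ.comp σ = RingHom.id E := by
      apply hE.hom_ext
      · ext z
        simp [hσa, hK.conj_conj]
      · simp [hσs]
    exact fun z => congrArg (fun k : E →+* E => k z) this
  have hστ : σ.comp (τ : E →+* E) = (τ : E →+* E).comp σ := by
    apply hE.hom_ext
    · ext z
      simp [hσa]
    · simp [hσs, hE.conj]
  have hστM : ∀ B : Matrix ι ι E, σ.mapMatrix ((τ : E →+* E).mapMatrix B) =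
      (τ : E →+* E).mapMatrix (σ.mapMatrix B) := fun B => mapMatrix_comm hστ B
  obtain ⟨P, R, hP, hR, hPR, e', g', he0, hg0, he, hg, hσe, hτe, hσg, hτg⟩ :=
    hρ.exists_commuting hι hΨ (σ := σ) (τ := (τ : E →+* E)) hσσ hE.conj_conj
      (fun z => congrArg (fun k : E →+* E => k z) hστ) (by ext z; simp [hσa]) (by ext z; simp)
      (u := algebraMap K E r) (v := s)
      (by simpa using hK.ne) (by rw [hσa, hK.conj, map_neg]) (by simp) hE.ne (by simp [hE.conj])
  have hfix : ∀ z : E, σ z = z → τ z = z → ∃ y : A, algebraMap K E (algebraMap A K y) = z := by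
    intro z h1 h2
    obtain ⟨y, rfl⟩ := hE.mem_of_fixed h2
    obtain ⟨x, rfl⟩ := hK.mem_of_fixed (z := y) ((algebraMap K E).injective (by rw [← hσa, h1]))
    exact ⟨x, rfl⟩
  obtain ⟨e, rfl⟩ := hfix e' hσe hτe
  obtain ⟨g, rfl⟩ := hfix g' hσg hτg
  have he0' : e ≠ 0 := by rintro rfl; simp at he0
  have hg0' : g ≠ 0 := by rintro rfl; simp at hg0
  refine ⟨e, g, he0', hg0', fun M _ j hsd hst => ?_⟩
  have : CharZero M := charZero_of_injective_ringHom j.injective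
  by_cases hsq : IsSquare (j d)
  · obtain ⟨w, hw⟩ := hsq
    obtain ⟨φ, hφ, -⟩ := hK.exists_lift j (m := w) (by rw [hw, pow_two])
    have hφa : ∀ z, φ (algebraMap A K z) = j z := fun z => congrArg (fun k : A →+* M => k z) hφ
    by_cases hsq' : IsSquare (j t)
    · obtain ⟨w', hw'⟩ := hsq'
      obtain ⟨ψ, hψ, -⟩ := hE.exists_lift φ (m := w') (by rw [hφa, hw', pow_two])
      have := Spl.map ⟨ρ, hρ⟩ ψ
      rwa [← RingHom.comp_assoc, ← RingHom.comp_assoc, hψ, hφ] at this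
    · obtain ⟨L, _, _, _, r₁, σ₁, h₁⟩ := exists_isQuad hsq'
      obtain ⟨ψ, hψ, hψs⟩ : ∃ ψ : E →+* L, ψ.comp (algebraMap K E) = (algebraMap M L).comp φ ∧
        ψ s = r₁ := hE.exists_lift _ (m := r₁) (by rw [h₁.sq, RingHom.comp_apply, hφa])
      have hψa : ∀ z, ψ (algebraMap K E z) = algebraMap M L (φ z) := fun z =>
        congrArg (fun k : K →+* L => k z) hψ
      refine spl_of_semilinear h₁ (φ := ψ) (by ext z; simp [hψa, hφa]) (θ := (τ : E →+* E)) ?_ hρ hR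
        hg0' hg hst
      apply hE.hom_ext
      · ext z; simp [hψa]
      · simp [hψs, hE.conj, h₁.conj]
  obtain ⟨E₁, _, _, _, r₁, σ₁, h₁⟩ := exists_isQuad hsq
  have : CharZero E₁ := h₁.charZeroL
  obtain ⟨φ, hφ, hφr⟩ : ∃ φ : K →+* E₁, φ.comp (algebraMap A K) = (algebraMap M E₁).comp j ∧
    φ r = r₁ := hK.exists_lift _ (m := r₁) h₁.sq
  have hφa : ∀ z, φ (algebraMap A K z) = algebraMap M E₁ (j z) := fun z =>
    congrArg (fun k : A →+* E₁ => k z) hφ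
  have hφσ : (σ₁ : E₁ →+* E₁).comp φ = φ.comp (σ₀ : K →+* K) := by
    apply hK.hom_ext
    · ext z; simp [hφa]
    · simp [hφr, hK.conj, h₁.conj]
  have hφσ' : ∀ z, φ (σ₀ z) = σ₁ (φ z) := fun z =>
    (congrArg (fun k : K →+* E₁ => k z) hφσ).symm
  by_cases hsq' : IsSquare (algebraMap M E₁ (j t))
  · obtain ⟨w, hw⟩ := hsq'
    obtain ⟨ψ, hψ, hψs⟩ := hE.exists_lift φ (m := w) (by rw [hφa, hw, pow_two])
    have hψa : ∀ z, ψ (algebraMap K E z) = φ z := fun z => congrArg (fun k : K →+* E₁ => k z) hψ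
    have hw2 : (σ₁ w - w) * (σ₁ w + w) = 0 := by
      have := congrArg σ₁ hw
      rw [AlgEquiv.commutes, map_mul, hw] at this
      linear_combination -this
    rcases mul_eq_zero.1 hw2 with hw2 | hw2
    · have hw3 : σ₁ w = w := by linear_combination hw2
      refine spl_of_semilinear h₁ (φ := ψ) (by ext z; simp [hψa, hφa]) (θ := σ) ?_ hρ hP
        he0' he hsd
      apply hE.hom_ext
      · ext z; simp [hψa, hσa, hφσ']
      · simp [hψs, hσs, hw3]
    · have hw3 : σ₁ w = -w := by linear_combination hw2
      obtain ⟨p, q, hpq⟩ := h₁.span w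
      have hwq : w = algebraMap M E₁ q * r₁ := by
        have h3 := hw3
        rw [hpq] at h3
        simp only [map_add, map_mul, AlgEquiv.commutes, h₁.conj] at h3
        have : algebraMap M E₁ p = 0 := by linear_combination h3 / 2
        rw [hpq, this, zero_add]
      have hjt : j t = q ^ 2 * j d := by
        apply (algebraMap M E₁).injective
        rw [hw, hwq, map_mul, map_pow, ← h₁.sq]
        ring
      have hst' : Sol M (j d) (j g) := by
        obtain ⟨x, y, hxy⟩ := hst
        exact ⟨x, q * y, by rw [← hxy, hjt]; ring⟩
      have hs : Sol M (j d) (j (e * g)) := by rw [map_mul]; exact hsd.mul hst'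
      refine spl_of_semilinear h₁ (φ := ψ) (by ext z; simp [hψa, hφa])
        (θ := σ.comp (τ : E →+* E)) ?_ hρ (T := P * σ.mapMatrix R) (hP.trans (hR.map σ))
        (mul_ne_zero he0' hg0') ?_ hs
      · apply hE.hom_ext
        · ext z; simp [hψa, hσa, hφσ']
        · simp [hψs, hσs, hw3, hE.conj]
      · change P * σ.mapMatrix R * (σ.mapMatrix ((τ : E →+* E).mapMatrix (P * σ.mapMatrix R))) = _
        rw [map_mul (τ : E →+* E).mapMatrix, ← hστM R, map_mul σ.mapMatrix,
          mapMatrix_involution hσσ, hPR, hστM, ← mul_assoc, mul_assoc R, ← map_mul, he, mapMatrix_smul,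
          map_one, mul_smul_comm, mul_one,
          smul_mul_assoc, hg, smul_smul]
        simp
  · obtain ⟨E₂, _, _, _, s₂, τ₂, h₂⟩ := exists_isQuad hsq'
    obtain ⟨ψ, hψ, hψs⟩ : ∃ ψ : E →+* E₂, ψ.comp (algebraMap K E) = (algebraMap E₁ E₂).comp φ ∧
      ψ s = s₂ := hE.exists_lift _ (m := s₂) (by rw [h₂.sq, RingHom.comp_apply, hφa])
    have hψa : ∀ z, ψ (algebraMap K E z) = algebraMap E₁ E₂ (φ z) := fun z =>
      congrArg (fun k : K →+* E₂ => k z) hψ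
    obtain ⟨σ₂, hσ₂, hσs₂⟩ : ∃ σ₂ : E₂ →+* E₂, σ₂.comp (algebraMap E₁ E₂) =
        (algebraMap E₁ E₂).comp (σ₁ : E₁ →+* E₁) ∧ σ₂ s₂ = s₂ := h₂.exists_lift _ (m := s₂) (by
      rw [h₂.sq]; simp)
    have hσ₂a : ∀ z, σ₂ (algebraMap E₁ E₂ z) = algebraMap E₁ E₂ (σ₁ z) := fun z =>
      congrArg (fun k : E₁ →+* E₂ => k z) hσ₂
    refine spl_of_two_steps h₁ h₂ (φ := ψ) (by ext z; simp [hψa, hφa]) hσ₂ hσs₂ (σ := σ)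
      (τ := (τ : E →+* E)) ?_ ?_ hρ hP hR hPR he0' hg0' he hg hsd hst
    · apply hE.hom_ext
      · ext z; simp [hψa, hσa, hφσ', hσ₂a]
      · simp [hψs, hσs, hσs₂]
    · apply hE.hom_ext
      · ext z; simp [hψa]
      · simp [hψs, hE.conj, h₂.conj]

end BiquadraticStep

section GaloisDescent

universe u

open scoped Kronecker

variable {F X : Type*} [Field F] [Ring X] [Algebra F X]
  {ι : Type*} [Fintype ι] [DecidableEq ι]

/-- Hilbert 90 for the general linear group. -/
lemma exists_mul_map_eq_of_cocycle {N E : Type*} [Field N] [Field E] [Algebra N E]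
    [FiniteDimensional N E] (P : (E ≃ₐ[N] E) → Matrix ι ι E) (hP : ∀ g, IsUnit (P g))
    (hc : ∀ g h, P g * (g : E →+* E).mapMatrix (P h) = P (g * h)) :
    ∃ Q : (Matrix ι ι E)ˣ, ∀ g, P g * (g : E →+* E).mapMatrix Q.val = Q := by
  let b : (ι → E) → ι → E := fun v => ∑ g, (P g).mulVec (fun k => g (v k))
  have hb : Submodule.span E (Set.range b) = ⊤ := by
    by_contra hne
    obtain ⟨f, hf, hle⟩ := Submodule.exists_le_ker_of_lt_top _ (lt_top_iff_ne_top.2 hne)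
    apply hf
    have h0 : ∀ v, f (b v) = 0 := fun v => hle (Submodule.subset_span ⟨v, rfl⟩)
    have hli := linearIndependent_monoidHom E E
    have key : ∀ k, f ((P 1).mulVec (Pi.single k 1)) = 0 := by
      intro k
      let e : (E ≃ₐ[N] E) → (E →* E) := fun g => (g : E →* E)
      have he : Function.Injective e := fun g h hgh => by
        ext z
        exact congrArg (fun q : E →* E => q z) hgh
      have hli' := hli.comp e he
      rw [Fintype.linearIndependent_iff] at hli'
      refine hli' (fun g => f ((P g).mulVec (Pi.single k 1))) ?_ 1
      ext c
      have := h0 (Pi.single k c)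
      simp only [b, map_sum] at this
      rw [Finset.sum_apply]
      refine Eq.trans ?_ this
      refine Finset.sum_congr rfl fun g _ => ?_
      have : (fun l => g (Pi.single (M := fun _ => E) k c l)) = g c • Pi.single k (1 : E) := by
        ext l
        by_cases hl : l = k
        · subst hl; simp
        · simp [hl]
      rw [this, Matrix.mulVec_smul, map_smul]
      simp [e, mul_comm]
    have hfz : ∀ v, f ((P 1).mulVec v) = 0 := by
      intro v
      have : f ∘ₗ (P 1).mulVecLin = 0 := by
        refine (Pi.basisFun E ι).ext fun k => ?_
        simpa using key k
      exact congrArg (fun q => q v) this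
    ext k
    obtain ⟨U, hU⟩ := hP 1
    have := hfz (U⁻¹.val.mulVec (Pi.single k 1))
    rw [Matrix.mulVec_mulVec, ← hU, U.mul_inv, Matrix.one_mulVec] at this
    simpa using this
  obtain ⟨κ, a, -, hspan, hind⟩ := exists_linearIndependent' E b
  rw [hb] at hspan
  let B := Module.Basis.mk hind hspan.ge
  have : Finite κ := hind.finite
  have : Fintype κ := Fintype.ofFinite κ
  have hcard : Fintype.card ι = Fintype.card κ := by
    rw [← Module.finrank_eq_card_basis B, Module.finrank_fintype_fun_eq_card]
  let eq : ι ≃ κ := Fintype.equivOfCardEq hcard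
  let Q : Matrix ι ι E := Matrix.of fun j k => b (a (eq k)) j
  have hQ : IsUnit Q := by
    have hQ : (Pi.basisFun E ι).toMatrix (B.reindex eq.symm) = Q := by
      ext j k
      simp [Module.Basis.toMatrix_apply, B, Q]
    rw [← hQ]
    let := (Pi.basisFun E ι).invertibleToMatrix (B.reindex eq.symm)
    exact isUnit_of_invertible _
  refine ⟨hQ.unit, fun τ => ?_⟩
  rw [hQ.unit_spec]
  have hcol : ∀ v, (P τ).mulVec (fun k => τ (b v k)) = b v := by
    intro v
    have : (fun k => τ (b v k)) =
        ∑ g : E ≃ₐ[N] E, ((τ : E →+* E).mapMatrix (P g)).mulVec fun k => (τ * g) (v k) := by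
      ext k
      simp only [b, Finset.sum_apply, map_sum]
      refine Finset.sum_congr rfl fun g _ => ?_
      simp [Matrix.mulVec, dotProduct]
    rw [this, Matrix.mulVec_sum]
    simp only [Matrix.mulVec_mulVec, hc]
    exact Fintype.sum_equiv (Equiv.mulLeft τ) _ _ fun g => rfl
  ext j k
  exact congrFun (hcol (a (eq k))) j

lemma spl_of_cocycle {N E : Type*} [Field N] [Field E] [Algebra N E]
    [FiniteDimensional N E] [IsGalois N E] {i : F →+* N} {ρ : X →+* Matrix ι ι E}
    (hρ : IsRep ((algebraMap N E).comp i) ρ) (P : (E ≃ₐ[N] E) → Matrix ι ι E)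
    (hP : ∀ g, Itw ρ (P g) ((g : E →+* E).mapMatrix.comp ρ))
    (hc : ∀ g h, P g * (g : E →+* E).mapMatrix (P h) = P (g * h)) : Spl ι X i := by
  obtain ⟨Q, hQ⟩ := exists_mul_map_eq_of_cocycle P (fun g => (hP g).1) hc
  let ρ' : X →+* Matrix ι ι E :=
    { toFun := fun x => Q⁻¹.val * ρ x * Q
      map_one' := by simp
      map_mul' := fun x y => by
        rw [map_mul]
        calc _ = Q⁻¹.val * ρ x * 1 * (ρ y * Q) := by simp only [mul_assoc, one_mul]
          _ = _ := by rw [← Q.mul_inv]; simp only [mul_assoc]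
      map_zero' := by simp
      map_add' := fun x y => by simp [mul_add, add_mul] }
  have hρ' : IsRep ((algebraMap N E).comp i) ρ' := by
    intro a
    change Q⁻¹.val * ρ _ * Q = _
    rw [hρ a]
    simp
  have e1 : ∀ x, Q.val * ρ' x = ρ x * Q.val := by
    intro x
    change Q.val * (Q⁻¹.val * ρ x * Q.val) = _
    rw [← mul_assoc, ← mul_assoc, Q.mul_inv, one_mul]
  clear_value ρ'
  obtain ⟨ρN, h, -⟩ := hρ'.descend (φ := algebraMap N E) (i := i) fun x j k =>
    (IsGalois.mem_range_algebraMap_iff_fixed (F := N) (ρ' x j k)).2 fun g => by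
      have : (g : E →+* E).mapMatrix (ρ' x) = ρ' x := (Units.mul_right_inj Q).1
        (map_eq_of_twist (g : E →+* E).mapMatrix (hQ g) ((hP g).2 x) (e1 x))
      exact congrFun (congrFun this j) k
  exact ⟨ρN, h⟩

variable [FiniteDimensional F X] [Algebra.IsCentral F X] [IsSimpleRing X]

theorem spl_of_odd_of_isGalois (hι : Fintype.card ι ^ 2 = Module.finrank F X)
    {Ψ : X → X → Matrix (ι × ι) (ι × ι) F} (hΨ : IsKr.{u} Ψ) {N L E : Type u} [Field N]
    [Field L] [Algebra N L] [FiniteDimensional N L] [CharZero N] [Field E] [Algebra N E]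
    [FiniteDimensional N E] [IsGalois N E] (φ : L →ₐ[N] E) (hodd : Odd (Module.finrank N L))
    {i : F →+* N} (hS : Spl ι X ((algebraMap N L).comp i)) : Spl ι X i := by
  have := nonempty_of_card_sq hι
  obtain ⟨ρ, hρ⟩ := hS
  have hcard : Fintype.card (L →ₐ[N] E) = Module.finrank N L := by
    refine AlgHom.card_of_splits N L E fun x => ?_
    rw [← minpoly.algHom_eq φ φ.injective]
    exact Normal.splits inferInstance _
  obtain ⟨l, hl⟩ := hodd
  have hφN : ∀ j : L →ₐ[N] E, IsRep ((algebraMap N E).comp i) ((j : L →+* E).mapMatrix.comp ρ) := by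
    intro j
    have := hρ.comp (j : L →+* E)
    rwa [← RingHom.comp_assoc, show (j : L →+* E).comp (algebraMap N L) = algebraMap N E by
      ext; simp] at this
  choose P hP using fun j => (hφN φ).exists_itw (hφN j) hι
  obtain ⟨Q, hQ⟩ := hΨ.exists_kr hρ
  have hQN : ∀ j : L →ₐ[N] E, Kr Ψ ((algebraMap N E).comp i) ((j : L →+* E).mapMatrix.comp ρ)
      ((j : L →+* E).mapMatrix Q) := by
    intro j
    have := hQ.map (j : L →+* E)
    rwa [← RingHom.comp_assoc, show (j : L →+* E).comp (algebraMap N L) = algebraMap N E by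
      ext; simp] at this
  choose f hf0 hf using fun j => hΨ.exists_smul (hQN φ) (hQN j) (hP j)
  let act : (E ≃ₐ[N] E) → (L →ₐ[N] E) → (L →ₐ[N] E) := fun g j => (g : E →ₐ[N] E).comp j
  have hPg : ∀ (g : E ≃ₐ[N] E) (j : L →ₐ[N] E),
      ∃ c : E, c ≠ 0 ∧ P (act g φ) * (g : E →+* E).mapMatrix (P j) = c • P (act g j) := fun g j =>
    (hφN φ).itw_unique hι ((hP (act g φ)).trans ((hP j).map (g : E →+* E))) (hP (act g j))
  choose c hc0 hc using hPg
  have hc2 : ∀ g j, c g j ^ 2 * f (act g j) = g (f j) * f (act g φ) := fun g j =>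
    kr_mul (g := (g : E →+* E)) (hQN φ).1 (hf (act g φ)) (hf j) (hf (act g j)) (hc g j)
  have hcc : ∀ g h j, g (c h j) * c g (act h j) = c g (act h φ) * c (g * h) j := by
    intro g h j
    refine smul_left_cancel_isUnit (hP (act (g * h) j)).1 ?_
    have e1 := congrArg (P (act g φ) * (g : E →+* E).mapMatrix ·) (hc h j)
    simp only [map_mul, mapMatrix_smul, mul_smul_comm] at e1
    rw [← mul_assoc, hc g (act h φ), hc g (act h j), smul_mul_assoc, smul_smul] at e1
    have e2 := hc (g * h) j
    have e3 : ((g * h : E ≃ₐ[N] E) : E →+* E).mapMatrix (P j) =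
      (g : E →+* E).mapMatrix ((h : E →+* E).mapMatrix (P j)) := rfl
    rw [e3] at e2
    change P (act g (act h φ)) * _ = _ at e2
    rw [e2, smul_smul] at e1
    exact e1.symm
  let n : (E ≃ₐ[N] E) → E := fun g => ∏ j, c g j
  have hn0 : ∀ g, n g ≠ 0 := fun g => Finset.prod_ne_zero_iff.2 fun j _ => hc0 g j
  have hn : ∀ g h, g (n h) * n g = c g (act h φ) ^ (2 * l + 1) * n (g * h) := by
    intro g h
    let π : (L →ₐ[N] E) ≃ (L →ₐ[N] E) :=
      ⟨act h, act h⁻¹, fun j => by ext z; simp [act],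
        fun j => by ext z; simp [act]⟩
    have : n g = ∏ j, c g (act h j) := (Fintype.prod_equiv π _ _ fun j => rfl).symm
    rw [this]
    simp only [n, map_prod]
    rw [← Finset.prod_mul_distrib, Finset.prod_congr rfl fun j _ => hcc g h j,
      Finset.prod_mul_distrib, Finset.prod_const, Finset.card_univ, hcard, hl]
  let w : (E ≃ₐ[N] E) → E := fun g => n g / f (act g φ) ^ l
  have hw0 : ∀ g, w g ≠ 0 := fun g => div_ne_zero (hn0 g) (pow_ne_zero _ (hf0 _))
  have hw : ∀ g h, g (w h) * w g = c g (act h φ) * w (g * h) := by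
    intro g h
    have h1 := hc2 g (act h φ)
    have h2 := hn g h
    have h3 : act g (act h φ) = act (g * h) φ := rfl
    rw [h3] at h1
    have hg0 : g (f (act h φ)) ≠ 0 := (map_ne_zero_iff _ g.injective).2 (hf0 _)
    have n1 := hf0 (act g φ)
    have n2 := hf0 (act (g * h) φ)
    simp only [w, map_div₀, map_pow]
    rw [div_mul_div_comm, h2, ← mul_pow, ← h1, mul_pow, ← pow_mul, pow_succ]
    have n3 := hc0 g (act h φ)
    field_simp
  refine spl_of_cocycle (hφN φ) (fun g => (w g)⁻¹ • P (act g φ))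
    (fun g => (hP (act g φ)).smul (inv_ne_zero (hw0 g))) fun g h => ?_
  rw [mapMatrix_smul, smul_mul_smul_comm, hc, smul_smul]
  change _ • P (act (g * h) φ) = _
  congr 1
  have n1 := hw0 g
  have n2 := hw0 (g * h)
  have n3 : g (w h) ≠ 0 := (map_ne_zero_iff _ g.injective).2 (hw0 h)
  simp only [RingHom.coe_coe, map_inv₀]
  field_simp
  linear_combination -hw g h

theorem spl_of_odd (hι : Fintype.card ι ^ 2 = Module.finrank F X)
    {Ψ : X → X → Matrix (ι × ι) (ι × ι) F} (hΨ : IsKr.{u} Ψ) {N L : Type u} [Field N]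
    [Field L] [Algebra N L] [FiniteDimensional N L] [CharZero N] (hodd : Odd (Module.finrank N L))
    {i : F →+* N} (hS : Spl ι X ((algebraMap N L).comp i)) : Spl ι X i :=
  spl_of_odd_of_isGalois hι hΨ
    (IsScalarTower.toAlgHom N L (IntermediateField.normalClosure N L (AlgebraicClosure L))) hodd hS

end GaloisDescent

section Closure

variable (K : Type*) {L : Type*} [Field K] [Field L] [Algebra K L]

/-- The elements of `L` which can be approximated by elements of `K`. -/
def closureAt (V : Valuation L ℤᵐ⁰) : Subfield L where
  carrier := {z | ∀ c : L, c ≠ 0 → ∃ x : K, V (z - algebraMap K L x) < V c}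
  one_mem' := fun c hc => ⟨1, by simpa [zero_lt_iff] using hc⟩
  zero_mem' := fun c hc => ⟨0, by simpa [zero_lt_iff] using hc⟩
  add_mem' := fun {z z'} hz hz' c hc => by
    obtain ⟨x, hx⟩ := hz c hc
    obtain ⟨x', hx'⟩ := hz' c hc
    refine ⟨x + x', ?_⟩
    rw [map_add, add_sub_add_comm]
    exact V.map_add_lt hx hx'
  neg_mem' := fun {z} hz c hc => by
    obtain ⟨x, hx⟩ := hz c hc
    refine ⟨-x, ?_⟩
    rwa [map_neg, ← neg_sub', Valuation.map_neg]
  mul_mem' := fun {z z'} hz hz' c hc => by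
    have aux : ∀ {y u : L}, (y ≠ 0 → V u < V (c / y)) → V (y * u) < V c := fun {y u} h => by
      by_cases hy : y = 0
      · simpa [hy, zero_lt_iff] using hc
      · have := h hy
        rw [map_div₀, lt_div_iff₀ (by simpa [zero_lt_iff] using hy)] at this
        rwa [map_mul, mul_comm]
    obtain ⟨x', hx'⟩ : ∃ x' : K, z ≠ 0 → V (z' - algebraMap K L x') < V (c / z) := by
      by_cases h : z = 0
      · exact ⟨0, fun h' => absurd h h'⟩
      · obtain ⟨x', hx'⟩ := hz' (c / z) (div_ne_zero hc h)
        exact ⟨x', fun _ => hx'⟩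
    obtain ⟨x, hx⟩ : ∃ x : K, algebraMap K L x' ≠ 0 →
        V (z - algebraMap K L x) < V (c / algebraMap K L x') := by
      by_cases h : algebraMap K L x' = 0
      · exact ⟨0, fun h' => absurd h h'⟩
      · obtain ⟨x, hx⟩ := hz (c / algebraMap K L x') (div_ne_zero hc h)
        exact ⟨x, fun _ => hx⟩
    refine ⟨x * x', ?_⟩
    rw [map_mul, show z * z' - algebraMap K L x * algebraMap K L x' =
      z * (z' - algebraMap K L x') + algebraMap K L x' * (z - algebraMap K L x) by ring]
    exact V.map_add_lt (aux hx') (aux hx)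
  inv_mem' := fun z hz c hc => by
    by_cases h0 : z = 0
    · exact ⟨0, by simpa [h0, zero_lt_iff] using hc⟩
    obtain ⟨x, hx, hx'⟩ : ∃ x : K, V (z - algebraMap K L x) < V z ∧
        V (z - algebraMap K L x) < V (c * z ^ 2) := by
      rcases le_total (V z) (V (c * z ^ 2)) with h | h
      · obtain ⟨x, hx⟩ := hz z h0
        exact ⟨x, hx, hx.trans_le h⟩
      · obtain ⟨x, hx⟩ := hz (c * z ^ 2) (mul_ne_zero hc (pow_ne_zero _ h0))
        exact ⟨x, hx.trans_le h, hx⟩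
    have hxz : V (algebraMap K L x) = V z :=
      Valuation.map_eq_of_sub_lt V (by rwa [Valuation.map_sub_swap])
    have hx0 : algebraMap K L x ≠ 0 := by
      rw [← V.ne_zero_iff, hxz]; simpa using h0
    refine ⟨x⁻¹, ?_⟩
    rw [map_inv₀, show z⁻¹ - (algebraMap K L x)⁻¹ =
      -(z - algebraMap K L x) / (z * algebraMap K L x) by field_simp; ring, map_div₀,
      Valuation.map_neg, div_lt_iff₀ (zero_lt_iff.2 ((V.ne_zero_iff).2 (mul_ne_zero h0 hx0))), map_mul, hxz]
    rwa [map_mul, map_pow, pow_two] at hx'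

variable {K} {V : Valuation L ℤᵐ⁰}

lemma algebraMap_mem_closureAt (x : K) : algebraMap K L x ∈ closureAt K V := fun c hc =>
  ⟨x, by simpa [zero_lt_iff] using hc⟩

lemma mem_closureAt_of_approx {z : L}
    (h : ∀ c : L, c ≠ 0 → ∃ y ∈ closureAt K V, V (z - y) < V c) : z ∈ closureAt K V := by
  intro c hc
  obtain ⟨y, hy, hyz⟩ := h c hc
  obtain ⟨x, hx⟩ := hy c hc
  refine ⟨x, ?_⟩
  rw [← sub_add_sub_cancel z y]
  exact V.map_add_lt hyz hx

end Closure

section Killing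

variable {A M : Type*} [Field A] [NumberField A] [Field M] [NumberField M] [Algebra A M]

lemma mem_closureAt_of_sq (w : Prm M) {z : M} (h : ∀ c : M, c ≠ 0 → ∃ s ∈ closureAt A w.val,
    ∃ e : M, w.val e < w.val c ∧ s ≠ 0 ∧ z ^ 2 = s ^ 2 * (1 + 4 * e)) : z ∈ closureAt A w.val := by
  by_cases hz0 : z = 0
  · rw [hz0]; exact zero_mem _
  have hz : ∀ s e : M, s ≠ 0 → z ^ 2 = s ^ 2 * (1 + 4 * e) → w.val e < 1 →
      w.val s = w.val z := by
    intro s e hs h1 he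
    have := congrArg w.val h1
    rw [map_mul, val_one_add (val_mul_lt_one val_four_le he), mul_one, map_pow, map_pow] at this
    exact ((pow_left_inj₀ zero_le zero_le two_ne_zero).1 this).symm
  refine mem_closureAt_of_approx fun c hc => ?_
  set c' := c / z with hc'
  have hc0 : c' ≠ 0 := div_ne_zero hc hz0
  obtain ⟨s, hs, e, he, hs0, hse⟩ : ∃ s ∈ closureAt A w.val, ∃ e : M,
      (w.val e < 1 ∧ w.val e < w.val (c' * c')) ∧ s ≠ 0 ∧ z ^ 2 = s ^ 2 * (1 + 4 * e) := by
    rcases le_total 1 (w.val (c' * c')) with h1 | h1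
    · obtain ⟨s, hs, e, he, h2⟩ := h 1 one_ne_zero
      rw [map_one] at he
      exact ⟨s, hs, e, ⟨he, he.trans_le h1⟩, h2⟩
    · obtain ⟨s, hs, e, he, h2⟩ := h (c' * c') (mul_ne_zero hc0 hc0)
      exact ⟨s, hs, e, ⟨he.trans_le h1, he⟩, h2⟩
  have hsz := hz s e hs0 hse he.1
  have key : ∀ u : M, w.val (u * (1 / s)) < w.val c' → w.val u < w.val c := by
    intro u hu
    rw [hc', map_mul, map_div₀, map_div₀, hsz, map_one, one_div, ← div_eq_mul_inv] at hu
    exact (div_lt_div_iff_of_pos_right (by simpa [zero_lt_iff] using hz0)).1 hu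
  have h2 : w.val ((z / s) ^ 2 - 1) < w.val c' * w.val c' := by
    rw [div_pow, hse, mul_div_cancel_left₀ _ (pow_ne_zero _ hs0), add_sub_cancel_left, ← map_mul,
      map_mul w.val 4]
    exact (mul_le_of_le_one_left' val_four_le).trans_lt he.2
  rcases near_one_or_neg_one h2 with h3 | h3
  · exact ⟨s, hs, key _ (by rwa [sub_mul, mul_one_div, mul_one_div, div_self hs0])⟩
  · exact ⟨-s, neg_mem hs, key _ (by
      rwa [sub_neg_eq_add, add_mul, mul_one_div, mul_one_div, div_self hs0])⟩

lemma mem_nrm_of_sq (w : Prm M) {z : M} (hz : z ∉ closureAt A w.val)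
    (hz2 : z ^ 2 ∈ closureAt A w.val) (a b : Aˣ) :
    Units.map (algebraMap A M : A →* M) b ∈ nrm (.inl w) (algebraMap A M a) := by
  set C := closureAt A w.val
  have hz0 : z ≠ 0 := by
    rintro rfl; exact hz (zero_mem _)
  let t : Cˣ := Units.mk0 ⟨z ^ 2, hz2⟩ (by
    intro h; exact pow_ne_zero 2 hz0 (congrArg (algebraMap C M) h))
  let lift : A → C := fun x => ⟨algebraMap A M x, algebraMap_mem_closureAt x⟩
  have hlift : ∀ x, algebraMap C M (lift x) = algebraMap A M x := fun x => rfl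
  have hl0 : ∀ x : Aˣ, lift x ≠ 0 := fun x h => by
    have := hlift x
    rw [h, map_zero] at this
    exact x.ne_zero ((map_eq_zero _).1 this.symm)
  have ht : t ∉ loc (.inl (below C w)) := by
    intro ht
    apply hz
    refine mem_closureAt_of_sq w fun c hc => ?_
    obtain ⟨x, hx, hx0⟩ : ∃ x : A, w.val (algebraMap A M x) ≤ w.val c ∧ algebraMap A M x ≠ 0 := by
      obtain ⟨π, hπ⟩ := exists_uniformizer (below A w)
      have hπ1 : w.val (algebraMap A M π) < 1 := by
        have h := (val_lt_iff (below_isEquiv w) (x := π) (y := 1)).2 (by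
          rw [hπ, map_one]; exact WithZero.exp_lt_exp.2 (by norm_num))
        rwa [map_one, map_one] at h
      have hπ0 : π ≠ 0 := by rintro rfl; exact WithZero.exp_ne_zero (hπ.symm.trans (map_zero _))
      obtain ⟨n, hn⟩ := exists_pow_lt_val hπ1 hc
      refine ⟨π ^ n, ?_, by simpa using fun h => absurd h hπ0⟩
      rw [map_pow, map_pow]
      exact hn.le
    obtain ⟨y, e, hy, -, he, hyt⟩ := NearSq.refine ht (d := lift x) (fun h => hx0 (by
      rw [← hlift, h, map_zero]))
    refine ⟨y, y.2, e, ?_, fun h => hy (Subtype.ext h), congrArg (algebraMap C M) hyt⟩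
    exact ((val_lt_iff (below_isEquiv w)).2 he).trans_le hx
  have := mem_nrm_of_isSquare w ht ⟨z, (pow_two z)⟩ (Units.mk0 _ (hl0 a)) (Units.mk0 _ (hl0 b))
  exact (show Units.map (algebraMap A M : A →* M) b =
    Units.map (algebraMap C M : C →* M) (Units.mk0 _ (hl0 b)) from Units.ext rfl) ▸ this

lemma val_pow_sub_pow_le {K : Type*} [Field K] {V : Valuation K ℤᵐ⁰} {z x : K} (hz : V z ≤ 1)
    (hx : V x ≤ 1) (m : ℕ) : V (z ^ m - x ^ m) ≤ V (z - x) := by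
  induction m with
  | zero => simp
  | succ m ih =>
    rw [show z ^ (m + 1) - x ^ (m + 1) = z * (z ^ m - x ^ m) + x ^ m * (z - x) by ring]
    refine V.map_add_le ?_ ?_
    · rw [map_mul]; exact (mul_le_of_le_one_left' hz).trans ih
    · rw [map_mul, map_pow]; exact mul_le_of_le_one_left' (pow_le_one₀ zero_le hx)

lemma exists_bound_rootsOfUnity.{u, v} {A : Type v} [Field A] [NumberField A] (v : Prm A) :
    ∃ k₀ : ℕ, ∀ k ≥ k₀, ∀ (M : Type u) [Field M]
    [NumberField M] [Algebra A M] (z : M), IsPrimitiveRoot z (2 ^ k) → ∀ w : Prm M,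
    below A w = v → z ∉ closureAt A w.val := by
  obtain ⟨π, hπ⟩ := exists_uniformizer v
  have hπ0 : π ≠ 0 := by rintro rfl; exact WithZero.exp_ne_zero (hπ.symm.trans (map_zero _))
  have hπ1 : v.val π < 1 := by rw [hπ]; exact WithZero.exp_lt_exp.2 (by norm_num)
  have hc0 : (2 * π : A) ≠ 0 := mul_ne_zero two_ne_zero hπ0
  have hg2 : v.val (2 * π) < v.val 2 := by
    rw [map_mul]
    exact mul_lt_of_lt_one_right (zero_lt_iff.2 ((v.val.ne_zero_iff).2 two_ne_zero)) hπ1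
  have hg1 : v.val (2 * π) < 1 := hg2.trans_le val_two_le
  have := finite_quot v ((v.val.ne_zero_iff).2 hc0) hg1.le
  let R := locRing v ⧸ ballIdeal v (v.val (2 * π))
  refine ⟨Nat.card R + 1, ?_⟩
  rintro (_ | k) hk M _ _ _ z hz w rfl hcl
  · omega
  obtain ⟨x, hx⟩ := hcl (algebraMap A M (2 * π)) ((map_ne_zero _).2 hc0)
  have hw1 : w.val (algebraMap A M (2 * π)) < 1 := by
    have h := (val_lt_iff (below_isEquiv w) (x := 2 * π) (y := 1)).2 (by rwa [map_one])
    rwa [map_one, map_one] at h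
  have hz1 : w.val z = 1 := by
    have := congrArg w.val hz.pow_eq_one
    rw [map_pow, map_one] at this
    exact (pow_eq_one_iff_of_nonneg zero_le (pow_ne_zero _ two_ne_zero)).1 this
  have hx1 : w.val (algebraMap A M x) ≤ 1 := by
    have := w.val.map_sub_le (x := z) (y := z - algebraMap A M x) (g := 1) hz1.le (hx.trans hw1).le
    rwa [sub_sub_cancel] at this
  have hxv : (below A w).val x ≤ 1 := by
    rw [← map_one (below A w).val, ← val_le_iff w, map_one, map_one]
    exact hx1
  have hzm : z ^ 2 ^ k = -1 := by
    have h1 : (z ^ 2 ^ k) ^ 2 = 1 := by rw [← pow_mul, ← pow_succ, hz.pow_eq_one]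
    rcases sq_eq_one_iff.1 h1 with h | h
    · exact absurd h (hz.pow_ne_one_of_pos_of_lt (by positivity)
        (Nat.pow_lt_pow_right (by norm_num) (by omega)))
    · exact h
  have hxm : (below A w).val (x ^ 2 ^ k + 1) < (below A w).val (2 * π) := by
    rw [← val_lt_iff (below_isEquiv w)]
    refine lt_of_le_of_lt ?_ hx
    rw [map_add, map_pow, map_one, ← sub_neg_eq_add, Valuation.map_sub_swap, ← hzm]
    exact val_pow_sub_pow_le hz1.le hx1 _
  let X : R := Ideal.Quotient.mk _ ⟨x, hxv⟩
  have hX : X ^ 2 ^ k = -1 := by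
    rw [← sub_eq_zero, sub_neg_eq_add, ← map_pow, ← map_one (Ideal.Quotient.mk _), ← map_add,
      Ideal.Quotient.eq_zero_iff_mem, mem_ballIdeal]
    exact hxm.le
  have hX1 : X ^ 2 ^ k ≠ 1 := by
    rw [hX]
    intro h
    rw [eq_comm, ← sub_eq_zero, sub_neg_eq_add, ← map_one (Ideal.Quotient.mk _), ← map_add,
      Ideal.Quotient.eq_zero_iff_mem, mem_ballIdeal] at h
    refine absurd h (not_le.2 (hg2.trans_eq (congrArg _ ?_)))
    change (2 : A) = 1 + 1
    norm_num
  have hX2 : X ^ 2 ^ (k + 1) = 1 := by rw [pow_succ, pow_mul, hX]; norm_num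
  have hord := orderOf_eq_prime_pow hX1 hX2
  obtain ⟨U, hU⟩ := IsUnit.of_pow_eq_one hX2 (by positivity)
  rw [← hU, orderOf_units] at hord
  have h1 := orderOf_le_card (x := U)
  have h2 := Nat.card_le_card_of_injective (fun u : Rˣ => (u : R)) Units.val_injective
  have h3 := Nat.lt_two_pow_self (n := k + 1)
  omega

lemma exists_mem_nrm_of_rootsOfUnity.{u, v} {A : Type v} [Field A] [NumberField A]
    (v : Prm A) :
    ∃ k₀ : ℕ, ∀ k ≥ k₀, ∀ (M : Type u) [Field M]
    [NumberField M] [Algebra A M] (z : M), IsPrimitiveRoot z (2 ^ k) → ∀ w : Prm M,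
    below A w = v → ∀ a b : Aˣ,
      Units.map (algebraMap A M : A →* M) b ∈ nrm (.inl w) (algebraMap A M a) := by
  obtain ⟨k₀, hk₀⟩ := exists_bound_rootsOfUnity.{u} v
  refine ⟨k₀, fun k hk M _ _ _ z hz w hw a b => ?_⟩
  by_contra hcon
  refine hk₀ k hk M z hz w hw ?_
  have key : ∀ j ≤ k, z ^ 2 ^ (k - j) ∈ closureAt A w.val := by
    intro j
    induction j with
    | zero => intro _; rw [Nat.sub_zero, hz.pow_eq_one]; exact one_mem _
    | succ j ih =>
      intro hj
      by_contra h
      refine hcon (mem_nrm_of_sq w h ?_ a b)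
      have := ih (by omega)
      rwa [show k - j = k - (j + 1) + 1 by omega, pow_succ, pow_mul] at this
  simpa using key k le_rfl

lemma not_isReal_of_primitiveRoot {k : ℕ} (hk : 2 ≤ k) {z : M} (hz : IsPrimitiveRoot z (2 ^ k))
    (v : NumberField.InfinitePlace M) : ¬ v.IsReal := by
  intro hv
  have h1 : (z ^ 2 ^ (k - 2)) ^ 2 = -1 := by
    have h1 : ((z ^ 2 ^ (k - 2)) ^ 2) ^ 2 = 1 := by
      rw [← pow_mul, ← pow_mul, ← mul_assoc, ← pow_succ, ← pow_succ, show k - 2 + 1 + 1 = k by omega,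
        hz.pow_eq_one]
    rcases sq_eq_one_iff.1 h1 with h | h
    · rw [← pow_mul, ← pow_succ] at h
      exact absurd h (hz.pow_ne_one_of_pos_of_lt (by positivity)
        (Nat.pow_lt_pow_right (by norm_num) (by omega)))
    · exact h
  have h2 := congrArg (fun q => (v.embedding q).re) h1
  simp only [pow_two, embedding_re_mul hv, map_neg, map_one, Complex.neg_re, Complex.one_re] at h2
  nlinarith [mul_self_nonneg (v.embedding (z ^ 2 ^ (k - 2))).re]

/-- Adjoining roots of unity of sufficiently large order kills a quaternion algebra. -/
theorem exists_sol_of_rootsOfUnity.{u, v} {A : Type v} [Field A] [NumberField A]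
    {a b : A} (ha : a ≠ 0) (hb : b ≠ 0) : ∃ k₀ : ℕ, ∀ k ≥ k₀,
    ∀ (M : Type u) [Field M] [NumberField M] [Algebra A M] (z : M), IsPrimitiveRoot z (2 ^ k) →
      Sol M (algebraMap A M a) (algebraMap A M b) := by
  classical
  obtain ⟨S, -, -, hS2, hS⟩ := exists_good_set ∅ {Units.mk0 a ha, Units.mk0 b hb}
  choose f hf using exists_mem_nrm_of_rootsOfUnity.{u} (A := A)
  refine ⟨max 2 (S.sup f), fun k hk M _ _ _ z hz => ?_⟩
  have h2 : 2 ≤ k := (le_max_left _ _).trans hk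
  let a' : Aˣ := Units.mk0 a ha
  let b' : Aˣ := Units.mk0 b hb
  let i := Units.map (algebraMap A M : A →* M)
  refine hasse_norm (a := i a') (b := i b') ?_
  rintro (w | w)
  · by_cases hw : below A w ∈ S
    · exact hf _ k (((Finset.le_sup hw).trans (le_max_right _ _)).trans hk) M z hz w rfl a' b'
    · have h2 : w.val 2 = 1 := by
        have := (val_eq_one_iff_below (K := A) w (x := 2)).2 (hS2 _ hw)
        rwa [map_ofNat] at this
      exact mem_nrm_of_units h2 ((val_eq_one_iff_below w).2 (hS a' (by simp [a']) _ hw))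
        ((val_eq_one_iff_below w).2 (hS b' (by simp [b']) _ hw))
  · refine loc_le_nrm _ _ ?_
    change _ ∈ posAt w
    rw [posAt_complex (not_isReal_of_primitiveRoot h2 hz w)]
    trivial

end Killing

section SplittingField

open scoped TensorProduct

variable {F X : Type*} [Field F] [Ring X] [Algebra F X] [FiniteDimensional F X]
  [Algebra.IsCentral F X] [IsSimpleRing X]

lemma isSimpleRing_tensorProduct (E : Type*) [Field E] [Algebra F E] : IsSimpleRing (E ⊗[F] X) := by
  let b := Module.finBasis F X
  let B := b.baseChange E
  have hB : ∀ i, B i = 1 ⊗ₜ[F] b i := fun i => by simp [B]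
  have : Nontrivial (E ⊗[F] X) := by
    have : Nonempty (Fin (Module.finrank F X)) := ⟨⟨0, Module.finrank_pos⟩⟩
    obtain ⟨i⟩ := this
    exact ⟨⟨B i, 0, B.ne_zero i⟩⟩
  refine ⟨{ eq_bot_or_eq_top := fun I => ?_ }⟩
  by_cases hI : Nontrivial I.ringCon.Quotient
  · left
    let q : (E ⊗[F] X) →ₐ[E] I.ringCon.Quotient :=
      { I.ringCon.mk' with commutes' := fun _ => rfl }
    let ρ : X →ₐ[F] I.ringCon.Quotient :=
      (q.restrictScalars F).comp Algebra.TensorProduct.includeRight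
    have hli : LinearIndependent E (fun i => q.toLinearMap (B i)) := by
      have := linearIndependent_map (E := E) ρ b
      simpa only [hB] using! this
    have hker : LinearMap.ker q.toLinearMap = ⊥ := by
      rw [LinearMap.ker_eq_bot']
      intro m hm
      rw [← B.sum_repr m, map_sum] at hm
      simp only [map_smul] at hm
      rw [← B.sum_repr m]
      have := Fintype.linearIndependent_iff.1 hli _ hm
      simp [this]
    refine le_bot_iff.1 fun x hx => ?_
    have : x ∈ LinearMap.ker q.toLinearMap := (RingCon.eq I.ringCon).2 ((I.mem_iff x).1 hx)
    rw [hker] at this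
    rw [(Submodule.mem_bot _).1 this]
    exact zero_mem _
  · right
    rw [not_nontrivial_iff_subsingleton] at hI
    rw [← TwoSidedIdeal.one_mem_iff, TwoSidedIdeal.mem_iff]
    exact (RingCon.eq I.ringCon).1 (Subsingleton.elim _ _)

/-- A central simple algebra is split by a finite Galois extension. -/
theorem exists_spl.{u, v} (F : Type u) (X : Type v) [Field F] [CharZero F] [Ring X] [Algebra F X]
    [FiniteDimensional F X] [Algebra.IsCentral F X] [IsSimpleRing X] :
    ∃ n : ℕ, Fintype.card (Fin n) ^ 2 = Module.finrank F X ∧ ∃ (E : Type u) (_ : Field E)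
      (_ : Algebra F E), FiniteDimensional F E ∧ IsGalois F E ∧
      Spl (Fin n) X (algebraMap F E) := by
  have := isSimpleRing_tensorProduct (F := F) (X := X) (AlgebraicClosure F)
  obtain ⟨n, -, ⟨e⟩⟩ := IsSimpleRing.exists_algEquiv_matrix_of_isAlgClosed (AlgebraicClosure F)
    (AlgebraicClosure F ⊗[F] X)
  refine ⟨n, ?_, ?_⟩
  · have := e.toLinearEquiv.finrank_eq
    rw [Module.finrank_baseChange, Module.finrank_matrix] at this
    simp [this, pow_two]
  let ρ : X →+* Matrix (Fin n) (Fin n) (AlgebraicClosure F) :=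
    e.toRingEquiv.toRingHom.comp
      (Algebra.TensorProduct.includeRight : X →ₐ[F] AlgebraicClosure F ⊗[F] X).toRingHom
  have hρ : IsRep (algebraMap F (AlgebraicClosure F)) ρ := by
    intro a
    change e (1 ⊗ₜ algebraMap F X a) = _
    rw [Algebra.algebraMap_eq_smul_one, ← TensorProduct.smul_tmul, ← Algebra.algebraMap_eq_smul_one]
    have : (algebraMap F (AlgebraicClosure F) a ⊗ₜ[F] (1 : X)) = algebraMap (AlgebraicClosure F)
      (AlgebraicClosure F ⊗[F] X) (algebraMap F (AlgebraicClosure F) a) := rfl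
    rw [this, AlgEquiv.commutes, Algebra.algebraMap_eq_smul_one]
  clear_value ρ
  let b := Module.finBasis F X
  let s : Set (AlgebraicClosure F) := Set.range fun p : Fin (Module.finrank F X) × Fin n × Fin n =>
    ρ (b p.1) p.2.1 p.2.2
  have hs : s.Finite := Set.finite_range _
  have := hs.to_subtype
  have : FiniteDimensional F (IntermediateField.adjoin F s) :=
    IntermediateField.finiteDimensional_adjoin fun x _ => Algebra.IsIntegral.isIntegral x
  let E := IntermediateField.normalClosure F (IntermediateField.adjoin F s) (AlgebraicClosure F)
  refine ⟨E, inferInstance, inferInstance, inferInstance, inferInstance, ?_⟩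
  have hle : s ⊆ E := (IntermediateField.subset_adjoin F s).trans
    (IntermediateField.le_normalClosure _)
  have hρ' : IsRep ((algebraMap E (AlgebraicClosure F)).comp (algebraMap F E)) ρ := hρ
  obtain ⟨ρM, h, -⟩ := hρ'.descend fun x j k => by
    have : ρ x j k ∈ E := by
      rw [← b.sum_repr x, map_sum, Matrix.sum_apply]
      refine sum_mem fun l _ => ?_
      rw [Algebra.smul_def, map_mul, hρ, smul_one_mul]
      exact mul_mem (E.algebraMap_mem _) (hle ⟨(l, j, k), rfl⟩)
    exact ⟨⟨_, this⟩, rfl⟩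
  exact ⟨ρM, h⟩

end SplittingField

section Towers

universe u

lemma exists_isQuad_of_finrank_eq_two {K L : Type*} [Field K] [CharZero K] [Field L] [Algebra K L]
    (h : Module.finrank K L = 2) : ∃ (a : K) (r : L) (σ : L ≃ₐ[K] L), IsQuad K L a r σ := by
  have : Algebra.IsQuadraticExtension K L := ⟨h⟩
  have : FiniteDimensional K L := Module.finite_of_finrank_pos (by omega)
  have : CharZero L := charZero_of_injective_algebraMap (algebraMap K L).injective
  have hcard : Nat.card (L ≃ₐ[K] L) = 2 := by rw [IsGalois.card_aut_eq_finrank, h]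
  obtain ⟨σ, hσ, huniv⟩ := (Nat.card_eq_two_iff' (1 : L ≃ₐ[K] L)).1 hcard
  have hσ2 : σ * σ = 1 := by
    by_contra h'
    exact hσ (mul_left_cancel ((huniv _ h').trans (mul_one σ).symm))
  have hσσ : ∀ z, σ (σ z) = z := fun z => congrArg (fun f : L ≃ₐ[K] L => f z) hσ2
  have hfix : ∀ z, σ z = z → z ∈ Set.range (algebraMap K L) := by
    intro z hz
    refine (IsGalois.mem_range_algebraMap_iff_fixed (F := K) z).2 fun f => ?_
    by_cases hf : f = 1
    · rw [hf]; rfl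
    · rw [huniv _ hf, hz]
  obtain ⟨x, hx⟩ : ∃ x, σ x ≠ x := by
    by_contra! h'
    exact hσ (AlgEquiv.ext h')
  have hr : x - σ x ≠ 0 := sub_ne_zero.2 hx.symm
  have hconj : σ (x - σ x) = -(x - σ x) := by rw [map_sub, hσσ]; ring
  obtain ⟨a, ha⟩ := hfix ((x - σ x) ^ 2) (by rw [map_pow, hconj]; ring)
  refine ⟨a, x - σ x, σ, ⟨ha.symm, hconj, hr, fun z => ?_⟩⟩
  obtain ⟨p, hp⟩ := hfix ((z + σ z) / 2) (by simp only [map_div₀, map_add, hσσ, map_ofNat]; ring)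
  obtain ⟨q, hq⟩ := hfix ((z - σ z) / (2 * (x - σ x))) (by
    rw [map_div₀, map_mul, hconj, map_sub, hσσ, map_ofNat]
    field_simp
    ring)
  refine ⟨p, q, ?_⟩
  rw [hp, hq]
  field_simp
  ring

variable {F X : Type*} [Field F] [Ring X] [Algebra F X]
  {ι : Type*} [Fintype ι] [DecidableEq ι]

lemma Spl.of_bijective {L E : Type*} [Field L] [Field E] {f : L →+* E}
    (hf : Function.Bijective f) {i : F →+* L} (h : Spl ι X (f.comp i)) : Spl ι X i := by
  have := h.map ((RingEquiv.ofBijective f hf).symm : E →+* L)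
  rwa [← RingHom.comp_assoc, show ((RingEquiv.ofBijective f hf).symm : E →+* L).comp f =
    RingHom.id L from RingHom.ext fun x => (RingEquiv.ofBijective f hf).symm_apply_apply x,
    RingHom.id_comp] at this

/-- Descent of a property along the quadratic steps of a Galois extension of 2-power degree. -/
theorem quadratic_descent (P : ∀ (A : Type u) [Field A] [NumberField A], (F →+* A) → Prop)
    (base : ∀ (A : Type u) [Field A] [NumberField A] (i : F →+* A), Spl ι X i → P A i)
    (step : ∀ (A K : Type u) [Field A] [NumberField A] [Field K] [NumberField K] [Algebra A K]
      (d : A) (r : K) (σ : K ≃ₐ[A] K), IsQuad A K d r σ → ∀ i : F →+* A,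
      P K ((algebraMap A K).comp i) → P A i) (n : ℕ) :
    ∀ (L E : Type u) [Field L] [NumberField L] [Field E] [NumberField E] [Algebra L E]
      [IsGalois L E] (i : F →+* L), Module.finrank L E = 2 ^ n →
      Spl ι X ((algebraMap L E).comp i) → P L i := by
  induction n with
  | zero =>
    intro L E _ _ _ _ _ _ i hn hS
    refine base L i (hS.of_bijective ?_)
    exact ⟨(algebraMap L E).injective, fun x => (Algebra.mem_bot (R := L) (A := E)).1
      ((Subalgebra.bot_eq_top_of_finrank_eq_one (by simpa using hn)).ge Algebra.mem_top)⟩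
  | succ n ih =>
    intro L E _ _ _ _ _ _ i hn hS
    have hfd : FiniteDimensional L E := Module.finite_of_finrank_pos (by rw [hn]; positivity)
    have : Fact (Nat.Prime 2) := ⟨Nat.prime_two⟩
    obtain ⟨H, hH⟩ := Sylow.exists_subgroup_card_pow_prime (G := E ≃ₐ[L] E) 2 (n := n) (by
      rw [IsGalois.card_aut_eq_finrank, hn]; exact pow_dvd_pow _ (by omega))
    let K := IntermediateField.fixedField H
    have h1 : Module.finrank K E = 2 ^ n := by
      rw [IntermediateField.finrank_fixedField_eq_card, hH]
    have h2 : Module.finrank L K = 2 := by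
      have := Module.finrank_mul_finrank L K E
      rw [h1, hn, pow_succ'] at this
      exact Nat.eq_of_mul_eq_mul_right (by positivity) this
    have : NumberField K := NumberField.of_module_finite L K
    obtain ⟨d, r, σ, hq⟩ := exists_isQuad_of_finrank_eq_two h2
    exact step L K d r σ hq i (ih K E _ h1 hS)

/-- Two extensions of a field, one of them of odd degree, have a common extension of odd degree
over the other. -/
lemma exists_odd_compositum {F L M : Type u} [Field F] [CharZero F] [Field L] [Algebra F L]
    [FiniteDimensional F L] [Field M] [Algebra F M] (hodd : Odd (Module.finrank F L)) :
    ∃ (N : Type u) (_ : Field N) (_ : Algebra M N) (_ : FiniteDimensional M N) (φ : L →+* N),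
      Odd (Module.finrank M N) ∧
      φ.comp (algebraMap F L) = (algebraMap M N).comp (algebraMap F M) := by
  have key : ∀ (n : ℕ) (q : Polynomial M), q.natDegree = n → Odd n →
      ∃ g : Polynomial M, Irreducible g ∧ Odd g.natDegree ∧ g ∣ q := by
    intro n
    induction n using Nat.strong_induction_on with
    | _ n ih =>
      intro q hq hn
      by_cases hirr : Irreducible q
      · exact ⟨q, hirr, hq ▸ hn, dvd_rfl⟩
      have hn0 : 0 < n := hn.pos
      have hq0 : q ≠ 0 := by rintro rfl; simp at hq; omega
      have hu : ¬ IsUnit q := fun h => by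
        have := Polynomial.natDegree_eq_zero_of_isUnit h; omega
      rw [irreducible_iff] at hirr
      push Not at hirr
      obtain ⟨f, g, rfl, hf, hg⟩ := hirr hu
      have hf0 := left_ne_zero_of_mul hq0
      have hg0 := right_ne_zero_of_mul hq0
      have hf1 : 0 < f.natDegree := Nat.pos_of_ne_zero fun h => hf
        (Polynomial.isUnit_iff_degree_eq_zero.2 (by rw [Polynomial.degree_eq_natDegree hf0, h]; rfl))
      have hg1 : 0 < g.natDegree := Nat.pos_of_ne_zero fun h => hg
        (Polynomial.isUnit_iff_degree_eq_zero.2 (by rw [Polynomial.degree_eq_natDegree hg0, h]; rfl))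
      rw [Polynomial.natDegree_mul hf0 hg0] at hq
      by_cases hfo : Odd f.natDegree
      · obtain ⟨k, h1, h2, h3⟩ := ih _ (by omega) f rfl hfo
        exact ⟨k, h1, h2, h3.mul_right g⟩
      · have hgo : Odd g.natDegree := by
          rw [← hq, Nat.odd_add] at hn
          by_contra h
          exact hfo (hn.2 (Nat.not_odd_iff_even.1 h))
        obtain ⟨k, h1, h2, h3⟩ := ih _ (by omega) g rfl hgo
        exact ⟨k, h1, h2, h3.mul_left f⟩
  let pb := Field.powerBasisOfFiniteOfSeparable F L
  obtain ⟨g, hg, hgo, hgd⟩ := key _ ((minpoly F pb.gen).map (algebraMap F M)) rfl (by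
    rw [Polynomial.natDegree_map, PowerBasis.natDegree_minpoly, ← PowerBasis.finrank]
    exact hodd)
  have : Fact (Irreducible g) := ⟨hg⟩
  let φ : L →ₐ[F] AdjoinRoot g := pb.lift (AdjoinRoot.root g) (by
    rw [← Polynomial.aeval_map_algebraMap M, AdjoinRoot.aeval_eq, AdjoinRoot.mk_eq_zero]
    exact hgd)
  let pb' := AdjoinRoot.powerBasis hg.ne_zero
  refine ⟨AdjoinRoot g, inferInstance, inferInstance, pb'.finite, (φ : L →+* AdjoinRoot g), ?_, ?_⟩
  · rw [pb'.finrank, AdjoinRoot.powerBasis_dim]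
    exact hgo
  · ext x
    simp only [RingHom.comp_apply, RingHom.coe_coe, AlgHom.commutes]
    exact IsScalarTower.algebraMap_apply F M (AdjoinRoot g) x

end Towers

section Cyclotomic

universe u

lemma exists_cyclotomic_lift {K M : Type u} [Field K] [NumberField K] [Field M] (j : K →+* M)
    {k l : ℕ} (hkl : k ≤ l) {z : M} (hz : IsPrimitiveRoot z (2 ^ l)) :
    ∃ φ : CyclotomicField (2 ^ k) K →+* M, φ.comp (algebraMap K _) = j := by
  let _ : Algebra K M := j.toAlgebra
  have hz' : IsPrimitiveRoot (z ^ 2 ^ (l - k)) (2 ^ k) :=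
    hz.pow (by positivity) (by rw [← pow_add]; congr 1; omega)
  have hs := IsCyclotomicExtension.isSplittingField_X_pow_sub_one (2 ^ k) K
    (CyclotomicField (2 ^ k) K)
  let φ := Polynomial.IsSplittingField.lift (CyclotomicField (2 ^ k) K)
    (Polynomial.X ^ 2 ^ k - 1 : Polynomial K) (F := M) (by
      simpa using Polynomial.X_pow_sub_one_splits hz')
  exact ⟨φ, φ.comp_algebraMap⟩

variable {F X : Type*} [Field F] [Ring X] [Algebra F X]
  {ι : Type*} [Fintype ι] [DecidableEq ι]

variable (X ι) in
/-- The algebra is split over every number field containing enough roots of unity of 2-power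
order. -/
def SplCyc (A : Type u) [Field A] [NumberField A] (i : F →+* A) : Prop :=
  ∃ k₀ : ℕ, ∀ k ≥ k₀, ∀ (M : Type u) [Field M] [NumberField M] (j : A →+* M) (z : M),
    IsPrimitiveRoot z (2 ^ k) → Spl ι X (j.comp i)

lemma SplCyc.of_spl {A : Type u} [Field A] [NumberField A] {i : F →+* A} (h : Spl ι X i) :
    SplCyc X ι A i :=
  ⟨0, fun _ _ _ _ _ j _ _ => h.map j⟩

variable [FiniteDimensional F X] [Algebra.IsCentral F X] [IsSimpleRing X]

lemma SplCyc.of_isQuad (hι : Fintype.card ι ^ 2 = Module.finrank F X) {A K : Type u} [Field A]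
    [NumberField A] [Field K] [NumberField K] [Algebra A K] {d : A} {r : K} {σ : K ≃ₐ[A] K}
    (hq : IsQuad A K d r σ) {i : F →+* A} (h : SplCyc X ι K ((algebraMap A K).comp i)) :
    SplCyc X ι A i := by
  obtain ⟨k₀, hk₀⟩ := h
  let B := CyclotomicField (2 ^ k₀) A
  let _ : NumberField B := IsCyclotomicExtension.numberField {2 ^ k₀} A B
  obtain ⟨z₀, hz₀⟩ := IsCyclotomicExtension.exists_isPrimitiveRoot (A := A) (B := B)
    (Set.mem_singleton (2 ^ k₀)) (by positivity)
  by_cases hd : IsSquare (algebraMap A B d)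
  · obtain ⟨y, hy⟩ := hd
    obtain ⟨φ, hφ, -⟩ : ∃ φ : K →+* B, φ.comp (algebraMap A K) = algebraMap A B ∧ φ r = y :=
      hq.exists_lift (algebraMap A B) (by rw [hy, pow_two])
    have hB := hk₀ k₀ le_rfl B φ z₀ hz₀
    rw [← RingHom.comp_assoc, hφ] at hB
    refine ⟨k₀, fun k hk M _ _ j z hz => ?_⟩
    obtain ⟨ψ, hψ⟩ := exists_cyclotomic_lift j hk hz
    have := hB.map ψ
    rwa [← RingHom.comp_assoc, hψ] at this
  · obtain ⟨L, _, _, _, r', σ', hq'⟩ := exists_isQuad_numberField hd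
    obtain ⟨φ, hφ, -⟩ : ∃ φ : K →+* L, φ.comp (algebraMap A K) =
        (algebraMap B L).comp (algebraMap A B) ∧ φ r = r' :=
      hq.exists_lift ((algebraMap B L).comp (algebraMap A B)) (by rw [hq'.sq]; rfl)
    have hL := hk₀ k₀ le_rfl L φ (algebraMap B L z₀)
      (hz₀.map_of_injective (algebraMap B L).injective)
    rw [← RingHom.comp_assoc, hφ, RingHom.comp_assoc] at hL
    obtain ⟨e, he, hS⟩ := hq'.exists_spl_of_sol hι hL
    have hd0 : algebraMap A B d ≠ 0 := fun h0 => hd (h0 ▸ ⟨0, by simp⟩)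
    obtain ⟨k₁, hk₁⟩ := exists_sol_of_rootsOfUnity.{u} hd0 he
    refine ⟨max k₀ k₁, fun k hk M _ _ j z hz => ?_⟩
    obtain ⟨ψ, hψ⟩ := exists_cyclotomic_lift j ((le_max_left k₀ k₁).trans hk) hz
    have := hS M ψ (by
      let _ : Algebra B M := ψ.toAlgebra
      exact hk₁ k ((le_max_right k₀ k₁).trans hk) M z hz)
    rwa [← RingHom.comp_assoc, hψ] at this

/-- An algebra of exponent two is split by adjoining enough roots of unity of 2-power order. -/
theorem splCyc {F : Type u} [Field F] [NumberField F] [Algebra F X] [FiniteDimensional F X]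
    [Algebra.IsCentral F X] (hι : Fintype.card ι ^ 2 = Module.finrank F X)
    {Ψ : X → X → Matrix (ι × ι) (ι × ι) F} (hΨ : IsKr.{u} Ψ) {E : Type u} [Field E]
    [Algebra F E] [FiniteDimensional F E] [IsGalois F E] (hS : Spl ι X (algebraMap F E)) :
    SplCyc X ι F (RingHom.id F) := by
  have : Fact (Nat.Prime 2) := ⟨Nat.prime_two⟩
  have : NumberField E := NumberField.of_module_finite F E
  let H : Sylow 2 (E ≃ₐ[F] E) := default
  let L := IntermediateField.fixedField (H : Subgroup (E ≃ₐ[F] E))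
  have : NumberField L := NumberField.of_module_finite F L
  obtain ⟨n, hn⟩ := IsPGroup.iff_card.1 H.2
  have h1 : Module.finrank L E = 2 ^ n := by
    rw [IntermediateField.finrank_fixedField_eq_card]
    exact hn
  have hodd : Odd (Module.finrank F L) := by
    have h2 : Module.finrank F L = (H : Subgroup (E ≃ₐ[F] E)).index := by
      have := Module.finrank_mul_finrank F L E
      rw [h1, ← IsGalois.card_aut_eq_finrank F E, ← Subgroup.index_mul_card
        (H : Subgroup (E ≃ₐ[F] E)), hn] at this
      exact Nat.eq_of_mul_eq_mul_right (by positivity) this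
    rw [h2, ← Nat.not_even_iff_odd, even_iff_two_dvd]
    exact H.not_dvd_index
  obtain ⟨k₀, hk₀⟩ := quadratic_descent (X := X) (ι := ι) (F := F)
    (fun A _ _ i => SplCyc X ι A i) (fun A _ _ i => SplCyc.of_spl)
    (fun A K _ _ _ _ _ d r σ hq i => SplCyc.of_isQuad hι hq) n L E (algebraMap F L) h1 hS
  refine ⟨k₀, fun k hk M _ _ j z hz => ?_⟩
  let _ : Algebra F M := j.toAlgebra
  obtain ⟨N, _, _, _, φ, hN, hφ⟩ := exists_odd_compositum (M := M) hodd
  have : NumberField N := NumberField.of_module_finite M N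
  have hSN := hk₀ k hk N φ (algebraMap M N z) (hz.map_of_injective (algebraMap M N).injective)
  rw [hφ] at hSN
  exact spl_of_odd hι hΨ hN hSN

end Cyclotomic

section LocalKummer

variable {K L : Type*} [Field K] [NumberField K] [Field L] [NumberField L] [Algebra K L]

lemma nearSq_below_of_mem_closureAt (w : Prm L) {x : K} (hx : NearSq w.val (algebraMap K L x))
    (hcl : ∀ z : L, z ∈ closureAt K w.val) : NearSq (below K w).val x := by
  obtain ⟨y, e, hy, he, hxe⟩ := hx
  have h4 : (4 : L) ≠ 0 := by norm_num
  obtain ⟨p, hp⟩ := hcl y (4 * y) (mul_ne_zero h4 hy)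
  have hp' : w.val (y - algebraMap K L p) < w.val y := hp.trans_le (by
    rw [map_mul]; exact mul_le_of_le_one_left' val_four_le)
  have hpy : w.val (algebraMap K L p) = w.val y :=
    Valuation.map_eq_of_sub_lt _ (by rwa [Valuation.map_sub_swap])
  have hy0 : 0 < w.val y := by simpa [zero_lt_iff] using hy
  apply nearSq_of_sub_sq (y := p)
  rw [← val_lt_iff (below_isEquiv w)]
  have h2 : w.val (y + algebraMap K L p) ≤ w.val y := by
    refine (w.val.map_add _ _).trans ?_
    rw [hpy, max_self]
  have h3 : w.val (algebraMap K L (4 * p ^ 2)) = w.val (4 * y) * w.val y := by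
    simp only [map_mul, map_ofNat, hpy, pow_two, mul_assoc]
  rw [h3, map_sub, map_pow, hxe, show y ^ 2 * (1 + 4 * e) - algebraMap K L p ^ 2 =
    (y - algebraMap K L p) * (y + algebraMap K L p) + e * (4 * y * y) by ring]
  refine w.val.map_add_lt ?_ ?_
  · rw [map_mul]
    exact (mul_le_mul_right h2 _).trans_lt (mul_lt_mul_of_pos_right hp hy0)
  · rw [map_mul, map_mul _ (4 * y)]
    exact mul_lt_of_lt_one_left (mul_pos (by simp [zero_lt_iff, hy]) hy0) he

lemma nearSq_below_or (w : Prm L) {a : K} {r : L} {σ : L ≃ₐ[K] L} (h : IsQuad K L a r σ) {x : K}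
    (hx : NearSq w.val (algebraMap K L x)) :
    NearSq (below K w).val x ∨ NearSq (below K w).val (a * x) := by
  by_cases hw : conjPrm σ w = w
  · exact NearSq.descend h (fun z => by rw [← conjPrm_val, hw]) (below_isEquiv w) hx
  · left
    have ha := (conj_ne_iff h).1 hw
    refine nearSq_below_of_mem_closureAt w hx fun z => ?_
    have hr : r ∈ closureAt K w.val := by
      refine mem_closureAt_of_sq w fun c hc => ?_
      obtain ⟨π, hπ⟩ := exists_uniformizer (below K w)
      have hπ0 : π ≠ 0 := by
        rintro rfl; rw [map_zero] at hπ; exact WithZero.exp_ne_zero hπ.symm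
      have hπ1 : w.val (algebraMap K L π) < 1 := by
        have := (val_lt_iff (below_isEquiv w) (x := π) (y := 1)).2 (by
          rw [hπ, map_one, ← WithZero.exp_zero, WithZero.exp_lt_exp]; norm_num)
        simpa using this
      obtain ⟨n, hn⟩ := exists_pow_lt_val hπ1 hc
      obtain ⟨y, e, hy, -, he, hae⟩ := ha.refine (pow_ne_zero n hπ0)
      refine ⟨algebraMap K L y, algebraMap_mem_closureAt y, algebraMap K L e, ?_, by simpa, ?_⟩
      · refine LT.lt.trans ?_ hn
        rw [← map_pow, ← map_pow]
        exact (val_lt_iff (below_isEquiv w)).2 he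
      · rw [h.sq, hae]
        simp only [map_mul, map_pow, map_add, map_one, map_ofNat]
    obtain ⟨p, q, rfl⟩ := h.span z
    exact add_mem (algebraMap_mem_closureAt p) (mul_mem (algebraMap_mem_closureAt q) hr)

end LocalKummer

section SplKum

universe u

lemma mem_posAt_comap {K L : Type*} [Field K] [NumberField K] [Field L] [NumberField L]
    [Algebra K L] {w : NumberField.InfinitePlace L} (hw : w.IsReal) {x : Kˣ} :
    (w.comap (algebraMap K L)).IsReal ∧ (Units.map (algebraMap K L : K →* L) x ∈ posAt w ↔
      x ∈ posAt (w.comap (algebraMap K L))) := by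
  have hv := hw.comap (algebraMap K L)
  refine ⟨hv, ?_⟩
  have he : (w.comap (algebraMap K L)).embedding = w.embedding.comp (algebraMap K L) := by
    have h1 : NumberField.ComplexEmbedding.IsReal (w.embedding.comp (algebraMap K L)) :=
      (NumberField.InfinitePlace.isReal_iff.1 hw).comp _
    rw [← NumberField.InfinitePlace.embedding_mk_eq_of_isReal h1,
      ← NumberField.InfinitePlace.comap_mk, NumberField.InfinitePlace.mk_embedding]
  rw [mem_posAt, mem_posAt, he]
  exact ⟨fun h _ => h hw, fun h _ => h hv⟩

lemma exists_not_mem_of_two_lt_index {G : Type*} [CommGroup G] {H : Subgroup G} (h : 2 < H.index)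
    (d : G) : ∃ x, x ∉ H ∧ d * x ∉ H := by
  by_contra! hc
  have hs : Function.Surjective fun b : Bool => ((if b then 1 else d⁻¹ : G) : G ⧸ H) := by
    intro q
    obtain ⟨x, rfl⟩ := QuotientGroup.mk_surjective q
    by_cases hx : x ∈ H
    · exact ⟨true, QuotientGroup.eq.2 (by simpa using hx)⟩
    · exact ⟨false, QuotientGroup.eq.2 (by simpa using hc x hx)⟩
  have := Nat.card_le_card_of_surjective _ hs
  rw [Nat.card_eq_fintype_card (α := Bool), Fintype.card_bool] at this
  exact absurd h (not_lt.2 this)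

lemma two_lt_index_loc {K : Type*} [Field K] [NumberField K] (v : Prm K) :
    2 < (loc (.inl v : Plc K)).index := by
  have h1 := index_nsq v
  have h2 := cNum_pos v
  change 2 < (nsq v.val).index
  omega

lemma exists_neg_at_real {A : Type*} [Field A] [NumberField A] (T : Finset (Prm A))
    (x : Prm A → Aˣ) : ∃ t : Aˣ, (∀ v ∈ T, t * (x v)⁻¹ ∈ loc (.inl v)) ∧
      ∀ v : NumberField.InfinitePlace A, v.IsReal → t ∉ loc (.inr v) := by
  obtain ⟨t, ht⟩ := approx T (Sum.elim x fun _ => -1)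
  refine ⟨t, fun v hv => ht _ (inl_mem_plc.2 hv), fun v hv h => ?_⟩
  have h1 := mul_mem (inv_mem h) (ht (.inr v) inr_mem_plc)
  rw [inv_mul_cancel_left] at h1
  have h2 : 0 < (v.embedding (((-1 : Aˣ)⁻¹ : Aˣ) : A)).re := h1 hv
  norm_num at h2

lemma exists_not_mem_loc_map {A K : Type*} [Field A] [NumberField A] [Field K] [NumberField K]
    [Algebra A K] {d : A} {r : K} {σ : K ≃ₐ[A] K} (hq : IsQuad A K d r σ) (T : Finset (Prm K)) :
    ∃ t : Aˣ, (∀ w ∈ T, Units.map (algebraMap A K : A →* K) t ∉ loc (.inl w)) ∧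
      ∀ w : NumberField.InfinitePlace K, w.IsReal →
        Units.map (algebraMap A K : A →* K) t ∉ loc (.inr w) := by
  classical
  have hd : d ≠ 0 := by
    rintro rfl
    exact hq.ne (pow_eq_zero_iff two_ne_zero |>.1 (by simpa using hq.sq))
  choose x hx hdx using fun v : Prm A =>
    exists_not_mem_of_two_lt_index (two_lt_index_loc v) (Units.mk0 d hd)
  obtain ⟨t, ht, hinf⟩ := exists_neg_at_real (T.image (below A)) x
  refine ⟨t, fun w hw h => ?_, fun w hw h => ?_⟩
  · have hv := ht (below A w) (Finset.mem_image_of_mem _ hw)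
    rcases nearSq_below_or w hq (x := (t : A)) h with h1 | h1
    · apply hx (below A w)
      have := mul_mem (inv_mem hv) (show t ∈ loc (.inl (below A w)) from h1)
      simpa using this
    · apply hdx (below A w)
      have := mul_mem (inv_mem hv) (show Units.mk0 d hd * t ∈ loc (.inl (below A w)) from h1)
      rwa [mul_inv_rev, inv_inv, mul_comm _ t, mul_assoc, inv_mul_cancel_left, mul_comm] at this
  · obtain ⟨hv, h1⟩ := mem_posAt_comap (K := A) hw (x := t)
    exact hinf _ hv (h1.1 h)

variable {F X : Type*} [Field F] [Ring X] [Algebra F X]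
  {ι : Type*} [Fintype ι] [DecidableEq ι]

variable (X ι) in
/-- The algebra is split by adjoining the square root of any element which is negative at the real
places and is not a local square at a given finite set of primes. -/
def SplKum (A : Type u) [Field A] [NumberField A] (i : F →+* A) : Prop :=
  ∃ B : Finset (Prm A), ∀ t : Aˣ, (∀ v ∈ B, t ∉ loc (.inl v)) →
    (∀ v : NumberField.InfinitePlace A, v.IsReal → t ∉ loc (.inr v)) →
    ∀ (M : Type u) [Field M] (j : A →+* M), IsSquare (j t) → Spl ι X (j.comp i)

lemma SplKum.of_spl {A : Type u} [Field A] [NumberField A] {i : F →+* A} (h : Spl ι X i) :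
    SplKum X ι A i :=
  ⟨∅, fun _ _ _ _ _ j _ => h.map j⟩

instance (A : Type*) [Field A] [NumberField A] : Nonempty (Prm A) := by
  obtain ⟨I, h1, h2⟩ := Ring.not_isField_iff_exists_prime.1
    (NumberField.RingOfIntegers.not_isField A)
  exact ⟨⟨I, h2, h1⟩⟩

variable [FiniteDimensional F X] [Algebra.IsCentral F X] [IsSimpleRing X]

lemma SplKum.of_isQuad (hι : Fintype.card ι ^ 2 = Module.finrank F X)
    {Ψ : X → X → Matrix (ι × ι) (ι × ι) F} (hΨ : IsKr.{u} Ψ) {A K : Type u} [Field A]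
    [NumberField A] [Field K] [NumberField K] [Algebra A K] {d : A} {r : K} {σ : K ≃ₐ[A] K}
    (hq : IsQuad A K d r σ) {i : F →+* A} (h : SplKum X ι K ((algebraMap A K).comp i)) :
    SplKum X ι A i := by
  classical
  obtain ⟨B, hB⟩ := h
  obtain ⟨w₀⟩ := (inferInstance : Nonempty (Prm K))
  obtain ⟨t, ht, htinf⟩ := exists_not_mem_loc_map hq (insert w₀ B)
  have htsq : ¬ IsSquare (algebraMap A K t) := by
    rintro ⟨y, hy⟩
    have hy0 : y ≠ 0 := by rintro rfl; simp at hy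
    refine ht w₀ (Finset.mem_insert_self _ _) ?_
    rw [mem_loc_inl]
    change NearSq _ (algebraMap A K t)
    rw [hy, ← pow_two]
    exact nearSq_sq hy0
  obtain ⟨E, _, _, _, s, τ, hE⟩ := exists_isQuad_numberField htsq
  have hS := hB (Units.map (algebraMap A K : A →* K) t)
    (fun v hv => ht v (Finset.mem_insert_of_mem hv)) htinf E (algebraMap K E)
    ⟨s, by rw [← pow_two, hE.sq]; rfl⟩
  rw [← RingHom.comp_assoc] at hS
  obtain ⟨e, g, he, hg, hS⟩ := exists_spl_of_sol_sol hι hΨ hq hE hS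
  have hd : d ≠ 0 := by
    rintro rfl
    exact hq.ne (pow_eq_zero_iff two_ne_zero |>.1 (by simpa using hq.sq))
  obtain ⟨v₀⟩ := (inferInstance : Nonempty (Prm A))
  obtain ⟨S, hv₀, -, hS2, hxs⟩ := exists_good_set {v₀}
    {Units.mk0 d hd, Units.mk0 e he, t, Units.mk0 g hg}
  refine ⟨S, fun t' ht' htinf' M _ j hj => ?_⟩
  have ht'sq : ¬ IsSquare (t' : A) := by
    rintro ⟨y, hy⟩
    have hy0 : y ≠ 0 := by rintro rfl; simp at hy
    refine ht' v₀ (hv₀ (Finset.mem_singleton_self _)) ?_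
    rw [mem_loc_inl, hy, ← pow_two]
    exact nearSq_sq hy0
  obtain ⟨L, _, _, _, y, ρ, hL⟩ := exists_isQuad_numberField ht'sq
  have hLsq : IsSquare (algebraMap A L t') := ⟨y, by rw [← pow_two, hL.sq]⟩
  have hsol : ∀ a b : Aˣ, a ∈ uS S → b ∈ uS S →
      Sol L (algebraMap A L a) (algebraMap A L b) := by
    intro a b ha hb
    refine hasse_norm (a := Units.map (algebraMap A L : A →* L) a)
      (b := Units.map (algebraMap A L : A →* L) b) fun w => ?_
    rcases w with w | w
    · by_cases hw : below A w ∈ S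
      · exact mem_nrm_of_isSquare w (ht' _ hw) hLsq a b
      · refine mem_nrm_of_units ?_ ((val_eq_one_iff_below w).2 (ha _ hw))
          ((val_eq_one_iff_below w).2 (hb _ hw))
        have := (val_eq_one_iff_below w).2 (hS2 _ hw)
        rwa [map_ofNat] at this
    · have hw : ¬ w.IsReal := by
        intro hw
        obtain ⟨hv, h1⟩ := mem_posAt_comap (K := A) hw (x := t')
        refine htinf' _ hv (h1.1 ?_)
        have hy0 : y ≠ 0 := hL.ne
        have h2 : Units.map (algebraMap A L : A →* L) t' = Units.mk0 y hy0 ^ 2 :=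
          Units.ext (by simpa using hL.sq.symm)
        rw [h2]
        exact sq_mem_loc (.inr w) _
      have h3 : (loc (.inr w : Plc L)) = ⊤ := posAt_complex hw
      exact loc_le_nrm _ _ (h3 ▸ Subgroup.mem_top _)
  have hSL := hS L (algebraMap A L)
    (hsol (Units.mk0 d hd) (Units.mk0 e he) (hxs _ (by simp)) (hxs _ (by simp)))
    (hsol t (Units.mk0 g hg) (hxs _ (by simp)) (hxs _ (by simp)))
  obtain ⟨m, hm⟩ := hj
  obtain ⟨φ, hφ, -⟩ : ∃ φ : L →+* M, φ.comp (algebraMap A L) = j ∧ φ y = m :=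
    hL.exists_lift j (by rw [hm, pow_two])
  have := hSL.map φ
  rwa [← RingHom.comp_assoc, hφ] at this

end SplKum

section QuadraticSplitting

universe u

lemma isPrimitiveRoot_two_pow_succ {A : Type*} [Field A] {z y : A} {j : ℕ}
    (hz : IsPrimitiveRoot z (2 ^ (j + 1))) (hy : y ^ 2 = z) : IsPrimitiveRoot y (2 ^ (j + 2)) := by
  have : Fact (Nat.Prime 2) := ⟨Nat.prime_two⟩
  have h : orderOf y = 2 ^ (j + 1 + 1) := by
    refine orderOf_eq_prime_pow ?_ ?_
    · intro h
      rw [pow_succ', pow_mul, hy] at h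
      exact absurd ((hz.pow_eq_one_iff_dvd _).1 h)
        (Nat.not_dvd_of_pos_of_lt (by positivity) (Nat.pow_lt_pow_right one_lt_two (by omega)))
    · rw [pow_succ', pow_mul, hy, hz.pow_eq_one]
  have h' := IsPrimitiveRoot.orderOf y
  rwa [h] at h'

variable {X : Type*} [Ring X] [IsSimpleRing X] {ι : Type*} [Fintype ι] [DecidableEq ι]
  {F : Type u} [Field F] [NumberField F] [Algebra F X] [FiniteDimensional F X]
  [Algebra.IsCentral F X]

lemma SplCyc.splKum (hι : Fintype.card ι ^ 2 = Module.finrank F X)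
    {Ψ : X → X → Matrix (ι × ι) (ι × ι) F} (hΨ : IsKr.{u} Ψ) (h : SplCyc X ι F (RingHom.id F)) :
    SplKum X ι F (RingHom.id F) := by
  obtain ⟨k, hk⟩ := h
  have key : ∀ (m j : ℕ), k ≤ j + 1 + m → ∀ (A : Type u) [Field A] [NumberField A] (i : F →+* A)
      (z : A), IsPrimitiveRoot z (2 ^ (j + 1)) → SplKum X ι A i := by
    intro m
    induction m with
    | zero =>
      intro j hj A _ _ i z hz
      exact SplKum.of_spl (hk (j + 1) hj A i z hz)
    | succ m ih =>
      intro j hj A _ _ i z hz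
      by_cases hsq : IsSquare z
      · obtain ⟨y, hy⟩ := hsq
        exact ih (j + 1) (by omega) A i y
          (isPrimitiveRoot_two_pow_succ hz (by rw [hy, pow_two]))
      · obtain ⟨L, _, _, _, r, σ, hq⟩ := exists_isQuad_numberField hsq
        exact SplKum.of_isQuad hι hΨ hq (ih (j + 1) (by omega) L _ r
          (isPrimitiveRoot_two_pow_succ (hz.map_of_injective (algebraMap A L).injective) hq.sq))
  refine key k 0 (by omega) F _ (-1) ?_
  rw [zero_add, pow_one]
  exact IsPrimitiveRoot.neg_one 0 two_ne_zero.symm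

lemma SplKum.exists_quadratic (h : SplKum X ι F (RingHom.id F)) :
    ∃ (L : Type u) (_ : Field L) (_ : Algebra F L), Module.finrank F L = 2 ∧
      Spl ι X (algebraMap F L) := by
  classical
  obtain ⟨B, hB⟩ := h
  obtain ⟨v₀⟩ := (inferInstance : Nonempty (Prm F))
  choose x hx _ using fun v : Prm F => exists_not_mem_of_two_lt_index (two_lt_index_loc v) 1
  obtain ⟨t, ht, hinf⟩ := exists_neg_at_real (insert v₀ B) x
  have ht' : ∀ v ∈ insert v₀ B, t ∉ loc (.inl v) := fun v hv h =>
    hx v (by simpa using mul_mem (inv_mem (ht v hv)) h)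
  have htsq : ¬ IsSquare (t : F) := by
    rintro ⟨y, hy⟩
    have hy0 : y ≠ 0 := by rintro rfl; simp at hy
    refine ht' v₀ (Finset.mem_insert_self _ _) ?_
    rw [mem_loc_inl, hy, ← pow_two]
    exact nearSq_sq hy0
  obtain ⟨L, _, _, _, r, σ, hq⟩ := exists_isQuad_numberField htsq
  exact ⟨L, inferInstance, inferInstance, hq.finrank_eq_two,
    hB t (fun v hv => ht' v (Finset.mem_insert_of_mem hv)) hinf L (algebraMap F L)
      ⟨r, by rw [← pow_two, hq.sq]⟩⟩

end QuadraticSplitting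

section Wedderburn

lemma card_mul_finrank_dvd {F D V ι : Type*} [Field F] [DivisionRing D] [Algebra F D]
    [AddCommGroup V] [Module F V] [FiniteDimensional F V] [Fintype ι] [DecidableEq ι] [Nonempty ι]
    (G : Matrix ι ι D →ₐ[F] Module.End F V) :
    Fintype.card ι * Module.finrank F D ∣ Module.finrank F V := by
  obtain ⟨a⟩ := (inferInstance : Nonempty ι)
  let _ : Module D V := Module.compHom V (G.toRingHom.comp (Matrix.scalar ι))
  have hsmul : ∀ (d : D) (v : V), d • v = G (Matrix.scalar ι d) v := fun _ _ => rfl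
  have : IsScalarTower F D V := ⟨fun c d v => by
    rw [hsmul, hsmul, ← LinearMap.smul_apply, ← map_smul]
    congr 2
    ext i j
    simp [Matrix.diagonal_apply]⟩
  have hcomm : ∀ (d : D) i j, Matrix.scalar ι d * Matrix.single i j 1 =
      Matrix.single i j 1 * Matrix.scalar ι d := fun d i j => by
    ext p q
    simp [Matrix.single_apply]
  let e : ι → ι → V →ₗ[D] V := fun i j =>
    { toFun := G (Matrix.single i j 1)
      map_add' := map_add _
      map_smul' := fun d v => by
        simp only [hsmul, RingHom.id_apply, ← Module.End.mul_apply, ← map_mul, hcomm] }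
  have he : ∀ i j k v, e i j (e j k v) = e i k v := fun i j k v => by
    change G _ (G _ v) = G _ v
    rw [← Module.End.mul_apply, ← map_mul, Matrix.single_mul_single_same, one_mul]
  have he' : ∀ i j k l v, j ≠ k → e i j (e k l v) = 0 := fun i j k l v h => by
    change G _ (G _ v) = 0
    rw [← Module.End.mul_apply, ← map_mul, Matrix.single_mul_single_of_ne _ _ _ _ h, map_zero,
      LinearMap.zero_apply]
  have hsum : ∀ v, ∑ i, e i i v = v := fun v => by
    change ∑ i, G (Matrix.single i i 1) v = v
    rw [← LinearMap.sum_apply, ← map_sum, Matrix.sum_single_one, map_one, Module.End.one_apply]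
  let U : Submodule D V := LinearMap.range (e a a)
  have hU : ∀ u : U, e a a u = u := by
    rintro ⟨_, v, rfl⟩
    exact he a a a v
  let Φ : (ι → U) ≃ₗ[D] V :=
    { toFun := fun u => ∑ i, e i a (u i)
      map_add' := fun u u' => by simp [Finset.sum_add_distrib]
      map_smul' := fun d u => by simp [Finset.smul_sum]
      invFun := fun v i => ⟨e a i v, e a i v, he a a i v⟩
      left_inv := fun u => by
        ext j
        change e a j (∑ i, e i a (u i)) = u j
        rw [map_sum, Finset.sum_eq_single j (fun i _ hij => he' _ _ _ _ _ hij.symm) (by simp), he,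
          hU]
      right_inv := fun v => by
        change ∑ i, e i a (e a i v) = v
        simp only [he, hsum] }
  have : Module.Finite D V := Module.Finite.of_restrictScalars_finite F D V
  have h1 := Φ.finrank_eq
  rw [Module.finrank_pi_fintype, Finset.sum_const, Finset.card_univ, smul_eq_mul] at h1
  rw [← Module.finrank_mul_finrank F D V, ← h1]
  exact ⟨Module.finrank D U, by ring⟩

lemma isCentral_of_algEquiv_matrix {F X D ι : Type*} [Field F] [Ring X] [Algebra F X]
    [Algebra.IsCentral F X] [DivisionRing D] [Algebra F D] [Fintype ι] [DecidableEq ι] [Nonempty ι]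
    (f : X ≃ₐ[F] Matrix ι ι D) : Algebra.IsCentral F D := by
  obtain ⟨a⟩ := (inferInstance : Nonempty ι)
  refine ⟨fun d hd => ?_⟩
  rw [Subalgebra.mem_center_iff] at hd
  have h1 : f.symm (Matrix.scalar ι d) ∈ Subalgebra.center F X := by
    rw [Subalgebra.mem_center_iff]
    intro x
    apply f.injective
    rw [map_mul, map_mul, f.apply_symm_apply]
    ext i j
    simp [hd]
  obtain ⟨c, hc⟩ := Algebra.mem_bot.1 (Algebra.IsCentral.out h1)
  refine Algebra.mem_bot.2 ⟨c, ?_⟩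
  have h2 := congrArg (fun x => f x a a) hc
  simpa [Matrix.algebraMap_matrix_apply] using h2

lemma countable_of_finiteDimensional (F D : Type*) [Field F] [NumberField F] [Ring D] [Algebra F D]
    [FiniteDimensional F D] : Countable D := by
  have : Countable F := (Module.finBasis ℚ F).equivFun.toEquiv.countable_iff.2 inferInstance
  exact (Module.finBasis F D).equivFun.toEquiv.countable_iff.2 inferInstance

/-- A central simple algebra split by a quadratic extension is a matrix algebra over the base field
or over a quaternion algebra. -/
theorem matrix_or_quaternion_of_spl {F X L : Type*} [Field F] [NumberField F] [Ring X]
    [Algebra F X] [FiniteDimensional F X] [Algebra.IsCentral F X] [IsSimpleRing X] [Field L]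
    [Algebra F L] (hL : Module.finrank F L = 2) {m : ℕ} (hm : m ^ 2 = Module.finrank F X)
    (hS : Spl (Fin m) X (algebraMap F L)) :
    (∃ n, 0 < n ∧ Nonempty (X ≃ₐ[F] Matrix (Fin n) (Fin n) F)) ∨
    (∃ (n : ℕ) (D : Type) (_ : DivisionRing D) (_ : Algebra F D), 0 < n ∧ Algebra.IsCentral F D ∧
      Module.finrank F D = 4 ∧ Nonempty (X ≃ₐ[F] Matrix (Fin n) (Fin n) D)) := by
  have : IsArtinianRing X := isArtinian_of_tower F inferInstance
  obtain ⟨n, hn, D, _, _, _, ⟨f⟩⟩ := IsSimpleRing.exists_algEquiv_matrix_divisionRing_finite F X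
  have : FiniteDimensional F L := Module.finite_of_finrank_pos (by omega)
  obtain ⟨ρ, hρ⟩ := hS
  let G : X →ₐ[F] Module.End F (Fin m → L) :=
    { (Module.toModuleEnd F (S := Module.End L (Fin m → L)) (Fin m → L)).comp
        ((Matrix.toLinAlgEquiv' : Matrix (Fin m) (Fin m) L ≃ₐ[L] _).toRingEquiv.toRingHom.comp
          ρ) with
      commutes' := fun c => by
        refine LinearMap.ext fun v => ?_
        change (ρ (algebraMap F X c)).mulVec v = c • v
        rw [hρ, Matrix.smul_mulVec, Matrix.one_mulVec, algebraMap_smul] }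
  have hdvd := card_mul_finrank_dvd (G.comp (f.symm : Matrix (Fin n) (Fin n) D →ₐ[F] X))
  have hV : Module.finrank F (Fin m → L) = m * 2 := by
    rw [Module.finrank_pi_fintype, Finset.sum_const, Finset.card_univ, Fintype.card_fin, hL,
      smul_eq_mul]
  rw [hV, Fintype.card_fin] at hdvd
  have hX : Module.finrank F X = n * n * Module.finrank F D := by
    rw [f.toLinearEquiv.finrank_eq, Module.finrank_matrix, Fintype.card_fin]
  have hD : 0 < Module.finrank F D := Module.finrank_pos
  have hn0 : 0 < n := Nat.pos_of_ne_zero hn.out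
  have hm0 : 0 < m := by
    refine Nat.pos_of_ne_zero ?_
    rintro rfl
    rw [hX] at hm
    have : 0 < n * n * Module.finrank F D := by positivity
    omega
  obtain ⟨q, hq⟩ := hdvd
  have hqD : q * q * Module.finrank F D = 4 := by
    have h1 : (m * m) * (q * q * Module.finrank F D) = (m * m) * 4 := by
      have h2 : (m * 2) * (m * 2) = (n * Module.finrank F D * q) * (n * Module.finrank F D * q) := by
        rw [hq]
      have h3 : m * m = n * n * Module.finrank F D := by rw [← hX, ← hm, pow_two]
      calc _ = (n * n * Module.finrank F D) * (q * q * Module.finrank F D) := by rw [h3]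
        _ = (n * Module.finrank F D * q) * (n * Module.finrank F D * q) := by ring
        _ = _ := by rw [← h2]; ring
    exact Nat.eq_of_mul_eq_mul_left (by positivity) h1
  have hq2 : q = 1 ∨ q = 2 := by
    have : q ≤ 2 := by
      by_contra! h
      nlinarith
    have : q ≠ 0 := by rintro rfl; omega
    omega
  rcases hq2 with rfl | rfl
  · right
    have := countable_of_finiteDimensional F D
    let g : D ≃ₐ[F] Shrink.{0} D := (Shrink.algEquiv.{0} F D).symm
    have f' := f.trans g.mapMatrix
    exact ⟨n, Shrink.{0} D, inferInstance, inferInstance, hn0, isCentral_of_algEquiv_matrix f',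
      by rw [← g.toLinearEquiv.finrank_eq]; omega, ⟨f'⟩⟩
  · left
    have h1 : Module.finrank F D = 1 := by omega
    have hbij : Function.Bijective (Algebra.ofId F D) :=
      ⟨(algebraMap F D).injective, fun x => Algebra.mem_bot.1
        ((Subalgebra.bot_eq_top_of_finrank_eq_one h1).ge (Algebra.mem_top (x := x)))⟩
    exact ⟨n, hn0, ⟨f.trans (AlgEquiv.ofBijective _ hbij).symm.mapMatrix⟩⟩

end Wedderburn

universe u v in
lemma matrix_or_quaternion_of_tensor_self (F : Type u) [Field F] [NumberField F] (X : Type v)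
    [Ring X] [Algebra F X] [FiniteDimensional F X] [Algebra.IsCentral F X] [IsSimpleRing X]
    (h2 : ∃ m : ℕ, 0 < m ∧ Nonempty ((X ⊗[F] X) ≃ₐ[F] Matrix (Fin m) (Fin m) F)) :
    (∃ n, 0 < n ∧ Nonempty (X ≃ₐ[F] Matrix (Fin n) (Fin n) F)) ∨
    (∃ (n : ℕ) (D : Type) (_ : DivisionRing D) (_ : Algebra F D), 0 < n ∧ Algebra.IsCentral F D ∧
      Module.finrank F D = 4 ∧ Nonempty (X ≃ₐ[F] Matrix (Fin n) (Fin n) D)) := by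
  obtain ⟨n, hn, E, _, _, _, _, hS⟩ := exists_spl F X
  obtain ⟨Ψ, hΨ⟩ : ∃ Ψ, IsKr.{u} Ψ := exists_isKr hn h2
  obtain ⟨L, _, _, hL, hSL⟩ := ((splCyc hn hΨ hS).splKum hn hΨ).exists_quadratic
  exact matrix_or_quaternion_of_spl hL (by simpa using hn) hSL

end TwoTorsionCSA

/-- Let `F` be a number field and `X` a central simple `F`-algebra whose Brauer class is
2-torsion (i.e. `X ⊗_F X` is a matrix algebra over `F`).  Then `X` is isomorphic either to
a matrix algebra `M_n(F)` or to a matrix algebra `M_n(D)` over a quaternion division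
algebra `D` over `F` (a central division algebra of dimension 4). -/
theorem two_torsion_csa_matrix_or_quaternion
    (F : Type*) [Field F] [NumberField F]
    (X : Type*) [Ring X] [Algebra F X] [FiniteDimensional F X]
    [Algebra.IsCentral F X] [IsSimpleRing X]
    (h2 : ∃ m : ℕ, 0 < m ∧ Nonempty ((X ⊗[F] X) ≃ₐ[F] Matrix (Fin m) (Fin m) F)) :
    (∃ n : ℕ, 0 < n ∧ Nonempty (X ≃ₐ[F] Matrix (Fin n) (Fin n) F)) ∨
    (∃ (n : ℕ) (D : Type) (_ : DivisionRing D) (_ : Algebra F D), 0 < n ∧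
      Algebra.IsCentral F D ∧ Module.finrank F D = 4 ∧
      Nonempty (X ≃ₐ[F] Matrix (Fin n) (Fin n) D)) := by
  exact TwoTorsionCSA.matrix_or_quaternion_of_tensor_self F X h2
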